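/- Let Ω ⊆ ℝ² be a bounded open convex set and set r = h(Ω)^{-1}. Then the unique Cheeger set E of Ω is the union of all balls of radius r contained in Ω; equivalently E = E_r + B_r(0) (Minkowski sum), where E_r = {x ∈ Ω : dist(x, ∂Ω) > r}. Moreover the inner Cheeger formula |E_r| = π r² holds. -/

import Mathlib

open MeasureTheory Metric Set Filter
open scoped ENNReal NNReal Topology Pointwise

noncomputable section

/-- The divergence of a vector field on `ℝⁿ`. -/
def divergence {n : ℕ} (g : EuclideanSpace ℝ (Fin n) → EuclideanSpace ℝ (Fin n))
    (x : EuclideanSpace ℝ (Fin n)) : ℝ :=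
  LinearMap.trace ℝ (EuclideanSpace ℝ (Fin n)) (fderiv ℝ g x).toLinearMap

/-- The (distributional) perimeter of a set `F ⊆ ℝⁿ`:
`P(F) = sup {∫_F div g : g ∈ C¹_c(ℝⁿ;ℝⁿ), ‖g‖ ≤ 1}`. -/
def perimeter {n : ℕ} (F : Set (EuclideanSpace ℝ (Fin n))) : ℝ≥0∞ :=
  ⨆ g ∈ {g : EuclideanSpace ℝ (Fin n) → EuclideanSpace ℝ (Fin n) |
      ContDiff ℝ 1 g ∧ HasCompactSupport g ∧ ∀ x, ‖g x‖ ≤ 1},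
    ENNReal.ofReal (∫ x in F, divergence g x)

/-- The Cheeger constant of `Ω`:
`h(Ω) = inf {P(F) / |F| : F ⊆ Ω Borel, |F| > 0}`. -/
def cheegerConstant {n : ℕ} (Ω : Set (EuclideanSpace ℝ (Fin n))) : ℝ≥0∞ :=
  ⨅ F ∈ {F : Set (EuclideanSpace ℝ (Fin n)) | MeasurableSet F ∧ F ⊆ Ω ∧ 0 < volume F},
    perimeter F / volume F

/-- `F` is a Cheeger set in `Ω`: a Borel subset of `Ω` of positive volume
whose ratio `P(F)/|F|` attains the Cheeger constant of `Ω`. -/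
def IsCheegerSet {n : ℕ} (Ω F : Set (EuclideanSpace ℝ (Fin n))) : Prop :=
  MeasurableSet F ∧ F ⊆ Ω ∧ 0 < volume F ∧ perimeter F / volume F = cheegerConstant Ω

namespace PlanarCheeger

/-- The Euclidean plane. -/
abbrev Plane := EuclideanSpace ℝ (Fin 2)

/-- The unit vector with angle `θ`. -/
def dir (θ : ℝ) : Plane := !₂[Real.cos θ, Real.sin θ]

/-- The unit vector with angle `θ + π / 2`. -/
def nrm (θ : ℝ) : Plane := !₂[-Real.sin θ, Real.cos θ]

/-- The point with coordinates `(s, τ)` in the frame `(dir θ, nrm θ)`. -/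
def pt (θ s τ : ℝ) : Plane := s • dir θ + τ • nrm θ

/-- Coordinate along `nrm θ`. -/
def ht (θ : ℝ) (x : Plane) : ℝ := Real.cos θ * x 1 - Real.sin θ * x 0

/-- Coordinate along `dir θ`. -/
def lg (θ : ℝ) (x : Plane) : ℝ := Real.cos θ * x 0 + Real.sin θ * x 1

lemma pt_apply_zero (θ s τ : ℝ) : pt θ s τ 0 = s * Real.cos θ - τ * Real.sin θ := by
  simp [pt, dir, nrm]; ring

lemma pt_apply_one (θ s τ : ℝ) : pt θ s τ 1 = s * Real.sin θ + τ * Real.cos θ := by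
  simp [pt, dir, nrm]

lemma pt_lg_ht (θ : ℝ) (x : Plane) : pt θ (lg θ x) (ht θ x) = x := by
  have h := Real.sin_sq_add_cos_sq θ
  ext i
  fin_cases i
  · simp only [Fin.zero_eta, Fin.isValue, pt_apply_zero, lg, ht]
    linear_combination (x 0) * h
  · simp only [Fin.mk_one, Fin.isValue, pt_apply_one, lg, ht]
    linear_combination (x 1) * h

lemma ht_pt (θ s τ : ℝ) : ht θ (pt θ s τ) = τ := by
  have h := Real.sin_sq_add_cos_sq θ
  simp only [ht, pt_apply_zero, pt_apply_one]
  linear_combination τ * h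

lemma lg_pt (θ s τ : ℝ) : lg θ (pt θ s τ) = s := by
  have h := Real.sin_sq_add_cos_sq θ
  simp only [lg, pt_apply_zero, pt_apply_one]
  linear_combination s * h

lemma norm_sq_eq (x : Plane) : ‖x‖ ^ 2 = x 0 ^ 2 + x 1 ^ 2 := by
  rw [EuclideanSpace.norm_sq_eq]; simp

lemma norm_sq_eq_lg_ht (θ : ℝ) (x : Plane) : ‖x‖ ^ 2 = lg θ x ^ 2 + ht θ x ^ 2 := by
  have h := Real.sin_sq_add_cos_sq θ
  rw [norm_sq_eq, lg, ht]
  linear_combination -(x 0 ^ 2 + x 1 ^ 2) * h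

lemma abs_ht_le (θ : ℝ) (x : Plane) : |ht θ x| ≤ ‖x‖ := by
  apply abs_le_of_sq_le_sq _ (norm_nonneg x)
  rw [norm_sq_eq_lg_ht θ]; nlinarith [sq_nonneg (lg θ x)]

lemma ht_add (θ : ℝ) (x y : Plane) : ht θ (x + y) = ht θ x + ht θ y := by simp [ht]; ring

lemma ht_smul (θ c : ℝ) (x : Plane) : ht θ (c • x) = c * ht θ x := by simp [ht]; ring

lemma ht_sub (θ : ℝ) (x y : Plane) : ht θ (x - y) = ht θ x - ht θ y := by simp [ht]; ring

lemma norm_dir (θ : ℝ) : ‖dir θ‖ = 1 := by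
  have h := Real.sin_sq_add_cos_sq θ
  rw [← sq_eq_sq₀ (norm_nonneg _) zero_le_one, norm_sq_eq]
  simp [dir]

lemma norm_nrm (θ : ℝ) : ‖nrm θ‖ = 1 := by
  have h := Real.sin_sq_add_cos_sq θ
  rw [← sq_eq_sq₀ (norm_nonneg _) zero_le_one, norm_sq_eq]
  simp [nrm]

lemma pt_sub_pt (θ s s' τ : ℝ) : pt θ s τ - pt θ s' τ = (s - s') • dir θ := by
  simp only [pt, sub_smul]; abel

lemma continuous_dir : Continuous dir := by
  unfold dir
  exact (PiLp.continuous_toLp 2 _).comp (by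
    apply continuous_pi; intro i; fin_cases i
    · exact Real.continuous_cos
    · exact Real.continuous_sin)

lemma continuous_nrm : Continuous nrm := by
  unfold nrm
  exact (PiLp.continuous_toLp 2 _).comp (by
    apply continuous_pi; intro i; fin_cases i
    · exact Real.continuous_sin.neg
    · exact Real.continuous_cos)

lemma continuous_pt : Continuous (fun p : ℝ × ℝ × ℝ => pt p.1 p.2.1 p.2.2) := by
  unfold pt
  have := continuous_dir; have := continuous_nrm
  fun_prop

lemma continuous_ht : Continuous (fun p : ℝ × Plane => ht p.1 p.2) := by
  unfold ht; fun_prop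

/-- The frame `(dir θ, nrm θ)` as an orthonormal basis. -/
def frame (θ : ℝ) : OrthonormalBasis (Fin 2) ℝ Plane :=
  OrthonormalBasis.mk (v := ![dir θ, nrm θ])
    (by
      refine ⟨fun i => ?_, fun i j hij => ?_⟩
      · fin_cases i
        · exact norm_dir θ
        · exact norm_nrm θ
      · fin_cases i <;> fin_cases j <;>
          simp [dir, nrm, PiLp.inner_apply, Fin.sum_univ_two] at hij ⊢ <;> ring)
    (by
      intro x _
      rw [← pt_lg_ht θ x]
      refine Submodule.add_mem _ (Submodule.smul_mem _ _ (Submodule.subset_span ⟨0, rfl⟩))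
        (Submodule.smul_mem _ _ (Submodule.subset_span ⟨1, rfl⟩)))

lemma coe_frame (θ : ℝ) : ⇑(frame θ) = ![dir θ, nrm θ] := OrthonormalBasis.coe_mk _ _

lemma measurePreserving_pt (θ : ℝ) :
    MeasurePreserving (fun p : ℝ × ℝ => pt θ p.1 p.2) (volume.prod volume) volume := by
  have h1 := (volume_preserving_finTwoArrow ℝ).symm
  have h2 := PiLp.volume_preserving_toLp (Fin 2)
  have h3 := (frame θ).measurePreserving_repr_symm
  have h := h3.comp (h2.comp h1)
  have e : (fun p : ℝ × ℝ => pt θ p.1 p.2) = fun p =>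
      (frame θ).repr.symm (WithLp.toLp 2 (MeasurableEquiv.finTwoArrow.symm p)) := by
    funext p
    rw [← OrthonormalBasis.sum_repr_symm]
    simp [Fin.sum_univ_two, pt, coe_frame]
  rw [e]
  exact h

lemma lintegral_eq_frame (θ : ℝ) {G : Plane → ℝ≥0∞} (hG : Measurable G) :
    ∫⁻ x, G x = ∫⁻ τ, ∫⁻ s, G (pt θ s τ) := by
  have h := measurePreserving_pt θ
  rw [← h.lintegral_comp hG]
  exact lintegral_prod_symm' _ (hG.comp h.measurable)

lemma ae_lines (θ : ℝ) {P : Plane → Prop} (h : ∀ᵐ x, P x) :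
    ∀ᵐ τ : ℝ, ∀ᵐ s : ℝ, P (pt θ s τ) := by
  have h1 := (measurePreserving_pt θ).quasiMeasurePreserving.ae h
  have h2 : ∀ᵐ p : ℝ × ℝ ∂(volume.prod volume), P (pt θ p.2 p.1) :=
    (Measure.measurePreserving_swap (μ := (volume : Measure ℝ))
      (ν := (volume : Measure ℝ))).quasiMeasurePreserving.ae h1
  exact Measure.ae_ae_of_ae_prod h2

lemma integral_abs_cos : ∫ θ in (0 : ℝ)..(2 * Real.pi), |Real.cos θ| = 4 := by
  have hper : Function.Periodic (fun θ => |Real.cos θ|) (2 * Real.pi) := fun x => by simp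
  have h0 := hper.intervalIntegral_add_eq 0 (-(Real.pi / 2))
  rw [zero_add] at h0
  rw [h0]
  have hc : Continuous fun θ => |Real.cos θ| := Real.continuous_cos.abs
  rw [← intervalIntegral.integral_add_adjacent_intervals (b := Real.pi / 2)
    (hc.intervalIntegrable _ _) (hc.intervalIntegrable _ _)]
  have e1 : ∫ θ in (-(Real.pi / 2))..(Real.pi / 2), |Real.cos θ| = 2 := by
    rw [intervalIntegral.integral_congr (g := Real.cos)]
    · rw [integral_cos]; simp; norm_num
    · intro θ hθ
      rw [uIcc_of_le (by linarith [Real.pi_pos])] at hθ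
      exact abs_of_nonneg (Real.cos_nonneg_of_mem_Icc hθ)
  have e2 : ∫ θ in (Real.pi / 2)..(-(Real.pi / 2) + 2 * Real.pi), |Real.cos θ| = 2 := by
    rw [intervalIntegral.integral_congr (g := fun θ => - Real.cos θ)]
    · rw [intervalIntegral.integral_neg, integral_cos]; simp; norm_num
    · intro θ hθ
      rw [uIcc_of_le (by linarith [Real.pi_pos])] at hθ
      exact abs_of_nonpos (Real.cos_nonpos_of_pi_div_two_le_of_le hθ.1 (by linarith [hθ.2]))
  rw [e1, e2]; norm_num

lemma inner_dir (v : Plane) (θ : ℝ) :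
    inner ℝ v (dir θ) = v 0 * Real.cos θ + v 1 * Real.sin θ := by
  simp [dir, PiLp.inner_apply, Fin.sum_univ_two]; ring

lemma exists_polar (v : Plane) : ∃ a : ℝ, v 0 = ‖v‖ * Real.cos a ∧ v 1 = ‖v‖ * Real.sin a := by
  have hn : ‖(⟨v 0, v 1⟩ : ℂ)‖ = ‖v‖ := by
    rw [← sq_eq_sq₀ (norm_nonneg _) (norm_nonneg _), norm_sq_eq, Complex.sq_norm,
      Complex.normSq_apply]; ring
  refine ⟨Complex.arg ⟨v 0, v 1⟩, ?_, ?_⟩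
  · rw [← hn, Complex.norm_mul_cos_arg]
  · rw [← hn, Complex.norm_mul_sin_arg]

lemma integral_abs_inner_dir (v : Plane) :
    ∫ θ in (0 : ℝ)..(2 * Real.pi), |inner ℝ v (dir θ)| = 4 * ‖v‖ := by
  obtain ⟨a, h0, h1⟩ := exists_polar v
  have h : ∀ θ, |inner ℝ v (dir θ)| = ‖v‖ * |Real.cos (θ - a)| := by
    intro θ
    rw [inner_dir, h0, h1, Real.cos_sub, ← abs_of_nonneg (norm_nonneg v), ← abs_mul,
      abs_of_nonneg (norm_nonneg v)]
    congr 1; ring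
  simp only [h]
  rw [intervalIntegral.integral_const_mul, intervalIntegral.integral_comp_sub_right
    (fun θ => |Real.cos θ|)]
  have hper : Function.Periodic (fun θ => |Real.cos θ|) (2 * Real.pi) := fun x => by simp
  have h2 := hper.intervalIntegral_add_eq 0 (0 - a)
  rw [zero_add, integral_abs_cos] at h2
  rw [show 2 * Real.pi - a = 0 - a + 2 * Real.pi by ring, ← h2]; ring

lemma lintegral_enorm_apply_dir (L : Plane →L[ℝ] ℝ) :
    ∫⁻ θ in Ioo 0 (2 * Real.pi), ‖L (dir θ)‖ₑ = 4 * ‖L‖ₑ := by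
  set v := (InnerProductSpace.toDual ℝ Plane).symm L with hv
  have hL : ∀ y, L y = inner ℝ v y := fun y => by
    rw [hv, InnerProductSpace.toDual_symm_apply]
  have hn : ‖v‖ = ‖L‖ := by rw [hv, LinearIsometryEquiv.norm_map]
  have h := integral_abs_inner_dir v
  have hc : Continuous fun θ => |inner ℝ v (dir θ)| := (continuous_const.inner continuous_dir).abs
  rw [intervalIntegral.integral_of_le (by positivity), integral_Ioc_eq_integral_Ioo] at h
  have hi : IntegrableOn (fun θ => |inner ℝ v (dir θ)|) (Ioo 0 (2 * Real.pi)) :=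
    (hc.integrableOn_Icc (a := 0) (b := 2 * Real.pi)).mono_set Ioo_subset_Icc_self
  have h2 := ofReal_integral_eq_lintegral_ofReal hi (Eventually.of_forall fun _ => abs_nonneg _)
  rw [h, hn] at h2
  simp_rw [hL, Real.enorm_eq_ofReal_abs]
  rw [← h2, ENNReal.ofReal_mul (by norm_num), ofReal_norm]
  norm_num

/-- The integral-geometric formula for gradients. -/
lemma four_mul_lintegral_fderiv (u : Plane → ℝ) {w : Plane → ℝ≥0∞} (hw : Measurable w) :
    4 * ∫⁻ x, w x * ‖fderiv ℝ u x‖ₑ = ∫⁻ θ in Ioo 0 (2 * Real.pi), ∫⁻ τ, ∫⁻ s,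
      w (pt θ s τ) * ‖fderiv ℝ u (pt θ s τ) (dir θ)‖ₑ := by
  have hm := measurable_fderiv ℝ u
  have hj : Measurable fun p : ℝ × Plane => w p.2 * ‖fderiv ℝ u p.2 (dir p.1)‖ₑ := by
    refine (hw.comp measurable_snd).mul (Measurable.enorm ?_)
    have : Continuous fun q : (Plane →L[ℝ] ℝ) × Plane => q.1 q.2 :=
      isBoundedBilinearMap_apply.continuous
    exact this.measurable.comp ((hm.comp measurable_snd).prodMk
      (continuous_dir.measurable.comp measurable_fst))
  have h1 : ∀ θ, ∫⁻ τ, ∫⁻ s, w (pt θ s τ) * ‖fderiv ℝ u (pt θ s τ) (dir θ)‖ₑ =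
      ∫⁻ x, w x * ‖fderiv ℝ u x (dir θ)‖ₑ := fun θ =>
    (lintegral_eq_frame θ (G := fun x => w x * ‖fderiv ℝ u x (dir θ)‖ₑ)
      (hj.comp measurable_prodMk_left)).symm
  simp_rw [h1]
  rw [lintegral_lintegral_swap hj.aemeasurable, ← lintegral_const_mul' _ _ (by norm_num)]
  refine lintegral_congr fun x => ?_
  rw [lintegral_const_mul, lintegral_enorm_apply_dir]
  · ring
  · exact ((fderiv ℝ u x).continuous.comp continuous_dir).measurable.enorm

lemma hasDerivAt_line {u : Plane → ℝ} {θ s τ : ℝ} (h : DifferentiableAt ℝ u (pt θ s τ)) :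
    HasDerivAt (fun s => u (pt θ s τ)) (fderiv ℝ u (pt θ s τ) (dir θ)) s := by
  have h1 : HasDerivAt (fun s => pt θ s τ) (dir θ) s := by
    unfold pt
    simpa using ((hasDerivAt_id s).smul_const (dir θ)).add_const (τ • nrm θ)
  exact h.hasFDerivAt.comp_hasDerivAt s h1

/-- `ht θ` as a linear map. -/
def htLin (θ : ℝ) : Plane →ₗ[ℝ] ℝ where
  toFun := ht θ
  map_add' := ht_add θ
  map_smul' := ht_smul θ

/-- The orthogonal projection of `A` to the line spanned by `nrm θ`. -/
def shadow (θ : ℝ) (A : Set Plane) : Set ℝ := ht θ '' A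

/-- The integral of the widths of `A` over all directions. -/
def totalWidth (A : Set Plane) : ℝ≥0∞ :=
  ∫⁻ θ in Ioo 0 (2 * Real.pi), volume (shadow θ A)

lemma mem_shadow {θ τ : ℝ} {A : Set Plane} : τ ∈ shadow θ A ↔ ∃ s, pt θ s τ ∈ A := by
  constructor
  · rintro ⟨x, hx, rfl⟩
    exact ⟨lg θ x, by rwa [pt_lg_ht]⟩
  · rintro ⟨s, hs⟩
    exact ⟨_, hs, ht_pt _ _ _⟩

lemma shadow_mono (θ : ℝ) {A B : Set Plane} (h : A ⊆ B) : shadow θ A ⊆ shadow θ B :=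
  image_mono h

lemma totalWidth_mono {A B : Set Plane} (h : A ⊆ B) : totalWidth A ≤ totalWidth B :=
  lintegral_mono fun θ => measure_mono (shadow_mono θ h)

lemma isOpen_setOf_mem_shadow {A : Set Plane} (hA : IsOpen A) :
    IsOpen {p : ℝ × ℝ | p.2 ∈ shadow p.1 A} := by
  have : {p : ℝ × ℝ | p.2 ∈ shadow p.1 A} =
      ⋃ s : ℝ, (fun p : ℝ × ℝ => pt p.1 s p.2) ⁻¹' A := by
    ext p; simp [mem_shadow]
  rw [this]
  refine isOpen_iUnion fun s => hA.preimage ?_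
  exact continuous_pt.comp (continuous_fst.prodMk (continuous_const.prodMk continuous_snd))

lemma isOpen_shadow (θ : ℝ) {A : Set Plane} (hA : IsOpen A) : IsOpen (shadow θ A) :=
  (isOpen_setOf_mem_shadow hA).preimage (Continuous.prodMk_right θ)

lemma continuous_ht_right (θ : ℝ) : Continuous (ht θ) :=
  continuous_ht.comp (Continuous.prodMk_right θ)

lemma isPreconnected_shadow (θ : ℝ) {A : Set Plane} (hA : IsPreconnected A) :
    IsPreconnected (shadow θ A) :=
  hA.image _ (continuous_ht_right θ).continuousOn

lemma dist_le_of_mem_shadow {θ τ τ' D : ℝ} {A : Set Plane} (hA : ∀ x ∈ A, ∀ y ∈ A, dist x y ≤ D)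
    (h : τ ∈ shadow θ A) (h' : τ' ∈ shadow θ A) : |τ - τ'| ≤ D := by
  obtain ⟨x, hx, rfl⟩ := h
  obtain ⟨y, hy, rfl⟩ := h'
  rw [← ht_sub]
  exact (abs_ht_le θ _).trans (by rw [← dist_eq_norm]; exact hA x hx y hy)

lemma isBounded_shadow (θ : ℝ) {A : Set Plane} (hA : Bornology.IsBounded A) :
    Bornology.IsBounded (shadow θ A) := by
  obtain ⟨D, hD⟩ := Metric.isBounded_iff.1 hA
  refine Metric.isBounded_iff.2 ⟨D, fun τ hτ τ' hτ' => ?_⟩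
  rw [Real.dist_eq]
  exact dist_le_of_mem_shadow (fun x hx y hy => hD hx hy) hτ hτ'

lemma exists_eq_Ioo {S : Set ℝ} (h1 : IsOpen S) (h2 : IsPreconnected S)
    (h3 : Bornology.IsBounded S) (h4 : S.Nonempty) : ∃ a b, a < b ∧ S = Ioo a b := by
  have hb := h3.bddBelow
  have ha := h3.bddAbove
  have hsub : S ⊆ Ioo (sInf S) (sSup S) := by
    intro x hx
    obtain ⟨ε, hε, hball⟩ := Metric.isOpen_iff.1 h1 x hx
    have e1 : x - ε / 2 ∈ S :=
      hball (by rw [mem_ball, Real.dist_eq, abs_lt]; constructor <;> linarith)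
    have e2 : x + ε / 2 ∈ S :=
      hball (by rw [mem_ball, Real.dist_eq, abs_lt]; constructor <;> linarith)
    exact ⟨lt_of_le_of_lt (csInf_le hb e1) (by linarith),
      lt_of_lt_of_le (by linarith) (le_csSup ha e2)⟩
  have heq : S = Ioo (sInf S) (sSup S) :=
    subset_antisymm hsub (IsConnected.Ioo_csInf_csSup_subset ⟨h4, h2⟩ hb ha)
  refine ⟨_, _, ?_, heq⟩
  obtain ⟨x, hx⟩ := h4
  exact (hsub hx).1.trans (hsub hx).2

lemma shadow_eq_Ioo (θ : ℝ) {A : Set Plane} (h1 : IsOpen A) (h2 : IsPreconnected A)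
    (h3 : Bornology.IsBounded A) (h4 : A.Nonempty) : ∃ a b, a < b ∧ shadow θ A = Ioo a b :=
  exists_eq_Ioo (isOpen_shadow θ h1) (isPreconnected_shadow θ h2) (isBounded_shadow θ h3)
    (h4.image _)

lemma volume_shadow_le (θ : ℝ) {A : Set Plane} {D : ℝ} (h1 : IsOpen A) (h2 : IsPreconnected A)
    (hA : ∀ x ∈ A, ∀ y ∈ A, dist x y ≤ D) : volume (shadow θ A) ≤ ENNReal.ofReal D := by
  rcases A.eq_empty_or_nonempty with h4 | h4
  · simp [h4, shadow]
  obtain ⟨a, b, hab, h⟩ := shadow_eq_Ioo θ h1 h2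
    (Metric.isBounded_iff.2 ⟨D, fun x hx y hy => hA x hx y hy⟩) h4
  rw [h, Real.volume_Ioo]
  apply ENNReal.ofReal_le_ofReal
  apply le_of_forall_pos_le_add
  intro ε hε
  set δ := min (ε / 2) ((b - a) / 4)
  have hδ : 0 < δ := lt_min (by linarith) (by linarith)
  have hδ1 : δ ≤ ε / 2 := min_le_left _ _
  have hδ2 : δ ≤ (b - a) / 4 := min_le_right _ _
  have e1 : a + δ ∈ shadow θ A := by rw [h]; constructor <;> linarith
  have e2 : b - δ ∈ shadow θ A := by rw [h]; constructor <;> linarith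
  have := (le_abs_self _).trans (dist_le_of_mem_shadow hA e2 e1)
  linarith

lemma volume_Ioo_two_pi : volume (Ioo 0 (2 * Real.pi)) = ENNReal.ofReal (2 * Real.pi) := by
  rw [Real.volume_Ioo, sub_zero]

lemma totalWidth_lt_top {A : Set Plane} (h3 : Bornology.IsBounded A) : totalWidth A < ∞ := by
  obtain ⟨D, hD⟩ := h3.subset_closedBall 0
  have : ∀ θ, volume (shadow θ A) ≤ volume (Icc (-D) D) := fun θ => by
    apply measure_mono
    rintro _ ⟨x, hx, rfl⟩
    have := (abs_ht_le θ x).trans (mem_closedBall_zero_iff.1 (hD hx))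
    exact abs_le.1 this
  refine (lintegral_mono this).trans_lt ?_
  rw [lintegral_const, Measure.restrict_apply_univ, volume_Ioo_two_pi, Real.volume_Icc]
  exact ENNReal.mul_lt_top ENNReal.ofReal_lt_top ENNReal.ofReal_lt_top

lemma shadow_homothety (θ : ℝ) (x₀ : Plane) (t : ℝ) (A : Set Plane) :
    shadow θ (AffineMap.homothety x₀ t '' A) =
      AffineMap.homothety (ht θ x₀) t '' shadow θ A := by
  simp only [shadow, image_image]
  refine image_congr fun x _ => ?_
  simp only [AffineMap.homothety_apply, vsub_eq_sub, vadd_eq_add, ht_add, ht_smul, ht_sub,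
    smul_eq_mul]

lemma totalWidth_homothety (x₀ : Plane) {t : ℝ} (ht : 0 ≤ t) (A : Set Plane) :
    totalWidth (AffineMap.homothety x₀ t '' A) = ENNReal.ofReal t * totalWidth A := by
  unfold totalWidth
  rw [← lintegral_const_mul' _ _ ENNReal.ofReal_ne_top]
  refine lintegral_congr fun θ => ?_
  rw [shadow_homothety, Measure.addHaar_image_homothety]
  simp [abs_of_nonneg ht]

lemma totalWidth_add_ball_le {A : Set Plane} (h1 : IsOpen A) (h2 : IsPreconnected A)
    (h3 : Bornology.IsBounded A) {r : ℝ} (hr : 0 ≤ r) :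
    totalWidth (A + ball (0 : Plane) r) ≤ totalWidth A + ENNReal.ofReal (4 * Real.pi * r) := by
  rcases A.eq_empty_or_nonempty with h4 | h4
  · simp [h4, totalWidth, shadow]
  have : ∀ θ, volume (shadow θ (A + ball (0 : Plane) r)) ≤
      volume (shadow θ A) + ENNReal.ofReal (2 * r) := fun θ => by
    obtain ⟨a, b, hab, h⟩ := shadow_eq_Ioo θ h1 h2 h3 h4
    have hs : shadow θ (A + ball (0 : Plane) r) ⊆ Ioo (a - r) (b + r) := by
      rintro _ ⟨_, ⟨x, hx, y, hy, rfl⟩, rfl⟩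
      have hx' : ht θ x ∈ Ioo a b := h ▸ ⟨x, hx, rfl⟩
      have hy' := abs_lt.1 ((abs_ht_le θ y).trans_lt (mem_ball_zero_iff.1 hy))
      simp only [ht_add]
      exact ⟨by linarith [hx'.1, hy'.1], by linarith [hx'.2, hy'.2]⟩
    refine (measure_mono hs).trans ?_
    rw [h, Real.volume_Ioo, Real.volume_Ioo, ← ENNReal.ofReal_add (by linarith) (by linarith)]
    exact ENNReal.ofReal_le_ofReal (by linarith)
  refine (lintegral_mono this).trans ?_
  rw [lintegral_add_right _ measurable_const, lintegral_const, Measure.restrict_apply_univ,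
    volume_Ioo_two_pi, ← ENNReal.ofReal_mul (by positivity)]
  exact le_of_eq (by rw [totalWidth]; congr 2; ring)

lemma shadow_convexHull (θ : ℝ) {A : Set Plane} (hA : IsPreconnected A) :
    shadow θ (convexHull ℝ A) = shadow θ A := by
  refine subset_antisymm ?_ (shadow_mono θ (subset_convexHull ℝ A))
  have hc : Convex ℝ (shadow θ A) := (isPreconnected_shadow θ hA).ordConnected.convex
  rintro _ ⟨x, hx, rfl⟩
  exact convexHull_min (fun y hy => (⟨y, hy, rfl⟩ : htLin θ y ∈ shadow θ A))
    (hc.linear_preimage (htLin θ)) hx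

lemma totalWidth_convexHull {A : Set Plane} (hA : IsPreconnected A) :
    totalWidth (convexHull ℝ A) = totalWidth A := by
  simp_rw [totalWidth, shadow_convexHull _ hA]

section Line

variable {φ : ℝ → ℝ} {K : ℝ≥0}

lemma ofReal_abs_sub_le_lintegral_deriv (hφ : LipschitzWith K φ) {a b : ℝ} (hab : a ≤ b) :
    ENNReal.ofReal |φ b - φ a| ≤ ∫⁻ x in Ioc a b, ‖deriv φ x‖ₑ := by
  have hac := hφ.lipschitzOnWith (s := uIcc a b) |>.absolutelyContinuousOnInterval
  rw [← hac.integral_deriv_eq_sub, intervalIntegral.integral_of_le hab, ← Real.enorm_eq_ofReal_abs]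
  exact enorm_integral_le_lintegral_enorm _

lemma lintegral_deriv_eq_of_nonneg (hφ : LipschitzWith K φ) {a b : ℝ} (hab : a ≤ b)
    (h : ∀ x ∈ Ioo a b, 0 ≤ deriv φ x) :
    ∫⁻ x in Ioc a b, ‖deriv φ x‖ₑ = ENNReal.ofReal (φ b - φ a) := by
  have hac := hφ.lipschitzOnWith (s := uIcc a b) |>.absolutelyContinuousOnInterval
  have hi := hac.intervalIntegrable_deriv
  rw [intervalIntegrable_iff_integrableOn_Ioo_of_le hab] at hi
  rw [← hac.integral_deriv_eq_sub, intervalIntegral.integral_of_le hab,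
    integral_Ioc_eq_integral_Ioo, Measure.restrict_congr_set (Ioo_ae_eq_Ioc (a := a) (b := b)).symm,
    ofReal_integral_eq_lintegral_ofReal hi
      ((ae_restrict_iff' measurableSet_Ioo).2 (Eventually.of_forall h))]
  refine setLIntegral_congr_fun measurableSet_Ioo fun x hx => ?_
  simp only [Real.enorm_eq_ofReal (h x hx)]

lemma deriv_eq_zero_of_notMem_Icc {A B : ℝ} (h0 : ∀ x ∉ Icc A B, φ x = 0) {x : ℝ}
    (hx : x ∉ Icc A B) : deriv φ x = 0 := by
  have : φ =ᶠ[𝓝 x] fun _ => 0 := by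
    filter_upwards [isClosed_Icc.isOpen_compl.mem_nhds hx] with y hy using h0 y hy
  rw [this.deriv_eq, deriv_const]

lemma lintegral_deriv_le_of_quasiconcave (hφ : LipschitzWith K φ) {A B M : ℝ}
    (h0 : ∀ x ∉ Icc A B, φ x = 0) (hM : ∀ x, φ x ≤ M) (hnn : ∀ x, 0 ≤ φ x)
    (hq : QuasiconcaveOn ℝ univ φ) :
    ∫⁻ x, ‖deriv φ x‖ₑ ≤ 2 * ENNReal.ofReal M := by
  rcases lt_or_ge B A with hAB | hAB
  · have : ∀ x, deriv φ x = 0 := fun x => deriv_eq_zero_of_notMem_Icc h0 (by simp [hAB])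
    simp [this]
  obtain ⟨c, hc, hmax⟩ := isCompact_Icc.exists_isMaxOn (nonempty_Icc.2 hAB)
    hφ.continuous.continuousOn
  have hmax' : ∀ x, φ x ≤ φ c := fun x => by
    by_cases hx : x ∈ Icc A B
    · exact hmax hx
    · rw [h0 x hx]; exact hnn c
  have hseg : ∀ x y z, x ≤ y → y ≤ z → min (φ x) (φ z) ≤ φ y := fun x y z hxy hyz => by
    have hs := (hq (min (φ x) (φ z))).ordConnected
    exact (hs.out ⟨mem_univ _, min_le_left _ _⟩ ⟨mem_univ _, min_le_right _ _⟩ ⟨hxy, hyz⟩).2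
  have hmono : MonotoneOn φ (Iio c) := fun x _ y hy hxy => by
    have := hseg x y c hxy (le_of_lt hy)
    rwa [min_eq_left (hmax' x)] at this
  have hanti : AntitoneOn φ (Ioi c) := fun x hx y _ hxy => by
    have := hseg c x y (le_of_lt hx) hxy
    rwa [min_eq_right (hmax' y)] at this
  have hd1 : ∀ x ∈ Ioo (A - 1) c, 0 ≤ deriv φ x := fun x hx => by
    rw [← derivWithin_of_isOpen isOpen_Iio hx.2]
    exact hmono.derivWithin_nonneg
  have hd2 : ∀ x ∈ Ioo c (B + 1), 0 ≤ deriv (-φ) x := fun x hx => by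
    rw [deriv.neg, ← derivWithin_of_isOpen isOpen_Ioi hx.1, neg_nonneg]
    exact hanti.derivWithin_nonpos
  have e1 := lintegral_deriv_eq_of_nonneg hφ (by linarith [hc.1]) hd1
  have e2 := lintegral_deriv_eq_of_nonneg hφ.neg (by linarith [hc.2]) hd2
  have z1 : φ (A - 1) = 0 := h0 _ (fun h => by linarith [h.1])
  have z2 : φ (B + 1) = 0 := h0 _ (fun h => by linarith [h.2])
  rw [z1, sub_zero] at e1
  simp only [deriv.neg, enorm_neg, Pi.neg_apply, z2, neg_zero, zero_sub, neg_neg] at e2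
  have hsplit : ∫⁻ x, ‖deriv φ x‖ₑ = ∫⁻ x in Ioc (A - 1) (B + 1), ‖deriv φ x‖ₑ := by
    symm
    apply setLIntegral_eq_of_support_subset
    intro x hx
    by_contra hx'
    apply hx
    have : x ∉ Icc A B := fun h => hx' ⟨by linarith [h.1], by linarith [h.2]⟩
    simp [deriv_eq_zero_of_notMem_Icc h0 this]
  rw [hsplit, ← Ioc_union_Ioc_eq_Ioc (b := c) (by linarith [hc.1]) (by linarith [hc.2])]
  refine (lintegral_union_le _ _ _).trans ?_
  rw [e1, e2, two_mul]
  exact add_le_add (ENNReal.ofReal_le_ofReal (hM c)) (ENNReal.ofReal_le_ofReal (hM c))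

lemma two_mul_le_lintegral_deriv (hφ : LipschitzWith K φ) {A B : ℝ}
    (h0 : ∀ x ∉ Icc A B, φ x = 0) (c : ℝ) :
    2 * ENNReal.ofReal (φ c) ≤ ∫⁻ x, ‖deriv φ x‖ₑ := by
  by_cases hc : c ∈ Icc A B
  swap
  · simp [h0 c hc]
  have e1 := ofReal_abs_sub_le_lintegral_deriv hφ (a := A - 1) (b := c) (by linarith [hc.1])
  have e2 := ofReal_abs_sub_le_lintegral_deriv hφ (a := c) (b := B + 1) (by linarith [hc.2])
  have z1 : φ (A - 1) = 0 := h0 _ (fun h => by linarith [h.1])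
  have z2 : φ (B + 1) = 0 := h0 _ (fun h => by linarith [h.2])
  rw [z1, sub_zero] at e1
  rw [z2, zero_sub, abs_neg] at e2
  have hle := ENNReal.ofReal_le_ofReal (le_abs_self (φ c))
  calc 2 * ENNReal.ofReal (φ c) ≤ (∫⁻ x in Ioc (A - 1) c, ‖deriv φ x‖ₑ) +
        ∫⁻ x in Ioc c (B + 1), ‖deriv φ x‖ₑ := by
        rw [two_mul]; exact add_le_add (hle.trans e1) (hle.trans e2)
    _ = ∫⁻ x in Ioc (A - 1) c ∪ Ioc c (B + 1), ‖deriv φ x‖ₑ := by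
        rw [lintegral_union measurableSet_Ioc]
        exact Ioc_disjoint_Ioc_of_le le_rfl
    _ ≤ _ := setLIntegral_le_lintegral _ _

lemma ofReal_integral_le_lintegral_comp_mul_deriv {k : ℝ → ℝ} (hφ : ContDiff ℝ 1 φ)
    (hk : Continuous k) (hk0 : ∀ x, 0 ≤ k x) {a b : ℝ} (hab : a ≤ b) (t : ℝ) :
    ENNReal.ofReal |∫ y in (φ a - t)..(φ b - t), k y| ≤
      ∫⁻ x in Ioo a b, ENNReal.ofReal (k (φ x - t)) * ‖deriv φ x‖ₑ := by
  have h := intervalIntegral.integral_comp_mul_deriv (a := a) (b := b) (f := fun x => φ x - t)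
    (f' := deriv φ) (g := k)
    (fun x _ => ((hφ.differentiable one_ne_zero) x).hasDerivAt.sub_const t)
    (hφ.continuous_deriv le_rfl).continuousOn hk
  rw [← h, intervalIntegral.integral_of_le hab, ← Real.enorm_eq_ofReal_abs,
    integral_Ioc_eq_integral_Ioo]
  refine (enorm_integral_le_lintegral_enorm _).trans (le_of_eq ?_)
  refine lintegral_congr fun x => ?_
  simp only [Function.comp_apply, enorm_mul]
  rw [Real.enorm_eq_ofReal (hk0 _)]

lemma exists_Ioo_superlevel (hφ : Continuous φ) {A B c t : ℝ} (hA : A < c) (hB : c < B)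
    (hφA : φ A ≤ t) (hφB : φ B ≤ t) (hc : t < φ c) :
    ∃ a b, a < c ∧ c < b ∧ φ a = t ∧ φ b = t ∧ ∀ x ∈ Ioo a b, t < φ x := by
  set S := Icc A c ∩ {x | φ x ≤ t} with hS
  set T := Icc c B ∩ {x | φ x ≤ t} with hT
  have hcl : IsClosed {x | φ x ≤ t} := isClosed_le hφ continuous_const
  have hSc : IsCompact S := isCompact_Icc.inter_right hcl
  have hTc : IsCompact T := isCompact_Icc.inter_right hcl
  have ha := hSc.sSup_mem ⟨A, ⟨⟨le_rfl, hA.le⟩, hφA⟩⟩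
  have hb := hTc.sInf_mem ⟨B, ⟨⟨hB.le, le_rfl⟩, hφB⟩⟩
  set a := sSup S
  set b := sInf T
  have hac : a < c := lt_of_le_of_ne ha.1.2 fun h => by
    have := ha.2; rw [h] at this; exact absurd this (not_le.2 hc)
  have hbc : c < b := lt_of_le_of_ne hb.1.1 fun h => by
    have := hb.2; rw [← h] at this; exact absurd this (not_le.2 hc)
  have hgt : ∀ x ∈ Ioo a b, t < φ x := by
    intro x hx
    by_contra! hle
    rcases le_total x c with h | h
    · exact absurd (le_csSup hSc.bddAbove ⟨⟨ha.1.1.trans hx.1.le, h⟩, hle⟩) (not_le.2 hx.1)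
    · exact absurd (csInf_le hTc.bddBelow ⟨⟨h, hx.2.le.trans hb.1.2⟩, hle⟩) (not_le.2 hx.2)
  have hcl2 : IsClosed {x | t ≤ φ x} := isClosed_le continuous_const hφ
  have hcc : Icc a b ⊆ {x | t ≤ φ x} := by
    rw [← closure_Ioo (hac.trans hbc).ne]
    exact closure_minimal (fun x hx => (hgt x hx).le) hcl2
  exact ⟨a, b, hac, hbc, le_antisymm ha.2 (hcc ⟨le_rfl, (hac.trans hbc).le⟩),
    le_antisymm hb.2 (hcc ⟨(hac.trans hbc).le, le_rfl⟩), hgt⟩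

lemma two_mul_integral_le_lintegral_comp {k : ℝ → ℝ} (hφ : ContDiff ℝ 1 φ)
    (hk : Continuous k) (hk0 : ∀ x, 0 ≤ k x) {a b c t : ℝ} (hac : a < c) (hcb : c < b)
    (ha : φ a = t) (hb : φ b = t) :
    2 * ENNReal.ofReal (∫ y in (0 : ℝ)..(φ c - t), k y) ≤
      ∫⁻ x in Ioo a b, ENNReal.ofReal (k (φ x - t)) * ‖deriv φ x‖ₑ := by
  have e1 := ofReal_integral_le_lintegral_comp_mul_deriv hφ hk hk0 hac.le t
  have e2 := ofReal_integral_le_lintegral_comp_mul_deriv hφ hk hk0 hcb.le t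
  rw [ha, sub_self] at e1
  rw [hb, sub_self, intervalIntegral.integral_symm, abs_neg] at e2
  have hle := ENNReal.ofReal_le_ofReal (le_abs_self (∫ y in (0 : ℝ)..(φ c - t), k y))
  set G : ℝ → ℝ≥0∞ := fun x => ENNReal.ofReal (k (φ x - t)) * ‖deriv φ x‖ₑ
  calc 2 * ENNReal.ofReal (∫ y in (0 : ℝ)..(φ c - t), k y)
      ≤ (∫⁻ x in Ioo a c, G x) + ∫⁻ x in Ioo c b, G x := by
        rw [two_mul]; exact add_le_add (hle.trans e1) (hle.trans e2)
    _ = ∫⁻ x in Ioo a c ∪ Ioo c b, G x := by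
        rw [lintegral_union measurableSet_Ioo]
        exact Set.disjoint_left.2 fun x hx hx' => absurd hx.2 (not_lt.2 hx'.1.le)
    _ ≤ _ := lintegral_mono_set (union_subset (Ioo_subset_Ioo_right hcb.le)
        (Ioo_subset_Ioo_left hac.le))

end Line

lemma norm_fderiv_infDist {S : Set Plane} (hS : IsClosed S) (hne : S.Nonempty) {x : Plane}
    (hx : x ∉ S) (hd : DifferentiableAt ℝ (fun y => infDist y S) x) :
    ‖fderiv ℝ (fun y => infDist y S) x‖ = 1 := by
  have hlip : LipschitzWith 1 (fun y => infDist y S) := lipschitz_infDist_pt S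
  refine le_antisymm (by simpa using norm_fderiv_le_of_lipschitz ℝ hlip (x₀ := x)) ?_
  obtain ⟨y, hy, hxy⟩ := hS.exists_infDist_eq_dist hne x
  have hpos : 0 < dist x y := dist_pos.2 fun h => hx (h ▸ hy)
  set L := fderiv ℝ (fun y => infDist y S) x
  have hline : HasDerivAt (fun t : ℝ => x + t • (y - x)) (y - x) 0 := by
    simpa using ((hasDerivAt_id (0 : ℝ)).smul_const (y - x)).const_add x
  have h1 : HasDerivAt (fun t : ℝ => infDist (x + t • (y - x)) S) (L (y - x)) 0 := by
    have h0 : HasFDerivAt (fun y => infDist y S) L (x + (0 : ℝ) • (y - x)) := by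
      simpa using hd.hasFDerivAt
    exact h0.comp_hasDerivAt (0 : ℝ) hline
  have hval : ∀ t ∈ Icc (0 : ℝ) 1, infDist (x + t • (y - x)) S = (1 - t) * dist x y := by
    intro t ht
    apply le_antisymm
    · refine (infDist_le_dist_of_mem hy).trans (le_of_eq ?_)
      rw [dist_eq_norm, dist_eq_norm, show x + t • (y - x) - y = (1 - t) • (x - y) by module,
        norm_smul, Real.norm_of_nonneg (by linarith [ht.2])]
    · have := hlip.dist_le_mul x (x + t • (y - x))
      rw [Real.dist_eq, hxy, dist_eq_norm x (x + _),
        show x - (x + t • (y - x)) = t • (x - y) by module, norm_smul,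
        Real.norm_of_nonneg ht.1, ← dist_eq_norm] at this
      have := (le_abs_self _).trans this
      simp only [NNReal.coe_one, one_mul] at this
      linarith
  have h2 : HasDerivAt (fun t : ℝ => (1 - t) * dist x y) (-dist x y) 0 := by
    simpa using ((hasDerivAt_id (0 : ℝ)).const_sub 1).mul_const (dist x y)
  have h3 : L (y - x) = -dist x y := by
    have hw1 := h1.hasDerivWithinAt (s := Icc 0 1)
    have hw2 := (h2.hasDerivWithinAt (s := Icc 0 1)).congr hval (hval 0 (by simp))
    exact (uniqueDiffOn_Icc (zero_lt_one' ℝ) 0 (by simp)).eq_deriv _ hw1 hw2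
  have h4 := L.le_opNorm (y - x)
  rw [h3, norm_neg, Real.norm_of_nonneg hpos.le, ← dist_eq_norm, dist_comm y x] at h4
  nlinarith

/-- The distance to the complement. -/
def inDist (Q : Set Plane) (x : Plane) : ℝ := infDist x Qᶜ

/-- The closed inner parallel set. -/
def innerSet (Q : Set Plane) (s : ℝ) : Set Plane := {x | s ≤ inDist Q x}

lemma lipschitz_inDist (Q : Set Plane) : LipschitzWith 1 (inDist Q) := lipschitz_infDist_pt _

lemma continuous_inDist (Q : Set Plane) : Continuous (inDist Q) := (lipschitz_inDist Q).continuous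

lemma inDist_nonneg (Q : Set Plane) (x : Plane) : 0 ≤ inDist Q x := infDist_nonneg

section Bounded

variable {Q : Set Plane}

lemma inDist_of_notMem {x : Plane} (hx : x ∉ Q) : inDist Q x = 0 :=
  infDist_zero_of_mem hx

lemma compl_nonempty_of_isBounded (hb : Bornology.IsBounded Q) : Qᶜ.Nonempty := by
  rw [nonempty_compl]
  rintro rfl
  exact NormedSpace.unbounded_univ ℝ Plane hb

lemma inDist_pos (ho : IsOpen Q) (hb : Bornology.IsBounded Q) {x : Plane} :
    0 < inDist Q x ↔ x ∈ Q := by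
  rw [inDist, ← ho.isClosed_compl.notMem_iff_infDist_pos (compl_nonempty_of_isBounded hb),
    notMem_compl_iff]

lemma ball_subset_iff (hb : Bornology.IsBounded Q) {x : Plane} {s : ℝ} :
    ball x s ⊆ Q ↔ s ≤ inDist Q x := by
  constructor
  · intro h
    refine (le_infDist (compl_nonempty_of_isBounded hb)).2 fun y hy => ?_
    by_contra! hlt
    exact hy (h (by rwa [mem_ball, dist_comm]))
  · intro h y hy
    by_contra hyQ
    have := infDist_le_dist_of_mem (s := Qᶜ) (x := x) hyQ
    rw [mem_ball, dist_comm] at hy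
    exact absurd (h.trans this) (not_le.2 hy)

lemma exists_line_inDist (ho : IsOpen Q) (hb : Bornology.IsBounded Q) (x : Plane) :
    ∃ y, dist x y = inDist Q x ∧
      ∀ t ∈ Icc (0 : ℝ) 1, inDist Q (x + t • (y - x)) ≤ (1 - t) * inDist Q x := by
  obtain ⟨y, hy, hxy⟩ := ho.isClosed_compl.exists_infDist_eq_dist (compl_nonempty_of_isBounded hb) x
  refine ⟨y, hxy.symm, fun t ht => (infDist_le_dist_of_mem hy).trans (le_of_eq ?_)⟩
  rw [dist_eq_norm, inDist, hxy, dist_eq_norm,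
    show x + t • (y - x) - y = (1 - t) • (x - y) by module,
    norm_smul, Real.norm_of_nonneg (by linarith [ht.2])]

lemma concaveOn_inDist (ho : IsOpen Q) (hb : Bornology.IsBounded Q) (hc : Convex ℝ Q) :
    ConcaveOn ℝ Q (inDist Q) := by
  refine ⟨hc, fun x hx y hy a b ha hb' hab => ?_⟩
  rw [← ball_subset_iff hb]
  have hxp := (inDist_pos ho hb).2 hx
  have hyp := (inDist_pos ho hb).2 hy
  have h1 := (ball_subset_iff hb).2 (le_refl (inDist Q x))
  have h2 := (ball_subset_iff hb).2 (le_refl (inDist Q y))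
  set p := inDist Q x
  set q := inDist Q y
  simp only [smul_eq_mul]
  have hpos : 0 < a * p + b * q := by
    rcases ha.eq_or_lt with h | h
    · have : b = 1 := by linarith
      rw [← h, this]; linarith
    · positivity
  intro z hz
  set v := (a * p + b * q)⁻¹ • (z - (a • x + b • y)) with hv
  have hvn : ‖v‖ < 1 := by
    rw [hv, norm_smul, norm_inv, Real.norm_of_nonneg hpos.le, inv_mul_lt_iff₀ hpos, mul_one,
      ← dist_eq_norm]
    exact hz
  have hzv : z = a • (x + p • v) + b • (y + q • v) := by
    have : (a * p + b * q) • v = z - (a • x + b • y) := by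
      rw [hv, smul_smul, mul_inv_cancel₀ hpos.ne', one_smul]
    calc z = (a • x + b • y) + (a * p + b * q) • v := by rw [this]; abel
      _ = _ := by module
  rw [hzv]
  refine hc (h1 ?_) (h2 ?_) ha hb' hab
  · rw [mem_ball, dist_eq_norm, add_sub_cancel_left, norm_smul, Real.norm_of_nonneg hxp.le]
    nlinarith
  · rw [mem_ball, dist_eq_norm, add_sub_cancel_left, norm_smul, Real.norm_of_nonneg hyp.le]
    nlinarith

lemma quasiconcaveOn_inDist (ho : IsOpen Q) (hb : Bornology.IsBounded Q) (hc : Convex ℝ Q) :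
    QuasiconcaveOn ℝ univ (inDist Q) := by
  intro r
  rcases le_or_gt r 0 with hr | hr
  · convert convex_univ (𝕜 := ℝ) (E := Plane)
    ext x; simp [hr.trans (inDist_nonneg Q x)]
  · have : {x | x ∈ univ ∧ r ≤ inDist Q x} = {x | x ∈ Q ∧ r ≤ inDist Q x} := by
      ext x
      exact ⟨fun h => ⟨(inDist_pos ho hb).1 (hr.trans_le h.2), h.2⟩, fun h => ⟨mem_univ x, h.2⟩⟩
    rw [this]
    exact (concaveOn_inDist ho hb hc).quasiconcaveOn r

lemma convex_innerSet (ho : IsOpen Q) (hb : Bornology.IsBounded Q) (hc : Convex ℝ Q) (s : ℝ) :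
    Convex ℝ (innerSet Q s) := by
  simpa [innerSet] using quasiconcaveOn_inDist ho hb hc s

lemma convex_lt_inDist (ho : IsOpen Q) (hb : Bornology.IsBounded Q) (hc : Convex ℝ Q) (s : ℝ) :
    Convex ℝ {x | s < inDist Q x} := by
  simpa using (quasiconcaveOn_inDist ho hb hc).convex_gt s

lemma isOpen_lt_inDist (Q : Set Plane) (s : ℝ) : IsOpen {x | s < inDist Q x} :=
  isOpen_lt continuous_const (continuous_inDist Q)

lemma isClosed_innerSet (Q : Set Plane) (s : ℝ) : IsClosed (innerSet Q s) :=
  isClosed_le continuous_const (continuous_inDist Q)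

lemma lt_inDist_subset (ho : IsOpen Q) (hb : Bornology.IsBounded Q) {s : ℝ} (hs : 0 ≤ s) :
    {x | s < inDist Q x} ⊆ Q := fun _ hx => (inDist_pos ho hb).1 (hs.trans_lt hx)

lemma innerSet_subset (ho : IsOpen Q) (hb : Bornology.IsBounded Q) {s : ℝ} (hs : 0 < s) :
    innerSet Q s ⊆ Q := fun _ hx => (inDist_pos ho hb).1 (hs.trans_le hx)

lemma volume_lt_inDist (ho : IsOpen Q) (hb : Bornology.IsBounded Q) (hc : Convex ℝ Q) {s : ℝ}
    (hs : 0 < s) : volume {x | s < inDist Q x} = volume (innerSet Q s) := by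
  apply le_antisymm (measure_mono fun x (hx : s < inDist Q x) => hx.le)
  have h1 : interior (innerSet Q s) ⊆ {x | s < inDist Q x} := by
    intro x hx
    obtain ⟨y, -, hy⟩ := exists_line_inDist ho hb x
    have hcont : Continuous fun t : ℝ => x + t • (y - x) := by fun_prop
    have hev : ∀ᶠ t : ℝ in 𝓝[>] 0, x + t • (y - x) ∈ innerSet Q s := by
      apply nhdsWithin_le_nhds
      apply hcont.continuousAt
      simpa using mem_interior_iff_mem_nhds.1 hx
    obtain ⟨t, ht, ht1⟩ := (hev.and (Ioo_mem_nhdsGT (zero_lt_one' ℝ))).exists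
    have h2 := hy t ⟨ht1.1.le, ht1.2.le⟩
    have h3 : s ≤ inDist Q (x + t • (y - x)) := ht
    have h4 : x ∈ innerSet Q s := interior_subset hx
    change s ≤ inDist Q x at h4
    change s < inDist Q x
    nlinarith [ht1.1, ht1.2]
  calc volume (innerSet Q s) ≤ volume (interior (innerSet Q s) ∪ frontier (innerSet Q s)) := by
        rw [← closure_eq_interior_union_frontier]; exact measure_mono subset_closure
    _ ≤ volume (interior (innerSet Q s)) + volume (frontier (innerSet Q s)) := measure_union_le _ _
    _ = volume (interior (innerSet Q s)) := by
        rw [(convex_innerSet ho hb hc s).addHaar_frontier volume, add_zero]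
    _ ≤ _ := measure_mono h1

lemma innerSet_lt_inDist_subset (ho : IsOpen Q) (hb : Bornology.IsBounded Q) {s ε : ℝ}
    (hs : 0 < s) (hε : 0 < ε) : innerSet {x | s < inDist Q x} ε ⊆ innerSet Q (s + ε) := by
  intro x hx
  have hb' := hb.subset (lt_inDist_subset ho hb hs.le)
  have hball := (ball_subset_iff hb').2 hx
  obtain ⟨y, hxy, hy⟩ := exists_line_inDist ho hb x
  have hxQ : s < inDist Q x := hball (mem_ball_self hε)
  have hpos : 0 < inDist Q x := hs.trans hxQ
  change s + ε ≤ inDist Q x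
  by_contra! hlt
  have ht : (1 - s / inDist Q x) ∈ Icc (0 : ℝ) 1 := by
    constructor
    · rw [sub_nonneg, div_le_one hpos]; exact hxQ.le
    · linarith [div_nonneg hs.le hpos.le]
  have h1 := hy _ ht
  rw [sub_sub_cancel, div_mul_cancel₀ _ hpos.ne'] at h1
  refine absurd (hball (?_ : x + (1 - s / inDist Q x) • (y - x) ∈ _)) (not_lt.2 h1)
  rw [mem_ball, dist_eq_norm, add_sub_cancel_left, norm_smul, Real.norm_of_nonneg ht.1,
    ← dist_eq_norm, dist_comm, hxy, sub_mul, div_mul_cancel₀ _ hpos.ne']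
  linarith

end Bounded

lemma lipschitz_pt (θ τ : ℝ) : LipschitzWith 1 fun s => pt θ s τ := by
  refine LipschitzWith.of_dist_le_mul fun s s' => ?_
  rw [dist_eq_norm, pt_sub_pt, norm_smul, norm_dir, Real.dist_eq, Real.norm_eq_abs]
  simp

lemma lipschitz_line {u : Plane → ℝ} {K : ℝ≥0} (hu : LipschitzWith K u) (θ τ : ℝ) :
    LipschitzWith K fun s => u (pt θ s τ) := by
  have h := hu.comp (lipschitz_pt θ τ)
  rwa [mul_one] at h

lemma four_mul_lintegral_fderiv_lipschitz {u : Plane → ℝ} {K : ℝ≥0} (hu : LipschitzWith K u) :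
    4 * ∫⁻ x, ‖fderiv ℝ u x‖ₑ = ∫⁻ θ in Ioo 0 (2 * Real.pi), ∫⁻ τ, ∫⁻ s,
      ‖deriv (fun s => u (pt θ s τ)) s‖ₑ := by
  have h := four_mul_lintegral_fderiv u (w := fun _ => 1) measurable_const
  simp only [one_mul] at h
  rw [h]
  refine lintegral_congr fun θ => lintegral_congr_ae ?_
  filter_upwards [ae_lines θ hu.ae_differentiableAt] with τ hτ
  refine lintegral_congr_ae ?_
  filter_upwards [hτ] with s hs
  rw [(hasDerivAt_line hs).deriv]

lemma setLIntegral_ofReal_sub_left {a h : ℝ} (hh : 0 ≤ h) :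
    ∫⁻ τ in Ioc a (a + h), ENNReal.ofReal (τ - a) = ENNReal.ofReal (h ^ 2 / 2) := by
  have hi : IntegrableOn (fun τ => τ - a) (Ioc a (a + h)) :=
    (Continuous.integrableOn_Icc (by fun_prop)).mono_set Ioc_subset_Icc_self
  rw [← ofReal_integral_eq_lintegral_ofReal hi
    ((ae_restrict_iff' measurableSet_Ioc).2
      (Eventually.of_forall fun x hx => sub_nonneg.2 hx.1.le)),
    ← intervalIntegral.integral_of_le (by linarith), intervalIntegral.integral_comp_sub_right
    (fun x => x)]
  simp

lemma setLIntegral_ofReal_sub_right {b h : ℝ} (hh : 0 ≤ h) :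
    ∫⁻ τ in Ioc (b - h) b, ENNReal.ofReal (b - τ) = ENNReal.ofReal (h ^ 2 / 2) := by
  have hi : IntegrableOn (fun τ => b - τ) (Ioc (b - h) b) :=
    (Continuous.integrableOn_Icc (by fun_prop)).mono_set Ioc_subset_Icc_self
  rw [← ofReal_integral_eq_lintegral_ofReal hi
    ((ae_restrict_iff' measurableSet_Ioc).2
      (Eventually.of_forall fun x hx => sub_nonneg.2 hx.2)),
    ← intervalIntegral.integral_of_le (by linarith), intervalIntegral.integral_comp_sub_left
    (fun x => x)]
  simp

lemma lintegral_min_le {a b s : ℝ} (hab : a < b) (hs : 0 < s) :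
    ∫⁻ τ, ENNReal.ofReal (min s (min (τ - a) (b - τ))) ≤
      ENNReal.ofReal (min s ((b - a) / 2) * (b - a) - min s ((b - a) / 2) ^ 2) := by
  set h := min s ((b - a) / 2) with hh
  have h1 : h ≤ s := min_le_left _ _
  have h2 : h ≤ (b - a) / 2 := min_le_right _ _
  have h0 : 0 < h := lt_min hs (by linarith)
  set G : ℝ → ℝ≥0∞ := fun τ => ENNReal.ofReal (min s (min (τ - a) (b - τ)))
  have hsplit : ∫⁻ τ, G τ ≤ (∫⁻ τ in Ioc a (a + h), G τ) + (∫⁻ τ in Ioc (a + h) (b - h), G τ) +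
      ∫⁻ τ in Ioc (b - h) b, G τ := by
    have e : ∫⁻ τ, G τ = ∫⁻ τ in Ioc a b, G τ := by
      symm
      apply setLIntegral_eq_of_support_subset
      intro τ hτ
      by_contra hn
      apply hτ
      apply ENNReal.ofReal_of_nonpos
      by_cases ha : a < τ
      · have : b < τ := by
          by_contra! hb
          exact hn ⟨ha, hb⟩
        exact (min_le_right _ _).trans ((min_le_right _ _).trans (by linarith))
      · exact (min_le_right _ _).trans ((min_le_left _ _).trans (by linarith))
    rw [e, ← Ioc_union_Ioc_eq_Ioc (b := b - h) (by linarith) (by linarith),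
      ← Ioc_union_Ioc_eq_Ioc (a := a) (b := a + h) (by linarith) (by linarith)]
    exact (lintegral_union_le _ _ _).trans (add_le_add_left (lintegral_union_le _ _ _) _)
  have e1 : ∫⁻ τ in Ioc a (a + h), G τ ≤ ENNReal.ofReal (h ^ 2 / 2) := by
    rw [← setLIntegral_ofReal_sub_left h0.le]
    exact lintegral_mono fun τ =>
      ENNReal.ofReal_le_ofReal ((min_le_right _ _).trans (min_le_left _ _))
  have e3 : ∫⁻ τ in Ioc (b - h) b, G τ ≤ ENNReal.ofReal (h ^ 2 / 2) := by
    rw [← setLIntegral_ofReal_sub_right h0.le]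
    exact lintegral_mono fun τ =>
      ENNReal.ofReal_le_ofReal ((min_le_right _ _).trans (min_le_right _ _))
  have e2 : ∫⁻ τ in Ioc (a + h) (b - h), G τ ≤ ENNReal.ofReal (h * (b - a - 2 * h)) := by
    have : ∀ τ, G τ ≤ ENNReal.ofReal h := fun τ => by
      apply ENNReal.ofReal_le_ofReal
      apply le_min (min_le_left _ _)
      rcases le_total (τ - a) (b - τ) with h | h
      · exact (min_le_right _ _).trans ((min_le_left _ _).trans (by linarith))
      · exact (min_le_right _ _).trans ((min_le_right _ _).trans (by linarith))
    refine (lintegral_mono this).trans ?_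
    rw [lintegral_const, Measure.restrict_apply_univ, Real.volume_Ioc, ← ENNReal.ofReal_mul h0.le]
    exact ENNReal.ofReal_le_ofReal (by nlinarith)
  refine hsplit.trans ((add_le_add (add_le_add e1 e2) e3).trans ?_)
  have h3 : 0 ≤ h * (b - a - 2 * h) := mul_nonneg h0.le (by linarith)
  rw [← ENNReal.ofReal_add (by positivity) h3, ← ENNReal.ofReal_add (by positivity) (by positivity)]
  exact ENNReal.ofReal_le_ofReal (by nlinarith)

/-- The width of `Q` in the direction `nrm θ`. -/
def width (Q : Set Plane) (θ : ℝ) : ℝ := (volume (shadow θ Q)).toReal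

section Convex

variable {Q : Set Plane}

lemma ofReal_width (hb : Bornology.IsBounded Q) (θ : ℝ) :
    ENNReal.ofReal (width Q θ) = volume (shadow θ Q) :=
  ENNReal.ofReal_toReal (isBounded_shadow θ hb).measure_lt_top.ne

lemma width_nonneg (Q : Set Plane) (θ : ℝ) : 0 ≤ width Q θ := ENNReal.toReal_nonneg

lemma totalWidth_eq (hb : Bornology.IsBounded Q) :
    totalWidth Q = ∫⁻ θ in Ioo 0 (2 * Real.pi), ENNReal.ofReal (width Q θ) := by
  simp_rw [ofReal_width hb]; rfl

lemma width_le (ho : IsOpen Q) (hc : IsPreconnected Q) {D : ℝ} (hD : 0 ≤ D)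
    (hdist : ∀ x ∈ Q, ∀ y ∈ Q, dist x y ≤ D) (θ : ℝ) : width Q θ ≤ D :=
  ENNReal.toReal_le_of_le_ofReal hD (volume_shadow_le θ ho hc hdist)

lemma Ioo_subset_shadow {x : Plane} {s : ℝ} (h : ball x s ⊆ Q) (θ : ℝ) :
    Ioo (ht θ x - s) (ht θ x + s) ⊆ shadow θ Q := by
  intro τ hτ
  refine mem_shadow.2 ⟨lg θ x, h ?_⟩
  rw [mem_ball, dist_eq_norm]
  have e : pt θ (lg θ x) τ - x = (τ - ht θ x) • nrm θ := by
    nth_rw 2 [← pt_lg_ht θ x]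
    simp only [pt]; module
  rw [e, norm_smul, norm_nrm, mul_one, Real.norm_eq_abs, abs_lt]
  exact ⟨by linarith [hτ.1], by linarith [hτ.2]⟩

lemma two_mul_le_width (hb : Bornology.IsBounded Q) {x : Plane} {s : ℝ}
    (h : s ≤ inDist Q x) (θ : ℝ) : 2 * s ≤ width Q θ := by
  have h1 := measure_mono (μ := volume) (Ioo_subset_shadow ((ball_subset_iff hb).2 h) θ)
  rw [Real.volume_Ioo, ← ofReal_width hb, ENNReal.ofReal_le_ofReal_iff (width_nonneg _ _)] at h1
  linarith

/-- Area of an inner collar of a convex set: an integral-geometric bound. -/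
lemma two_mul_volume_diff_le (ho : IsOpen Q) (hb : Bornology.IsBounded Q) (hc : Convex ℝ Q)
    {s : ℝ} (hs : 0 < s) :
    2 * volume (Q \ innerSet Q s) ≤ ∫⁻ θ in Ioo 0 (2 * Real.pi),
      ENNReal.ofReal (min s (width Q θ / 2) * width Q θ - min s (width Q θ / 2) ^ 2) := by
  rcases Q.eq_empty_or_nonempty with hne | hne
  · simp [hne]
  set u : Plane → ℝ := fun x => min (inDist Q x) s with hu_def
  have hu : LipschitzWith 1 u := by
    simpa using (lipschitz_inDist Q).min_const s
  have hu0 : ∀ x, 0 ≤ u x := fun x => le_min (inDist_nonneg Q x) hs.le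
  have huq : QuasiconcaveOn ℝ univ u := by
    intro t
    have h := (quasiconcaveOn_inDist ho hb hc t).inter
      (by by_cases hts : t ≤ s <;> simp [hts, convex_univ, convex_empty] :
        Convex ℝ {x : Plane | t ≤ s})
    convert h using 1
    ext x
    simp [hu_def]
  have hcompl := compl_nonempty_of_isBounded hb
  have key1 : volume (Q \ innerSet Q s) ≤ ∫⁻ x, ‖fderiv ℝ u x‖ₑ := by
    have hms : MeasurableSet (Q \ innerSet Q s) :=
      ho.measurableSet.diff (isClosed_innerSet Q s).measurableSet
    rw [← setLIntegral_one]
    refine le_trans ?_ (setLIntegral_le_lintegral (Q \ innerSet Q s) _)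
    refine lintegral_mono_ae ((ae_restrict_iff' hms).2 ?_)
    filter_upwards [hu.ae_differentiableAt] with x hx hxQ
    have hlt : inDist Q x < s := not_le.1 hxQ.2
    have hloc : u =ᶠ[𝓝 x] fun y => infDist y Qᶜ := by
      filter_upwards [(isOpen_lt (continuous_inDist Q) continuous_const).mem_nhds hlt] with y hy
      exact min_eq_left (le_of_lt hy)
    have h1 := norm_fderiv_infDist ho.isClosed_compl hcompl (x := x) (fun h => h hxQ.1)
      (hx.congr_of_eventuallyEq hloc.symm)
    rw [hloc.fderiv_eq, ← ofReal_norm, h1, ENNReal.ofReal_one]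
  obtain ⟨D, hD⟩ := hb.subset_closedBall 0
  have hline : ∀ θ, ∫⁻ τ, ∫⁻ σ, ‖deriv (fun s => u (pt θ s τ)) σ‖ₑ ≤
      2 * ENNReal.ofReal (min s (width Q θ / 2) * width Q θ - min s (width Q θ / 2) ^ 2) := by
    intro θ
    obtain ⟨a, b, hab, hsh⟩ := shadow_eq_Ioo θ ho hc.isPreconnected hb hne
    have hw : width Q θ = b - a := by
      rw [width, hsh, Real.volume_Ioo, ENNReal.toReal_ofReal (by linarith)]
    rw [hw]
    refine le_trans ?_ (mul_le_mul_right (lintegral_min_le hab hs) 2)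
    rw [← lintegral_const_mul' _ _ (by norm_num)]
    refine lintegral_mono fun τ => ?_
    have hM : ∀ σ, u (pt θ σ τ) ≤ max 0 (min s (min (τ - a) (b - τ))) := by
      intro σ
      by_cases hx : pt θ σ τ ∈ Q
      · refine le_max_of_le_right (le_min (min_le_right _ _) ((min_le_left _ _).trans ?_))
        have hsub := Ioo_subset_shadow ((ball_subset_iff hb).2 (le_refl (inDist Q (pt θ σ τ)))) θ
        have hp := (inDist_pos ho hb).2 hx
        rw [hsh, ht_pt, Ioo_subset_Ioo_iff (by linarith)] at hsub
        exact le_min (by linarith [hsub.1]) (by linarith [hsub.2])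
      · refine le_max_of_le_left ?_
        simp only [hu_def, inDist_of_notMem hx]; exact min_le_left _ _
    refine (lintegral_deriv_le_of_quasiconcave (lipschitz_line hu θ τ) (A := -D) (B := D)
      (fun σ hσ => ?_) hM (fun σ => hu0 _) ?_).trans ?_
    · have : pt θ σ τ ∉ Q := fun hx => hσ (by
        have h1 := mem_closedBall_zero_iff.1 (hD hx)
        have h2 := norm_sq_eq_lg_ht θ (pt θ σ τ)
        rw [lg_pt] at h2
        exact abs_le.1 ((abs_le_of_sq_le_sq (by nlinarith [sq_nonneg (ht θ (pt θ σ τ))])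
          (norm_nonneg _)).trans h1))
      simp only [hu_def, inDist_of_notMem this]; exact min_eq_left hs.le
    · intro r
      have h1 := huq r
      rw [convex_iff_segment_subset] at h1 ⊢
      intro x hx y hy z hz
      refine ⟨mem_univ _, ?_⟩
      obtain ⟨p, q, hp, hq, hpq, rfl⟩ := hz
      refine (h1 (x := pt θ x τ) ⟨mem_univ _, hx.2⟩ (y := pt θ y τ) ⟨mem_univ _, hy.2⟩
        ⟨p, q, hp, hq, hpq, ?_⟩).2
      have : τ = (p + q) * τ := by rw [hpq, one_mul]
      simp only [pt, smul_eq_mul]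
      nth_rw 3 [this]
      module
    · rw [ENNReal.ofReal_max, ENNReal.ofReal_zero, max_eq_right zero_le]
  have h4 := four_mul_lintegral_fderiv_lipschitz hu
  have h5 : 4 * volume (Q \ innerSet Q s) ≤ 2 * ∫⁻ θ in Ioo 0 (2 * Real.pi),
      ENNReal.ofReal (min s (width Q θ / 2) * width Q θ - min s (width Q θ / 2) ^ 2) := by
    refine (mul_le_mul_right key1 4).trans ?_
    rw [h4, ← lintegral_const_mul' _ _ (by norm_num)]
    exact lintegral_mono hline
  rw [show (4 : ℝ≥0∞) = 2 * 2 by norm_num, mul_assoc] at h5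
  exact (ENNReal.mul_le_mul_iff_right (by norm_num) (by norm_num)).1 h5

end Convex

variable {Q : Set Plane}

lemma lintegral_const_two_pi (c : ℝ≥0∞) :
    ∫⁻ _ in Ioo 0 (2 * Real.pi), c = c * ENNReal.ofReal (2 * Real.pi) := by
  rw [lintegral_const, Measure.restrict_apply_univ, volume_Ioo_two_pi]

lemma two_mul_volume_diff_le_mul_totalWidth (ho : IsOpen Q) (hb : Bornology.IsBounded Q)
    (hc : Convex ℝ Q) {s : ℝ} (hs : 0 < s) :
    2 * volume (Q \ innerSet Q s) ≤ ENNReal.ofReal s * totalWidth Q := by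
  refine (two_mul_volume_diff_le ho hb hc hs).trans ?_
  rw [totalWidth_eq hb, ← lintegral_const_mul' _ _ ENNReal.ofReal_ne_top]
  refine lintegral_mono fun θ => ?_
  rw [← ENNReal.ofReal_mul hs.le]
  apply ENNReal.ofReal_le_ofReal
  have h1 := min_le_left s (width Q θ / 2)
  have h2 := width_nonneg Q θ
  nlinarith [sq_nonneg (min s (width Q θ / 2))]

lemma two_mul_volume_diff_add_le (ho : IsOpen Q) (hb : Bornology.IsBounded Q)
    (hc : Convex ℝ Q) {s : ℝ} (hs : 0 < s) {x : Plane} (hx : s ≤ inDist Q x) :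
    2 * volume (Q \ innerSet Q s) + ENNReal.ofReal (2 * Real.pi * s ^ 2) ≤
      ENNReal.ofReal s * totalWidth Q := by
  have h1 := two_mul_volume_diff_le ho hb hc hs
  have e : ENNReal.ofReal (2 * Real.pi * s ^ 2) =
      ∫⁻ _ in Ioo 0 (2 * Real.pi), ENNReal.ofReal (s ^ 2) := by
    rw [lintegral_const_two_pi, ← ENNReal.ofReal_mul (by positivity)]
    congr 1; ring
  rw [e]
  refine (add_le_add_left h1 _).trans ?_
  rw [← lintegral_add_right _ measurable_const, totalWidth_eq hb,
    ← lintegral_const_mul' _ _ ENNReal.ofReal_ne_top]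
  refine lintegral_mono fun θ => ?_
  have hw := two_mul_le_width hb hx θ
  rw [min_eq_left (by linarith), ← ENNReal.ofReal_mul hs.le,
    ← ENNReal.ofReal_add (by nlinarith) (by positivity)]
  exact ENNReal.ofReal_le_ofReal (by linarith)

/-- Volume of a convex set in terms of its inner parallel set and its total width. -/
lemma two_mul_volume_add_le (ho : IsOpen Q) (hb : Bornology.IsBounded Q)
    (hc : Convex ℝ Q) {s : ℝ} (hs : 0 < s) {x : Plane} (hx : s ≤ inDist Q x) :
    2 * volume Q + ENNReal.ofReal (2 * Real.pi * s ^ 2) ≤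
      2 * volume (innerSet Q s) + ENNReal.ofReal s * totalWidth Q := by
  have h1 := two_mul_volume_diff_add_le ho hb hc hs hx
  have h2 := measure_sdiff_add_inter (μ := volume) Q (isClosed_innerSet Q s).measurableSet
  have h3 : volume (Q ∩ innerSet Q s) ≤ volume (innerSet Q s) := measure_mono inter_subset_right
  calc 2 * volume Q + ENNReal.ofReal (2 * Real.pi * s ^ 2)
      = 2 * volume (Q ∩ innerSet Q s) + (2 * volume (Q \ innerSet Q s) +
        ENNReal.ofReal (2 * Real.pi * s ^ 2)) := by rw [← h2]; ring
    _ ≤ _ := add_le_add (mul_le_mul_right h3 2) h1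

lemma two_mul_volume_le_of_innerSet_eq_empty (ho : IsOpen Q) (hb : Bornology.IsBounded Q)
    (hc : Convex ℝ Q) {s D : ℝ} (hs : 0 < s) (hD : 0 < D)
    (hdist : ∀ x ∈ Q, ∀ y ∈ Q, dist x y ≤ D) (he : innerSet Q s = ∅) :
    2 * volume Q ≤ ENNReal.ofReal ((1 - min (1 / 2) (s / D)) * s) * totalWidth Q := by
  have h1 := two_mul_volume_diff_le ho hb hc hs
  rw [he, sdiff_empty] at h1
  refine h1.trans ?_
  rw [totalWidth_eq hb, ← lintegral_const_mul' _ _ ENNReal.ofReal_ne_top]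
  refine lintegral_mono fun θ => ?_
  have hc1 := min_le_left (1 / 2) (s / D)
  have hc2 := min_le_right (1 / 2) (s / D)
  rw [← ENNReal.ofReal_mul (mul_nonneg (by linarith) hs.le)]
  apply ENNReal.ofReal_le_ofReal
  have hw0 := width_nonneg Q θ
  have hwD := width_le ho hc.isPreconnected hD.le hdist θ
  set w := width Q θ
  set c := min (1 / 2) (s / D)
  rcases le_total s (w / 2) with h | h
  · rw [min_eq_left h]
    have : c * w ≤ s := by
      calc c * w ≤ s / D * D := by gcongr
        _ = s := div_mul_cancel₀ _ hD.ne'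
    nlinarith
  · rw [min_eq_right h]
    nlinarith [mul_nonneg hs.le hw0]

/-- A lower bound of Steiner type for the area of an outer parallel set. -/
lemma steiner_le (ho : IsOpen Q) (hb : Bornology.IsBounded Q) (hc : Convex ℝ Q)
    (hne : Q.Nonempty) {r : ℝ} (hr : 0 < r) :
    2 * volume Q + ENNReal.ofReal r * totalWidth Q + ENNReal.ofReal (2 * Real.pi * r ^ 2) ≤
      2 * volume (Q + ball (0 : Plane) r) := by
  have hT : Q + ball (0 : Plane) r = {x | infDist x Q < r} := by
    rw [add_ball_zero]
    ext x
    rw [mem_thickening_iff_infDist_lt hne]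
    rfl
  rw [hT]
  set u : Plane → ℝ := fun x => max (r - infDist x Q) 0 with hu_def
  have hu : LipschitzWith 1 u := by
    have h1 : LipschitzWith 1 fun x => r - infDist x Q := by
      refine LipschitzWith.of_dist_le_mul fun x y => ?_
      have := (lipschitz_infDist_pt Q).dist_le_mul x y
      rw [Real.dist_eq] at this ⊢
      rwa [show r - infDist x Q - (r - infDist y Q) = -(infDist x Q - infDist y Q) by ring, abs_neg]
    exact h1.max_const 0
  have hmo : IsOpen {x | infDist x Q < r} := isOpen_lt (continuous_infDist_pt Q) continuous_const
  have hsub : Q ⊆ {x | infDist x Q < r} := fun x hx => by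
    change infDist x Q < r
    rw [infDist_zero_of_mem hx]; exact hr
  have key1 : ∫⁻ x, ‖fderiv ℝ u x‖ₑ ≤ volume ({x | infDist x Q < r} \ Q) := by
    rw [← lintegral_indicator_one (hmo.measurableSet.diff ho.measurableSet)]
    refine lintegral_mono fun x => ?_
    by_cases hx : x ∈ {x | infDist x Q < r} \ Q
    · rw [indicator_of_mem hx, Pi.one_apply, ← ofReal_norm, ← ENNReal.ofReal_one]
      exact ENNReal.ofReal_le_ofReal (by simpa using norm_fderiv_le_of_lipschitz ℝ hu (x₀ := x))
    · rw [indicator_of_notMem hx, nonpos_iff_eq_zero, ← ofReal_norm,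
        ENNReal.ofReal_eq_zero, norm_le_zero_iff]
      by_cases hxQ : x ∈ Q
      · have : u =ᶠ[𝓝 x] fun _ => r := by
          filter_upwards [ho.mem_nhds hxQ] with y hy
          simp only [hu_def, infDist_zero_of_mem hy, sub_zero]; exact max_eq_left hr.le
        rw [this.fderiv_eq]; simp
      · have hge : r ≤ infDist x Q := by
          by_contra! hlt
          exact hx ⟨hlt, hxQ⟩
        have : IsLocalMin u x := Eventually.of_forall fun y => by
          simp only [hu_def, max_eq_right (sub_nonpos.2 hge)]; exact le_max_right _ _
        exact this.fderiv_eq_zero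
  obtain ⟨D, hD⟩ := hb.subset_closedBall 0
  have hline : ∀ θ, 2 * (ENNReal.ofReal r * ENNReal.ofReal (width Q θ) + ENNReal.ofReal (r ^ 2)) ≤
      ∫⁻ τ, ∫⁻ σ, ‖deriv (fun s => u (pt θ s τ)) σ‖ₑ := by
    intro θ
    obtain ⟨a, b, hab, hsh⟩ := shadow_eq_Ioo θ ho hc.isPreconnected hb hne
    have hw : width Q θ = b - a := by
      rw [width, hsh, Real.volume_Ioo, ENNReal.toReal_ofReal (by linarith)]
    have hlow : ∀ τ, ∀ τ' ∈ Ioo a b, 2 * ENNReal.ofReal (r - |τ - τ'|) ≤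
        ∫⁻ σ, ‖deriv (fun s => u (pt θ s τ)) σ‖ₑ := by
      intro τ τ' hτ'
      rw [← hsh] at hτ'
      obtain ⟨σ, hσ⟩ := mem_shadow.1 hτ'
      have h0 : ∀ x ∉ Icc (-(D + r)) (D + r), u (pt θ x τ) = 0 := by
        intro x hx
        by_contra hne0
        apply hx
        have hlt : infDist (pt θ x τ) Q < r := by
          by_contra! hge
          exact hne0 (max_eq_right (sub_nonpos.2 hge))
        obtain ⟨y, hy, hxy⟩ := (infDist_lt_iff hne).1 hlt
        have h1 := mem_closedBall_zero_iff.1 (hD hy)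
        have h2 := norm_sq_eq_lg_ht θ (pt θ x τ)
        rw [lg_pt] at h2
        have h3 : |x| ≤ ‖pt θ x τ‖ := abs_le_of_sq_le_sq
          (by nlinarith [sq_nonneg (ht θ (pt θ x τ))]) (norm_nonneg _)
        have h4 : ‖pt θ x τ‖ ≤ ‖y‖ + dist (pt θ x τ) y := by
          rw [dist_eq_norm]
          calc ‖pt θ x τ‖ = ‖y + (pt θ x τ - y)‖ := by congr 1; abel
            _ ≤ _ := norm_add_le _ _
        exact abs_le.1 (by linarith)
      refine le_trans ?_ (two_mul_le_lintegral_deriv (lipschitz_line hu θ τ) h0 σ)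
      refine mul_le_mul_right (ENNReal.ofReal_le_ofReal (le_max_of_le_left ?_)) 2
      have h5 := infDist_le_dist_of_mem (x := pt θ σ τ) hσ
      rw [dist_eq_norm, show pt θ σ τ - pt θ σ τ' = (τ - τ') • nrm θ by simp only [pt]; module,
        norm_smul, norm_nrm, mul_one, Real.norm_eq_abs] at h5
      linarith
    have hlim : ∀ τ c, c ∈ Icc a b → 2 * ENNReal.ofReal (r - |τ - c|) ≤
        ∫⁻ σ, ‖deriv (fun s => u (pt θ s τ)) σ‖ₑ := by
      intro τ c hcab
      have hcl : IsClosed {c : ℝ | 2 * ENNReal.ofReal (r - |τ - c|) ≤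
          ∫⁻ σ, ‖deriv (fun s => u (pt θ s τ)) σ‖ₑ} := by
        refine isClosed_le ?_ continuous_const
        exact (ENNReal.continuous_const_mul (by norm_num)).comp
          (ENNReal.continuous_ofReal.comp (by fun_prop))
      have := closure_minimal (fun τ' hτ' => hlow τ τ' hτ') hcl
      rw [closure_Ioo hab.ne] at this
      exact this hcab
    set G : ℝ → ℝ≥0∞ := fun τ => ∫⁻ σ, ‖deriv (fun s => u (pt θ s τ)) σ‖ₑ
    have e1 : 2 * ENNReal.ofReal (r ^ 2 / 2) ≤ ∫⁻ τ in Ioc (a - r) a, G τ := by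
      have h := setLIntegral_ofReal_sub_left (a := a - r) hr.le
      rw [sub_add_cancel] at h
      rw [← h, ← lintegral_const_mul' _ _ (by norm_num)]
      refine setLIntegral_mono' measurableSet_Ioc fun τ hτ =>
        le_trans ?_ (hlim τ a ⟨le_rfl, hab.le⟩)
      rw [abs_of_nonpos (by linarith [hτ.2])]
      exact le_of_eq (by congr 2; ring)
    have e2 : 2 * (ENNReal.ofReal r * ENNReal.ofReal (width Q θ)) ≤ ∫⁻ τ in Ioc a b, G τ := by
      calc 2 * (ENNReal.ofReal r * ENNReal.ofReal (width Q θ))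
          = ∫⁻ τ in Ioc a b, 2 * ENNReal.ofReal r := by
            rw [lintegral_const, Measure.restrict_apply_univ, Real.volume_Ioc, hw, mul_assoc]
        _ ≤ _ := setLIntegral_mono' measurableSet_Ioc fun τ hτ => by
            simpa using hlim τ τ ⟨hτ.1.le, hτ.2⟩
    have e3 : 2 * ENNReal.ofReal (r ^ 2 / 2) ≤ ∫⁻ τ in Ioc b (b + r), G τ := by
      have h := setLIntegral_ofReal_sub_right (b := b + r) hr.le
      rw [add_sub_cancel_right] at h
      rw [← h, ← lintegral_const_mul' _ _ (by norm_num)]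
      refine setLIntegral_mono' measurableSet_Ioc fun τ hτ =>
        le_trans ?_ (hlim τ b ⟨hab.le, le_rfl⟩)
      rw [abs_of_nonneg (by linarith [hτ.1])]
      exact le_of_eq (by congr 2; ring)
    calc 2 * (ENNReal.ofReal r * ENNReal.ofReal (width Q θ) + ENNReal.ofReal (r ^ 2))
        = 2 * ENNReal.ofReal (r ^ 2 / 2) + 2 * (ENNReal.ofReal r * ENNReal.ofReal (width Q θ)) +
          2 * ENNReal.ofReal (r ^ 2 / 2) := by
          rw [show r ^ 2 = r ^ 2 / 2 + r ^ 2 / 2 by ring,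
            ENNReal.ofReal_add (by positivity) (by positivity), add_halves]; ring
      _ ≤ (∫⁻ τ in Ioc (a - r) a, G τ) + (∫⁻ τ in Ioc a b, G τ) + ∫⁻ τ in Ioc b (b + r), G τ :=
          add_le_add (add_le_add e1 e2) e3
      _ = ∫⁻ τ in Ioc (a - r) (b + r), G τ := by
          rw [← lintegral_union measurableSet_Ioc (Ioc_disjoint_Ioc_of_le le_rfl),
            Ioc_union_Ioc_eq_Ioc (by linarith) hab.le,
            ← lintegral_union measurableSet_Ioc (Ioc_disjoint_Ioc_of_le le_rfl),
            Ioc_union_Ioc_eq_Ioc (by linarith) (by linarith)]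
      _ ≤ _ := setLIntegral_le_lintegral _ _
  have h4 := four_mul_lintegral_fderiv_lipschitz hu
  have h5 : 2 * (ENNReal.ofReal r * totalWidth Q + ENNReal.ofReal (2 * Real.pi * r ^ 2)) ≤
      2 * (2 * volume ({x | infDist x Q < r} \ Q)) := by
    calc 2 * (ENNReal.ofReal r * totalWidth Q + ENNReal.ofReal (2 * Real.pi * r ^ 2))
        = ∫⁻ θ in Ioo 0 (2 * Real.pi), 2 * (ENNReal.ofReal r * ENNReal.ofReal (width Q θ) +
          ENNReal.ofReal (r ^ 2)) := by
          rw [lintegral_const_mul' _ _ (by norm_num), lintegral_add_right _ measurable_const,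
            lintegral_const_mul' _ _ ENNReal.ofReal_ne_top, ← totalWidth_eq hb,
            lintegral_const_two_pi, ← ENNReal.ofReal_mul (by positivity), mul_comm (r ^ 2)]
      _ ≤ _ := lintegral_mono hline
      _ = 4 * ∫⁻ x, ‖fderiv ℝ u x‖ₑ := h4.symm
      _ ≤ _ := by
          rw [← mul_assoc]; norm_num
          exact mul_le_mul_right key1 4
  have h6 := (ENNReal.mul_le_mul_iff_right (by norm_num) (by norm_num)).1 h5
  calc 2 * volume Q + ENNReal.ofReal r * totalWidth Q + ENNReal.ofReal (2 * Real.pi * r ^ 2)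
      ≤ 2 * volume Q + 2 * volume ({x | infDist x Q < r} \ Q) := by
        rw [add_assoc]; exact add_le_add_right h6 _
    _ = 2 * volume {x | infDist x Q < r} := by
        rw [← mul_add, ← measure_sdiff_add_inter (μ := volume) {x | infDist x Q < r}
          ho.measurableSet, inter_eq_right.2 hsub, add_comm]

lemma exists_kernel {ε : ℝ} (hε : 0 < ε) : ∃ k : ℝ → ℝ, Continuous k ∧ (∀ x, 0 ≤ k x) ∧
    (∫⁻ x, ENNReal.ofReal (k x) = 1) ∧ ∀ y, ε ≤ y → ∫ x in (0 : ℝ)..y, k x = 1 := by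
  let f : ContDiffBump (ε / 2 : ℝ) := ⟨ε / 4, ε / 2, by linarith, by linarith⟩
  have hint : Integrable (f.normed volume) := f.integrable_normed
  refine ⟨f.normed volume, f.continuous_normed, f.nonneg_normed, ?_, fun y hy => ?_⟩
  · rw [← ofReal_integral_eq_lintegral_ofReal hint (Eventually.of_forall f.nonneg_normed),
      f.integral_normed, ENNReal.ofReal_one]
  · rw [intervalIntegral.integral_eq_integral_of_support_subset, f.integral_normed]
    rw [f.support_normed_eq, Real.ball_eq_Ioo]
    change Ioo (ε / 2 - ε / 2) (ε / 2 + ε / 2) ⊆ Ioc 0 y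
    exact fun x hx => ⟨by linarith [hx.1], by linarith [hx.2]⟩

section Coarea

variable {u : Plane → ℝ} {c : ℝ≥0∞}

lemma two_mul_le_lintegral_line (hu : ContDiff ℝ 1 u) (hcs : HasCompactSupport u) {t : ℝ}
    (htp : 0 < t) {C : Set Plane}
    (hC : ∃ x ∈ {x | t < u x}, C = connectedComponentIn {x | t < u x} x)
    {k : ℝ → ℝ} (hk : Continuous k) (hk0 : ∀ x, 0 ≤ k x) {θ σ τ : ℝ} (hσ : pt θ σ τ ∈ C) :
    2 * ENNReal.ofReal (∫ y in (0 : ℝ)..(u (pt θ σ τ) - t), k y) ≤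
      ∫⁻ s, C.indicator (fun x => ENNReal.ofReal (k (u x - t))) (pt θ s τ) *
        ‖fderiv ℝ u (pt θ s τ) (dir θ)‖ₑ := by
  obtain ⟨x, hx, rfl⟩ := hC
  have hpt : Continuous fun s => pt θ s τ := (lipschitz_pt θ τ).continuous
  have hptd : ContDiff ℝ 1 fun s => pt θ s τ := by unfold pt; fun_prop
  have hφ : ContDiff ℝ 1 fun s => u (pt θ s τ) := hu.comp hptd
  have hsup := connectedComponentIn_subset {x | t < u x} x hσ
  obtain ⟨D, hD⟩ := (hcs : IsCompact (tsupport u)).isBounded.subset_closedBall 0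
  have h0 : ∀ s, D < |s| → u (pt θ s τ) = 0 := by
    intro s hs
    by_contra hne
    have h1 := mem_closedBall_zero_iff.1 (hD (subset_tsupport u hne))
    have h2 := norm_sq_eq_lg_ht θ (pt θ s τ)
    rw [lg_pt] at h2
    have h3 : |s| ≤ ‖pt θ s τ‖ := abs_le_of_sq_le_sq
      (by nlinarith [sq_nonneg (ht θ (pt θ s τ))]) (norm_nonneg _)
    linarith
  set B := max (D + 1) (|σ| + 1)
  have hB1 : D + 1 ≤ B := le_max_left _ _
  have hB2 : |σ| + 1 ≤ B := le_max_right _ _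
  have hBpos : 0 < B := by linarith [abs_nonneg σ]
  have hσB := abs_lt.1 (lt_of_lt_of_le (lt_add_one |σ|) hB2)
  obtain ⟨a, b, ha, hb, hua, hub, hab⟩ := exists_Ioo_superlevel hφ.continuous (A := -B) (B := B)
    (c := σ) (t := t) hσB.1 hσB.2
    (by rw [h0 (-B) (by rw [abs_neg, abs_of_pos hBpos]; linarith)]; exact htp.le)
    (by rw [h0 B (by rw [abs_of_pos hBpos]; linarith)]; exact htp.le) hsup
  have hsub : ∀ s ∈ Ioo a b, pt θ s τ ∈ connectedComponentIn {x | t < u x} x := by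
    intro s hs
    rw [connectedComponentIn_eq hσ]
    have himg : IsPreconnected ((fun s => pt θ s τ) '' Ioo a b) :=
      isPreconnected_Ioo.image _ hpt.continuousOn
    refine himg.subset_connectedComponentIn ⟨σ, ⟨ha, hb⟩, rfl⟩ ?_ ⟨s, hs, rfl⟩
    rintro _ ⟨s', hs', rfl⟩
    exact hab s' hs'
  refine (two_mul_integral_le_lintegral_comp hφ hk hk0 ha hb hua hub).trans ?_
  refine le_trans (le_of_eq ?_) (setLIntegral_le_lintegral (Ioo a b) _)
  refine setLIntegral_congr_fun measurableSet_Ioo fun s hs => ?_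
  simp only [indicator_of_mem (hsub s hs)]
  rw [(hasDerivAt_line ((hu.differentiable one_ne_zero) _)).deriv]

lemma two_mul_totalWidth_le_liminf (hu : ContDiff ℝ 1 u) (hcs : HasCompactSupport u) {t : ℝ}
    (htp : 0 < t) {C : Set Plane}
    (hC : ∃ x ∈ {x | t < u x}, C = connectedComponentIn {x | t < u x} x)
    {k : ℕ → ℝ → ℝ} (hk : ∀ n, Continuous (k n)) (hk0 : ∀ n x, 0 ≤ k n x)
    (hk1 : ∀ y, 0 < y → ∀ᶠ n in atTop, ∫ x in (0 : ℝ)..y, k n x = 1) :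
    2 * totalWidth C ≤
      liminf (fun n => 4 * ∫⁻ x in C, ENNReal.ofReal (k n (u x - t)) * ‖fderiv ℝ u x‖ₑ) atTop := by
  have hCo : IsOpen C := by
    obtain ⟨x, -, rfl⟩ := hC
    exact (isOpen_lt continuous_const hu.continuous).connectedComponentIn
  have hCU : C ⊆ {x | t < u x} := by
    obtain ⟨x, -, rfl⟩ := hC
    exact connectedComponentIn_subset _ _
  have hw : ∀ n, Measurable (C.indicator fun x => ENNReal.ofReal (k n (u x - t))) := fun n =>
    Measurable.indicator (ENNReal.measurable_ofReal.comp
      ((hk n).comp (hu.continuous.sub continuous_const)).measurable) hCo.measurableSet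
  have hfd : Continuous fun p : Plane × ℝ => fderiv ℝ u p.1 (dir p.2) :=
    ((hu.continuous_fderiv one_ne_zero).comp continuous_fst).clm_apply
      (continuous_dir.comp continuous_snd)
  have hform : ∀ n, 4 * ∫⁻ x in C, ENNReal.ofReal (k n (u x - t)) * ‖fderiv ℝ u x‖ₑ =
      ∫⁻ θ in Ioo 0 (2 * Real.pi), ∫⁻ τ, ∫⁻ s,
        C.indicator (fun x => ENNReal.ofReal (k n (u x - t))) (pt θ s τ) *
          ‖fderiv ℝ u (pt θ s τ) (dir θ)‖ₑ := fun n => by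
    rw [← four_mul_lintegral_fderiv u (hw n), ← lintegral_indicator hCo.measurableSet]
    congr 2
    funext x
    by_cases hx : x ∈ C <;> simp [hx]
  simp_rw [hform]
  set J : ℕ → ℝ → ℝ → ℝ≥0∞ := fun n θ τ => ∫⁻ s,
    C.indicator (fun x => ENNReal.ofReal (k n (u x - t))) (pt θ s τ) *
      ‖fderiv ℝ u (pt θ s τ) (dir θ)‖ₑ with hJ
  have hmeas : ∀ n, Measurable (Function.uncurry (J n)) := fun n => by
    have hpt : Continuous fun p : (ℝ × ℝ) × ℝ => pt p.1.1 p.2 p.1.2 :=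
      continuous_pt.comp ((continuous_fst.comp continuous_fst).prodMk
        (continuous_snd.prodMk (continuous_snd.comp continuous_fst)))
    have : Measurable fun p : (ℝ × ℝ) × ℝ =>
        C.indicator (fun x => ENNReal.ofReal (k n (u x - t))) (pt p.1.1 p.2 p.1.2) *
          ‖fderiv ℝ u (pt p.1.1 p.2 p.1.2) (dir p.1.1)‖ₑ :=
      ((hw n).comp hpt.measurable).mul
        (hfd.comp (hpt.prodMk (continuous_fst.comp continuous_fst))).measurable.enorm
    exact this.lintegral_prod_right'
  have hmeas₁ : ∀ θ n, Measurable fun τ => J n θ τ := fun θ n => (hmeas n).of_uncurry_left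
  have hmeas₂ : ∀ n, Measurable fun θ => ∫⁻ τ, J n θ τ := fun n => (hmeas n).lintegral_prod_right'
  suffices 2 * totalWidth C ≤
      liminf (fun n => ∫⁻ θ in Ioo 0 (2 * Real.pi), ∫⁻ τ, J n θ τ) atTop from this
  clear_value J
  calc 2 * totalWidth C = ∫⁻ θ in Ioo 0 (2 * Real.pi), 2 * volume (shadow θ C) :=
        (lintegral_const_mul' _ _ (by norm_num)).symm
    _ ≤ ∫⁻ θ in Ioo 0 (2 * Real.pi), liminf (fun n => ∫⁻ τ, J n θ τ) atTop := by
        refine lintegral_mono fun θ => ?_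
        calc 2 * volume (shadow θ C) = ∫⁻ τ in shadow θ C, 2 := by
              rw [setLIntegral_const]
          _ ≤ ∫⁻ τ in shadow θ C, liminf (fun n => J n θ τ) atTop := by
              refine setLIntegral_mono' (isOpen_shadow θ hCo).measurableSet fun τ hτ => ?_
              obtain ⟨σ, hσ⟩ := mem_shadow.1 hτ
              refine le_liminf_of_le (by isBoundedDefault) ?_
              filter_upwards [hk1 (u (pt θ σ τ) - t) (sub_pos.2 (hCU hσ))] with n hn
              have := two_mul_le_lintegral_line hu hcs htp hC (hk n) (hk0 n) hσ
              rw [hn, ENNReal.ofReal_one, mul_one] at this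
              rwa [hJ]
          _ ≤ ∫⁻ τ, liminf (fun n => J n θ τ) atTop := setLIntegral_le_lintegral _ _
          _ ≤ liminf (fun n => ∫⁻ τ, J n θ τ) atTop := lintegral_liminf_le (hmeas₁ θ)
    _ ≤ liminf (fun n => ∫⁻ θ in Ioo 0 (2 * Real.pi), ∫⁻ τ, J n θ τ) atTop :=
        lintegral_liminf_le hmeas₂

lemma two_mul_setLIntegral_superlevel_le {Ω : Set Plane} (hΩ : Convex ℝ Ω) {ρ : Plane → ℝ≥0∞}
    (hc : c ≠ ∞)
    (H : ∀ Q ⊆ Ω, IsOpen Q → Convex ℝ Q → ∫⁻ x in Q, ρ x ≤ c * totalWidth Q)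
    (hu : ContDiff ℝ 1 u) (hcs : HasCompactSupport u) (hsupp : ∀ x, 0 < u x → x ∈ Ω) {t : ℝ}
    (htp : 0 < t)
    {k : ℕ → ℝ → ℝ} (hk : ∀ n, Continuous (k n)) (hk0 : ∀ n x, 0 ≤ k n x)
    (hk1 : ∀ y, 0 < y → ∀ᶠ n in atTop, ∫ x in (0 : ℝ)..y, k n x = 1) :
    2 * ∫⁻ x in {x | t < u x}, ρ x ≤
      liminf (fun n => 4 * c * ∫⁻ x, ENNReal.ofReal (k n (u x - t)) * ‖fderiv ℝ u x‖ₑ) atTop := by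
  set U := {x | t < u x} with hU
  have hUo : IsOpen U := isOpen_lt continuous_const hu.continuous
  set S : Set (Set Plane) := {C | ∃ x ∈ U, C = connectedComponentIn U x} with hS
  have hopen : ∀ C ∈ S, IsOpen C := by
    rintro _ ⟨x, -, rfl⟩
    exact hUo.connectedComponentIn
  have hdisj : S.PairwiseDisjoint id := by
    rintro _ ⟨x, hx, rfl⟩ _ ⟨y, hy, rfl⟩ hne
    by_contra hnd
    obtain ⟨z, hz1, hz2⟩ := Set.not_disjoint_iff.1 hnd
    exact hne ((connectedComponentIn_eq hz1).trans (connectedComponentIn_eq hz2).symm)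
  have hcount : S.Countable := hdisj.countable_of_isOpen hopen (by
    rintro _ ⟨x, hx, rfl⟩
    exact ⟨x, mem_connectedComponentIn hx⟩)
  have hUS : U = ⋃ C : ↥S, (C : Set Plane) := by
    ext x
    simp only [mem_iUnion]
    constructor
    · exact fun hx => ⟨⟨_, x, hx, rfl⟩, mem_connectedComponentIn hx⟩
    · rintro ⟨⟨_, y, hy, rfl⟩, hx⟩
      exact connectedComponentIn_subset _ _ hx
  have := hcount.to_subtype
  have hsum : ∀ g : Plane → ℝ≥0∞, ∫⁻ x in U, g x = ∑' C : S, ∫⁻ x in (C : Set Plane), g x := by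
    intro g
    rw [hUS]
    exact lintegral_iUnion (s := fun C : S => (C : Set Plane))
      (fun C : S => (hopen C C.2).measurableSet)
      (fun (C : S) (D : S) hCD => hdisj C.2 D.2 (fun h => hCD (Subtype.ext h))) g
  have hcomp : ∀ C : S, 2 * ∫⁻ x in (C : Set Plane), ρ x ≤ liminf (fun n => 4 * c *
      ∫⁻ x in (C : Set Plane), ENNReal.ofReal (k n (u x - t)) * ‖fderiv ℝ u x‖ₑ) atTop := by
    rintro ⟨C, hC⟩
    have hCpre : IsPreconnected C := by
      obtain ⟨x, -, rfl⟩ := hC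
      exact isPreconnected_connectedComponentIn
    have hCΩ : C ⊆ Ω := by
      obtain ⟨x, -, rfl⟩ := hC
      exact fun y hy => hsupp y (htp.trans (connectedComponentIn_subset U x hy))
    have h1 := H (convexHull ℝ C) (convexHull_min hCΩ hΩ) (hopen C hC).convexHull
      (convex_convexHull ℝ C)
    rw [totalWidth_convexHull hCpre] at h1
    have h2 := two_mul_totalWidth_le_liminf hu hcs htp hC hk hk0 hk1
    calc 2 * ∫⁻ x in C, ρ x ≤ 2 * ∫⁻ x in convexHull ℝ C, ρ x :=
          mul_le_mul_right (lintegral_mono_set (subset_convexHull ℝ C)) 2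
      _ ≤ 2 * (c * totalWidth C) := mul_le_mul_right h1 2
      _ = c * (2 * totalWidth C) := by ring
      _ ≤ c * liminf (fun n => 4 * ∫⁻ x in C, ENNReal.ofReal (k n (u x - t)) *
          ‖fderiv ℝ u x‖ₑ) atTop := mul_le_mul_right h2 c
      _ = liminf (fun n => c * (4 * ∫⁻ x in C, ENNReal.ofReal (k n (u x - t)) *
          ‖fderiv ℝ u x‖ₑ)) atTop := (ENNReal.liminf_const_mul_of_ne_top hc).symm
      _ = _ := by congr 1; funext n; ring
  calc 2 * ∫⁻ x in U, ρ x = ∑' C : S, 2 * ∫⁻ x in (C : Set Plane), ρ x := by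
        rw [hsum, ENNReal.tsum_mul_left]
    _ ≤ ∑' C : S, liminf (fun n => 4 * c *
        ∫⁻ x in (C : Set Plane), ENNReal.ofReal (k n (u x - t)) * ‖fderiv ℝ u x‖ₑ) atTop :=
        ENNReal.tsum_le_tsum hcomp
    _ ≤ liminf (fun n => ∑' C : S, 4 * c *
        ∫⁻ x in (C : Set Plane), ENNReal.ofReal (k n (u x - t)) * ‖fderiv ℝ u x‖ₑ) atTop := by
        let _ : MeasurableSpace S := ⊤
        simp_rw [← lintegral_count]
        exact lintegral_liminf_le fun n => measurable_from_top
    _ ≤ _ := by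
        refine liminf_le_liminf (Eventually.of_forall fun n => ?_)
        rw [ENNReal.tsum_mul_left, ← hsum]
        exact mul_le_mul_right (setLIntegral_le_lintegral _ _) _

/-- A weighted Sobolev inequality deduced from the corresponding inequality for convex sets. -/
lemma lintegral_mul_le_lintegral_fderiv {Ω : Set Plane} (hΩ : Convex ℝ Ω) {ρ : Plane → ℝ≥0∞}
    (hρ : Measurable ρ) (hc : c ≠ ∞)
    (H : ∀ Q ⊆ Ω, IsOpen Q → Convex ℝ Q → ∫⁻ x in Q, ρ x ≤ c * totalWidth Q)
    (hu : ContDiff ℝ 1 u) (hcs : HasCompactSupport u) (hu0 : ∀ x, 0 ≤ u x)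
    (hsupp : ∀ x, 0 < u x → x ∈ Ω) :
    ∫⁻ x, ρ x * ENNReal.ofReal (u x) ≤ 2 * c * ∫⁻ x, ‖fderiv ℝ u x‖ₑ := by
  have hε : ∀ n : ℕ, (0 : ℝ) < 1 / (n + 1) := fun n => Nat.one_div_pos_of_nat
  choose k hk hk0 hkint hk1 using fun n : ℕ => exists_kernel (hε n)
  have hk1' : ∀ y, 0 < y → ∀ᶠ n in atTop, ∫ x in (0 : ℝ)..y, k n x = 1 := by
    intro y hy
    filter_upwards [(tendsto_one_div_add_atTop_nhds_zero_nat (𝕜 := ℝ)).eventually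
      (gt_mem_nhds hy)] with n hn using hk1 n y hn.le
  have hfd : Measurable fun x => ‖fderiv ℝ u x‖ₑ := (measurable_fderiv ℝ u).enorm
  have hum := hu.continuous.measurable
  have hlayer : ∫⁻ x, ρ x * ENNReal.ofReal (u x) =
      ∫⁻ t in Ioi (0 : ℝ), ∫⁻ x in {x | t < u x}, ρ x := by
    have h1 := lintegral_withDensity_eq_lintegral_mul volume hρ
      (ENNReal.measurable_ofReal.comp hum)
    have h2 := lintegral_eq_lintegral_meas_lt (volume.withDensity ρ) (f := u)
      (Eventually.of_forall hu0) hum.aemeasurable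
    simp only [Pi.mul_apply, Function.comp_apply] at h1
    rw [← h1, h2]
    refine lintegral_congr fun t => ?_
    rw [withDensity_apply _ (measurableSet_lt measurable_const hum)]
  have hjoint : ∀ n, Measurable fun p : ℝ × Plane =>
      ENNReal.ofReal (k n (u p.2 - p.1)) * ‖fderiv ℝ u p.2‖ₑ := fun n =>
    (ENNReal.measurable_ofReal.comp ((hk n).measurable.comp
      ((hum.comp measurable_snd).sub measurable_fst))).mul (hfd.comp measurable_snd)
  have hmain : 2 * ∫⁻ x, ρ x * ENNReal.ofReal (u x) ≤ 2 * (2 * c * ∫⁻ x, ‖fderiv ℝ u x‖ₑ) := by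
    rw [hlayer, ← lintegral_const_mul' _ _ (by norm_num)]
    calc ∫⁻ t in Ioi (0 : ℝ), 2 * ∫⁻ x in {x | t < u x}, ρ x
        ≤ ∫⁻ t in Ioi (0 : ℝ), liminf (fun n => 4 * c *
          ∫⁻ x, ENNReal.ofReal (k n (u x - t)) * ‖fderiv ℝ u x‖ₑ) atTop :=
          setLIntegral_mono' measurableSet_Ioi fun t ht =>
            two_mul_setLIntegral_superlevel_le hΩ hc H hu hcs hsupp ht hk hk0 hk1'
      _ ≤ liminf (fun n => ∫⁻ t in Ioi (0 : ℝ), 4 * c *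
          ∫⁻ x, ENNReal.ofReal (k n (u x - t)) * ‖fderiv ℝ u x‖ₑ) atTop :=
          lintegral_liminf_le fun n => ((hjoint n).lintegral_prod_right').const_mul _
      _ ≤ liminf (fun _ : ℕ => 4 * c * ∫⁻ x, ‖fderiv ℝ u x‖ₑ) atTop := by
          refine liminf_le_liminf (Eventually.of_forall fun n => ?_)
          rw [lintegral_const_mul' _ _ (ENNReal.mul_ne_top (by norm_num) hc)]
          refine mul_le_mul_right ?_ _
          refine (setLIntegral_le_lintegral _ _).trans ?_
          rw [lintegral_lintegral_swap (hjoint n).aemeasurable]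
          refine lintegral_mono fun x => ?_
          rw [lintegral_mul_const' _ _ enorm_ne_top,
            lintegral_sub_left_eq_self (fun y => ENNReal.ofReal (k n y)) (u x), hkint, one_mul]
      _ = _ := by
          rw [liminf_const]; ring
  exact (ENNReal.mul_le_mul_iff_right (by norm_num) (by norm_num)).1 hmain

end Coarea

open scoped Convolution

lemma divergence_eq_sum {ι : Type*} [Fintype ι] (b : OrthonormalBasis ι ℝ Plane)
    (g : Plane → Plane) (x : Plane) :
    divergence g x = ∑ i, inner ℝ (b i) (fderiv ℝ g x (b i)) :=
  LinearMap.trace_eq_sum_inner _ b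

lemma divergence_eq_sum_fderiv {ι : Type*} [Fintype ι] (b : OrthonormalBasis ι ℝ Plane)
    {g : Plane → Plane} (hg : ContDiff ℝ 1 g) (x : Plane) :
    divergence g x = ∑ i, fderiv ℝ (fun y => inner ℝ (b i) (g y)) x (b i) := by
  rw [divergence_eq_sum b]
  refine Finset.sum_congr rfl fun i _ => ?_
  rw [fderiv_inner_apply (𝕜 := ℝ) (by fun_prop) (hg.differentiable one_ne_zero x)]
  simp

lemma continuous_divergence {g : Plane → Plane} (hg : ContDiff ℝ 1 g) :
    Continuous (divergence g) := by
  have h : divergence g = fun x => ∑ i, inner ℝ (stdOrthonormalBasis ℝ Plane i)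
      (fderiv ℝ g x (stdOrthonormalBasis ℝ Plane i)) :=
    funext fun x => divergence_eq_sum _ g x
  have := hg.continuous_fderiv one_ne_zero
  rw [h]
  fun_prop

lemma hasCompactSupport_divergence {g : Plane → Plane} (hcs : HasCompactSupport g) :
    HasCompactSupport (divergence g) := by
  refine (hcs.fderiv ℝ).mono' ?_
  intro x hx
  refine subset_tsupport _ fun h0 => hx ?_
  simp [divergence, h0]

lemma integrable_divergence {g : Plane → Plane} (hg : ContDiff ℝ 1 g) (hcs : HasCompactSupport g) :
    Integrable (divergence g) :=
  (continuous_divergence hg).integrable_of_hasCompactSupport (hasCompactSupport_divergence hcs)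

lemma divergence_comp_add_right (g : Plane → Plane) (a x : Plane) :
    divergence (fun y => g (y + a)) x = divergence g (x + a) := by
  simp only [divergence, fderiv_comp_add_right]

lemma integral_mul_divergence {u : Plane → ℝ} {g : Plane → Plane} (hu : ContDiff ℝ 1 u)
    (hg : ContDiff ℝ 1 g) (hcs : HasCompactSupport g) :
    ∫ x, u x * divergence g x = -∫ x, fderiv ℝ u x (g x) := by
  let b := stdOrthonormalBasis ℝ Plane
  have huc := hu.continuous
  have hud := hu.continuous_fderiv one_ne_zero
  have hgc := hg.continuous
  have hgi : ∀ i, ContDiff ℝ 1 fun y => inner ℝ (b i) (g y) :=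
    fun i => contDiff_const.inner ℝ hg
  have hgs : ∀ i, HasCompactSupport fun y => inner ℝ (b i) (g y) := fun i =>
    hcs.comp_left (g := fun v => inner ℝ (b i) v) (inner_zero_right _)
  have hgd : ∀ i, Continuous fun x => fderiv ℝ (fun y => inner ℝ (b i) (g y)) x (b i) := fun i =>
    ((hgi i).continuous_fderiv one_ne_zero).clm_apply continuous_const
  have hgds : ∀ i, HasCompactSupport fun x => fderiv ℝ (fun y => inner ℝ (b i) (g y)) x (b i) :=
    fun i => (hgs i).fderiv_apply ℝ (b i)
  have h1 : ∀ i, Integrable fun x => u x * fderiv ℝ (fun y => inner ℝ (b i) (g y)) x (b i) :=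
    fun i => (huc.mul (hgd i)).integrable_of_hasCompactSupport (hgds i).mul_left
  have h2 : ∀ i, Integrable fun x => fderiv ℝ u x (b i) * inner ℝ (b i) (g x) := fun i =>
    ((hud.clm_apply continuous_const).mul (hgi i).continuous).integrable_of_hasCompactSupport
      (hgs i).mul_left
  have h3 : ∀ i, Integrable fun x => u x * inner ℝ (b i) (g x) := fun i =>
    (huc.mul (hgi i).continuous).integrable_of_hasCompactSupport (hgs i).mul_left
  have h4 : ∀ x, fderiv ℝ u x (g x) = ∑ i, fderiv ℝ u x (b i) * inner ℝ (b i) (g x) := by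
    intro x
    conv_lhs => rw [← b.sum_repr' (g x)]
    simp [mul_comm]
  simp_rw [divergence_eq_sum_fderiv b hg, h4, Finset.mul_sum]
  rw [integral_finsetSum _ fun i _ => h1 i, integral_finsetSum _ fun i _ => h2 i,
    ← Finset.sum_neg_distrib]
  refine Finset.sum_congr rfl fun i _ => ?_
  exact integral_mul_fderiv_eq_neg_fderiv_mul_of_integrable (h2 i) (h1 i) (h3 i)
    (fun x _ => hu.differentiable one_ne_zero x)
    (fun x _ => (hgi i).differentiable one_ne_zero x)

lemma le_perimeter {F : Set Plane} {g : Plane → Plane} (hg : ContDiff ℝ 1 g)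
    (hcs : HasCompactSupport g) (hg1 : ∀ x, ‖g x‖ ≤ 1) :
    ENNReal.ofReal (∫ x in F, divergence g x) ≤ perimeter F :=
  le_iSup₂_of_le g ⟨hg, hcs, hg1⟩ le_rfl

lemma le_perimeter_translate {F : Set Plane} (hF : MeasurableSet F) {g : Plane → Plane}
    (hg : ContDiff ℝ 1 g) (hcs : HasCompactSupport g) (hg1 : ∀ x, ‖g x‖ ≤ 1) (a : Plane) :
    ENNReal.ofReal (∫ x, F.indicator 1 (x - a) * divergence g x) ≤ perimeter F := by
  have h1 : ∫ x, F.indicator 1 (x - a) * divergence g x =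
      ∫ x in F, divergence (fun y => g (y + a)) x := by
    rw [← integral_add_right_eq_self _ a, ← integral_indicator hF]
    refine integral_congr_ae (Eventually.of_forall fun x => ?_)
    by_cases hx : x ∈ F <;> simp [hx, divergence_comp_add_right]
  rw [h1]
  exact le_perimeter (by fun_prop) (hcs.comp_homeomorph (Homeomorph.addRight a))
    fun x => hg1 _

lemma lintegral_fderiv_le_of_forall_divergence {u : Plane → ℝ} (hu : ContDiff ℝ 2 u)
    (hcs : HasCompactSupport u) {P : ℝ≥0∞}
    (hP : ∀ g : Plane → Plane, ContDiff ℝ 1 g → HasCompactSupport g → (∀ x, ‖g x‖ ≤ 1) →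
      ENNReal.ofReal (∫ x, u x * divergence g x) ≤ P) :
    ∫⁻ x, ‖fderiv ℝ u x‖ₑ ≤ P := by
  let b := stdOrthonormalBasis ℝ Plane
  have hu1 : ContDiff ℝ 1 u := hu.of_le (by norm_num)
  have hfd : ContDiff ℝ 1 (fderiv ℝ u) := hu.fderiv_right (by norm_num)
  set G : Plane → Plane := fun x => ∑ i, fderiv ℝ u x (b i) • b i with hG
  have hGd : ContDiff ℝ 1 G := by
    simp only [hG]
    fun_prop
  have hGi : ∀ x v, fderiv ℝ u x v = inner ℝ (G x) v := by
    intro x v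
    conv_lhs => rw [← b.sum_repr' v]
    simp [hG, sum_inner, inner_smul_left, mul_comm]
  have hGn : ∀ x, ‖fderiv ℝ u x‖ ≤ ‖G x‖ := fun x =>
    ContinuousLinearMap.opNorm_le_bound _ (norm_nonneg _) fun v => by
      rw [hGi]
      exact norm_inner_le_norm _ _
  have hGs : HasCompactSupport G := (hcs.fderiv ℝ).comp_left
    (g := fun L : Plane →L[ℝ] ℝ => ∑ i, L (b i) • b i) (by simp)
  let q : ℕ → Plane → ℝ := fun n x => √(‖G x‖ ^ 2 + (1 / (n + 1 : ℝ)) ^ 2)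
  have hpos : ∀ (n : ℕ) x, 0 < ‖G x‖ ^ 2 + (1 / (n + 1 : ℝ)) ^ 2 := fun n x => by positivity
  have hqpos : ∀ n x, 0 < q n x := fun n x => Real.sqrt_pos.2 (hpos n x)
  have hqd : ∀ n, ContDiff ℝ 1 (q n) := fun n =>
    ((hGd.norm_sq ℝ).add contDiff_const).sqrt fun x => (hpos n x).ne'
  have hqG : ∀ n x, ‖G x‖ ≤ q n x := fun n x =>
    Real.le_sqrt_of_sq_le (by nlinarith [sq_nonneg (1 / (n + 1 : ℝ))])
  have hbound : ∀ n, ∫⁻ x, ENNReal.ofReal (‖G x‖ ^ 2 / q n x) ≤ P := by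
    intro n
    let g : Plane → Plane := fun x => -((q n x)⁻¹ • G x)
    have hgd : ContDiff ℝ 1 g := (((hqd n).inv fun x => (hqpos n x).ne').smul hGd).neg
    have hgs : HasCompactSupport g := by
      refine hGs.mono fun x hx h0 => hx ?_
      simp [g, h0]
    have hg1 : ∀ x, ‖g x‖ ≤ 1 := fun x => by
      simp only [g, norm_neg, norm_smul, norm_inv, Real.norm_of_nonneg (hqpos n x).le]
      exact inv_mul_le_one_of_le₀ (hqG n x) (hqpos n x).le
    have h1 := hP g hgd hgs hg1
    rw [integral_mul_divergence hu1 hgd hgs, ← integral_neg] at h1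
    have h2 : ∀ x, -(fderiv ℝ u x (g x)) = ‖G x‖ ^ 2 / q n x := fun x => by
      rw [hGi]
      simp only [g, inner_neg_right, neg_neg, inner_smul_right, real_inner_self_eq_norm_sq]
      rw [div_eq_inv_mul]
    simp_rw [h2] at h1
    rwa [ofReal_integral_eq_lintegral_ofReal] at h1
    · refine Continuous.integrable_of_hasCompactSupport
        ((hGd.continuous.norm.pow 2).div (hqd n).continuous fun x => (hqpos n x).ne') ?_
      refine hGs.mono fun x hx h0 => hx ?_
      simp [h0]
    · exact Eventually.of_forall fun x => div_nonneg (sq_nonneg _) (hqpos n x).le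
  have hlim : ∀ x, Tendsto (fun n => ENNReal.ofReal (‖G x‖ ^ 2 / q n x)) atTop
      (𝓝 (ENNReal.ofReal ‖G x‖)) := by
    intro x
    rcases eq_or_ne ‖G x‖ 0 with h0 | h0
    · simp [h0]
    refine ENNReal.tendsto_ofReal ?_
    have h1 : Tendsto (fun n : ℕ => q n x) atTop (𝓝 (√(‖G x‖ ^ 2 + 0 ^ 2))) :=
      (tendsto_const_nhds.add ((tendsto_one_div_add_atTop_nhds_zero_nat (𝕜 := ℝ)).pow 2)).sqrt
    have h2 : √(‖G x‖ ^ 2 + 0 ^ 2) = ‖G x‖ := by simp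
    rw [h2] at h1
    have h3 := (tendsto_const_nhds (x := ‖G x‖ ^ 2)).div h1 h0
    rw [sq, mul_div_assoc, div_self h0, mul_one] at h3
    exact h3.congr fun n => by simp [sq]
  calc ∫⁻ x, ‖fderiv ℝ u x‖ₑ ≤ ∫⁻ x, liminf (fun n => ENNReal.ofReal (‖G x‖ ^ 2 / q n x)) atTop :=
        lintegral_mono fun x => by
          rw [(hlim x).liminf_eq, ← ofReal_norm]
          exact ENNReal.ofReal_le_ofReal (hGn x)
    _ ≤ liminf (fun n => ∫⁻ x, ENNReal.ofReal (‖G x‖ ^ 2 / q n x)) atTop :=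
        lintegral_liminf_le fun n => ENNReal.measurable_ofReal.comp
          ((hGd.continuous.norm.pow 2).div (hqd n).continuous
            fun x => (hqpos n x).ne').measurable
    _ ≤ liminf (fun _ : ℕ => P) atTop := liminf_le_liminf (Eventually.of_forall hbound)
    _ = P := liminf_const P

/-- The mollification of the characteristic function of a set by a bump function. -/
def mollify (φ : ContDiffBump (0 : Plane)) (F : Set Plane) : Plane → ℝ :=
  φ.normed volume ⋆[ContinuousLinearMap.lsmul ℝ ℝ, volume] F.indicator 1

section Mollify

variable {φ : ContDiffBump (0 : Plane)} {F : Set Plane}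

lemma mollify_apply (x : Plane) :
    mollify φ F x = ∫ y, φ.normed volume y * F.indicator 1 (x - y) := rfl

lemma mollify_nonneg (x : Plane) : 0 ≤ mollify φ F x :=
  integral_nonneg fun y => mul_nonneg (φ.nonneg_normed y)
    (indicator_nonneg (fun _ _ => zero_le_one) _)

lemma mem_add_ball_of_mollify_pos {x : Plane} (hx : 0 < mollify φ F x) :
    x ∈ F + ball 0 φ.rOut := by
  have h := support_convolution_subset_swap (ContinuousLinearMap.lsmul ℝ ℝ) hx.ne'
  rw [φ.support_normed_eq] at h
  exact add_subset_add_right support_indicator_subset h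

lemma locallyIntegrable_indicator_one (hF : MeasurableSet F) :
    LocallyIntegrable (F.indicator (1 : Plane → ℝ)) :=
  (locallyIntegrable_const 1).indicator hF

lemma contDiff_mollify (hF : MeasurableSet F) {n : ℕ∞} : ContDiff ℝ n (mollify φ F) :=
  φ.hasCompactSupport_normed.contDiff_convolution_left _ φ.contDiff_normed
    (locallyIntegrable_indicator_one hF)

lemma hasCompactSupport_mollify (hb : Bornology.IsBounded F) :
    HasCompactSupport (mollify φ F) :=
  φ.hasCompactSupport_normed.convolution _
    (HasCompactSupport.of_support_subset_isCompact hb.isCompact_closure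
      (support_indicator_subset.trans subset_closure))

lemma ofReal_integral_mollify_mul_divergence_le (hF : MeasurableSet F) {g : Plane → Plane}
    (hg : ContDiff ℝ 1 g) (hcs : HasCompactSupport g) (hg1 : ∀ x, ‖g x‖ ≤ 1) :
    ENNReal.ofReal (∫ x, mollify φ F x * divergence g x) ≤ perimeter F := by
  rcases eq_or_ne (perimeter F) ∞ with hP | hP
  · simp [hP]
  refine ENNReal.ofReal_le_of_le_toReal ?_
  have hm : Measurable (F.indicator (1 : Plane → ℝ)) := measurable_one.indicator hF
  have hint : Integrable (fun p : Plane × Plane =>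
      φ.normed volume p.2 * F.indicator 1 (p.1 - p.2) * divergence g p.1)
      (volume.prod volume) := by
    refine ((integrable_divergence hg hcs).norm.mul_prod φ.integrable_normed).mono' ?_ ?_
    · exact (((φ.continuous_normed.measurable.comp measurable_snd).mul
        (hm.comp (measurable_fst.sub measurable_snd))).mul
        ((continuous_divergence hg).measurable.comp measurable_fst)).aestronglyMeasurable
    · refine Eventually.of_forall fun p => ?_
      rw [norm_mul, norm_mul, mul_comm ‖divergence g p.1‖, Real.norm_of_nonneg (φ.nonneg_normed _)]
      refine mul_le_mul_of_nonneg_right ?_ (norm_nonneg _)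
      refine mul_le_of_le_one_right (φ.nonneg_normed _) ?_
      by_cases h : p.1 - p.2 ∈ F <;> simp [h]
  calc ∫ x, mollify φ F x * divergence g x
      = ∫ x, ∫ y, φ.normed volume y * F.indicator 1 (x - y) * divergence g x := by
        refine integral_congr_ae (Eventually.of_forall fun x => ?_)
        simp only [mollify_apply, ← integral_mul_const]
    _ = ∫ y, ∫ x, φ.normed volume y * F.indicator 1 (x - y) * divergence g x :=
        integral_integral_swap hint
    _ ≤ ∫ y, φ.normed volume y * (perimeter F).toReal := by
        refine integral_mono hint.integral_prod_right (φ.integrable_normed.mul_const _)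
          fun y => ?_
        simp_rw [mul_assoc]
        rw [integral_const_mul]
        exact mul_le_mul_of_nonneg_left
          ((ENNReal.ofReal_le_iff_le_toReal hP).1 (le_perimeter_translate hF hg hcs hg1 y))
          (φ.nonneg_normed y)
    _ = (perimeter F).toReal := by
        rw [integral_mul_const, φ.integral_normed, one_mul]

lemma lintegral_fderiv_mollify_le (hF : MeasurableSet F) (hb : Bornology.IsBounded F) :
    ∫⁻ x, ‖fderiv ℝ (mollify φ F) x‖ₑ ≤ perimeter F :=
  lintegral_fderiv_le_of_forall_divergence (contDiff_mollify (n := 2) hF)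
    (hasCompactSupport_mollify hb) fun _ hg hcs hg1 =>
      ofReal_integral_mollify_mul_divergence_le hF hg hcs hg1

end Mollify

lemma homothety_eq (x₀ : Plane) (t : ℝ) (x : Plane) :
    AffineMap.homothety x₀ t x = x₀ + t • (x - x₀) := by
  rw [AffineMap.homothety_apply, vsub_eq_sub, vadd_eq_add, add_comm]

lemma continuous_homothety (x₀ : Plane) (t : ℝ) :
    Continuous (AffineMap.homothety x₀ t : Plane → Plane) := by
  have : (AffineMap.homothety x₀ t : Plane → Plane) = fun x => x₀ + t • (x - x₀) :=
    funext (homothety_eq x₀ t)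
  rw [this]
  fun_prop

lemma lintegral_homothety_image (x₀ : Plane) {t : ℝ} (ht : 0 < t) {Q : Set Plane}
    (hQ : MeasurableSet Q) (ρ : Plane → ℝ≥0∞) :
    ∫⁻ x in AffineMap.homothety x₀ t '' Q, ρ x =
      ENNReal.ofReal (t ^ 2) * ∫⁻ x in Q, ρ (AffineMap.homothety x₀ t x) := by
  have hd : ∀ x ∈ Q, HasFDerivWithinAt (AffineMap.homothety x₀ t : Plane → Plane)
      (t • ContinuousLinearMap.id ℝ Plane) Q x := by
    intro x _
    have h : HasFDerivAt (fun x : Plane => x₀ + t • (x - x₀))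
        (t • ContinuousLinearMap.id ℝ Plane) x :=
      (((hasFDerivAt_id x).sub_const x₀).const_smul t).const_add x₀
    exact (h.congr_of_eventuallyEq
      (Eventually.of_forall (homothety_eq x₀ t))).hasFDerivWithinAt
  have hinj : InjOn (AffineMap.homothety x₀ t : Plane → Plane) Q := by
    intro x _ y _ h
    rw [homothety_eq, homothety_eq] at h
    exact sub_left_injective (smul_right_injective _ ht.ne' (add_left_cancel h))
  have hdet : (t • ContinuousLinearMap.id ℝ Plane).det = t ^ 2 := by
    simp [ContinuousLinearMap.det, LinearMap.det_smul]
  rw [lintegral_image_eq_lintegral_abs_det_fderiv_mul volume hQ hd hinj]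
  simp_rw [hdet, abs_of_pos (pow_pos ht 2)]
  exact lintegral_const_mul' _ _ ENNReal.ofReal_ne_top

section Sobolev

variable {Ω : Set Plane} {ρ : Plane → ℝ≥0∞} {c : ℝ≥0∞}

lemma exists_add_ball_subset_homothety_preimage (ho : IsOpen Ω) (hconv : Convex ℝ Ω) {x₀ : Plane}
    (hx₀ : x₀ ∈ Ω) {t : ℝ} (ht : 0 < t) (ht1 : t < 1) :
    ∃ δ > 0, Ω + ball 0 δ ⊆ AffineMap.homothety x₀ t ⁻¹' Ω := by
  obtain ⟨R, hR, hRΩ⟩ := Metric.isOpen_iff.1 ho x₀ hx₀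
  have h1t : 0 < 1 - t := sub_pos.2 ht1
  refine ⟨(1 - t) * R / t, by positivity, ?_⟩
  rintro _ ⟨y, hy, v, hv, rfl⟩
  rw [mem_ball_zero_iff, lt_div_iff₀ ht] at hv
  have hz : x₀ + (t / (1 - t)) • v ∈ Ω := by
    refine hRΩ ?_
    rw [mem_ball_iff_norm, add_sub_cancel_left, norm_smul, Real.norm_of_nonneg (by positivity),
      div_mul_eq_mul_div, div_lt_iff₀ h1t]
    linarith
  have h := hconv hy hz ht.le h1t.le (by ring)
  change AffineMap.homothety x₀ t (y + v) ∈ Ω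
  convert h using 1
  rw [homothety_eq, smul_add (1 - t), smul_smul, mul_div_cancel₀ _ h1t.ne']
  module

lemma setLIntegral_comp_homothety_le
    (H : ∀ Q ⊆ Ω, IsOpen Q → Convex ℝ Q → ∫⁻ x in Q, ρ x ≤ c * totalWidth Q)
    (x₀ : Plane) {t : ℝ} (ht : 0 < t) {Q : Set Plane}
    (hQ : Q ⊆ AffineMap.homothety x₀ t ⁻¹' Ω) (hQo : IsOpen Q) (hQc : Convex ℝ Q) :
    ∫⁻ x in Q, ρ (AffineMap.homothety x₀ t x) ≤ ENNReal.ofReal t⁻¹ * c * totalWidth Q := by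
  have hopen : IsOpen (AffineMap.homothety x₀ t '' Q) :=
    AffineMap.homothety_isOpenMap x₀ t ht.ne' Q hQo
  have h := H _ (image_subset_iff.2 hQ) hopen (hQc.affine_image _)
  rw [lintegral_homothety_image x₀ ht hQo.measurableSet, totalWidth_homothety x₀ ht.le] at h
  have h2 : ENNReal.ofReal (t⁻¹ ^ 2) * ENNReal.ofReal (t ^ 2) = 1 := by
    rw [← ENNReal.ofReal_mul (by positivity), ← mul_pow, inv_mul_cancel₀ ht.ne', one_pow,
      ENNReal.ofReal_one]
  have h3 : ENNReal.ofReal (t⁻¹ ^ 2) * ENNReal.ofReal t = ENNReal.ofReal t⁻¹ := by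
    rw [← ENNReal.ofReal_mul (by positivity), sq, mul_assoc, inv_mul_cancel₀ ht.ne', mul_one]
  calc ∫⁻ x in Q, ρ (AffineMap.homothety x₀ t x)
      = ENNReal.ofReal (t⁻¹ ^ 2) *
          (ENNReal.ofReal (t ^ 2) * ∫⁻ x in Q, ρ (AffineMap.homothety x₀ t x)) := by
        rw [← mul_assoc, h2, one_mul]
    _ ≤ ENNReal.ofReal (t⁻¹ ^ 2) * (c * (ENNReal.ofReal t * totalWidth Q)) :=
        mul_le_mul_right h _
    _ = ENNReal.ofReal (t⁻¹ ^ 2) * ENNReal.ofReal t * c * totalWidth Q := by ring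
    _ = _ := by rw [h3]

lemma setLIntegral_comp_homothety_le_perimeter (ho : IsOpen Ω) (hconv : Convex ℝ Ω) {x₀ : Plane}
    (hx₀ : x₀ ∈ Ω) (hρ : Measurable ρ) (hρt : ∀ x, ρ x ≠ ∞) (hc : c ≠ ∞)
    (H : ∀ Q ⊆ Ω, IsOpen Q → Convex ℝ Q → ∫⁻ x in Q, ρ x ≤ c * totalWidth Q)
    {F : Set Plane} (hF : MeasurableSet F) (hFΩ : F ⊆ Ω) (hb : Bornology.IsBounded F)
    {t : ℝ} (ht : 0 < t) (ht1 : t < 1) :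
    ∫⁻ x in F, ρ (AffineMap.homothety x₀ t x) ≤
      ENNReal.ofReal t⁻¹ * (2 * c * perimeter F) := by
  obtain ⟨δ, hδ, hδΩ⟩ := exists_add_ball_subset_homothety_preimage ho hconv hx₀ ht ht1
  have hε : ∀ n : ℕ, (0 : ℝ) < 1 / (n + 1) := fun n => Nat.one_div_pos_of_nat
  let φ : ℕ → ContDiffBump (0 : Plane) := fun n =>
    ⟨1 / (n + 1) / 2, 1 / (n + 1), half_pos (hε n), half_lt_self (hε n)⟩
  have hφ : Tendsto (fun n => (φ n).rOut) atTop (𝓝 0) := tendsto_one_div_add_atTop_nhds_zero_nat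
  have hφ' : ∀ᶠ n in atTop, (φ n).rOut ≤ 2 * (φ n).rIn :=
    Eventually.of_forall fun n => by simp only [φ]; linarith
  have hae := ContDiffBump.ae_convolution_tendsto_right_of_locallyIntegrable (μ := volume) hφ hφ'
    (locallyIntegrable_indicator_one hF)
  have hρm : Measurable fun x => ρ (AffineMap.homothety x₀ t x) :=
    hρ.comp (continuous_homothety x₀ t).measurable
  have hconv' : Convex ℝ (AffineMap.homothety x₀ t ⁻¹' Ω) := hconv.affine_preimage _
  have hbound : ∀ᶠ n in atTop, ∫⁻ x, ρ (AffineMap.homothety x₀ t x) *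
      ENNReal.ofReal (mollify (φ n) F x) ≤ ENNReal.ofReal t⁻¹ * (2 * c * perimeter F) := by
    filter_upwards [hφ.eventually (gt_mem_nhds hδ)] with n hn
    have hsub : ∀ x, 0 < mollify (φ n) F x → x ∈ AffineMap.homothety x₀ t ⁻¹' Ω := fun x hx =>
      hδΩ (add_subset_add hFΩ (ball_subset_ball hn.le) (mem_add_ball_of_mollify_pos hx))
    calc _ ≤ 2 * (ENNReal.ofReal t⁻¹ * c) * ∫⁻ x, ‖fderiv ℝ (mollify (φ n) F) x‖ₑ :=
          lintegral_mul_le_lintegral_fderiv hconv' hρm (ENNReal.mul_ne_top ENNReal.ofReal_ne_top hc)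
            (fun Q hQ hQo hQc => setLIntegral_comp_homothety_le H x₀ ht hQ hQo hQc)
            (contDiff_mollify (n := 1) hF) (hasCompactSupport_mollify hb) mollify_nonneg hsub
      _ ≤ 2 * (ENNReal.ofReal t⁻¹ * c) * perimeter F :=
          mul_le_mul_right (lintegral_fderiv_mollify_le hF hb) _
      _ = _ := by ring
  calc ∫⁻ x in F, ρ (AffineMap.homothety x₀ t x)
      ≤ ∫⁻ x in F, liminf (fun n => ρ (AffineMap.homothety x₀ t x) *
          ENNReal.ofReal (mollify (φ n) F x)) atTop := by
        refine setLIntegral_mono_ae' hF ?_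
        filter_upwards [hae] with x hx hxF
        rw [indicator_of_mem hxF, Pi.one_apply] at hx
        have h1 : Tendsto (fun n => ρ (AffineMap.homothety x₀ t x) *
            ENNReal.ofReal (mollify (φ n) F x)) atTop
            (𝓝 (ρ (AffineMap.homothety x₀ t x) * ENNReal.ofReal 1)) :=
          ENNReal.Tendsto.const_mul (ENNReal.tendsto_ofReal hx) (Or.inr (hρt _))
        rw [h1.liminf_eq, ENNReal.ofReal_one, mul_one]
    _ ≤ liminf (fun n => ∫⁻ x in F, ρ (AffineMap.homothety x₀ t x) *
          ENNReal.ofReal (mollify (φ n) F x)) atTop :=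
        lintegral_liminf_le fun n => hρm.mul (ENNReal.measurable_ofReal.comp
          (contDiff_mollify (n := 1) hF).continuous.measurable)
    _ ≤ liminf (fun _ : ℕ => ENNReal.ofReal t⁻¹ * (2 * c * perimeter F)) atTop := by
        refine liminf_le_liminf ?_
        filter_upwards [hbound] with n hn using (setLIntegral_le_lintegral _ _).trans hn
    _ = _ := liminf_const _

/-- A weighted isoperimetric inequality deduced from the corresponding inequality for
convex sets. -/
lemma setLIntegral_le_perimeter (ho : IsOpen Ω) (hconv : Convex ℝ Ω)
    (hρ : LowerSemicontinuous ρ) (hρt : ∀ x, ρ x ≠ ∞) (hc : c ≠ ∞)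
    (H : ∀ Q ⊆ Ω, IsOpen Q → Convex ℝ Q → ∫⁻ x in Q, ρ x ≤ c * totalWidth Q)
    {F : Set Plane} (hF : MeasurableSet F) (hFΩ : F ⊆ Ω) (hb : Bornology.IsBounded F) :
    ∫⁻ x in F, ρ x ≤ 2 * c * perimeter F := by
  rcases F.eq_empty_or_nonempty with rfl | ⟨x₀, hx₀⟩
  · simp
  let t : ℕ → ℝ := fun n => 1 - 1 / (n + 2)
  have htp : ∀ n, 0 < t n := fun n => by
    have : (1 : ℝ) / (n + 2) < 1 := by
      rw [div_lt_one (by positivity)]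
      linarith [n.cast_nonneg (α := ℝ)]
    simp only [t]; linarith
  have ht1 : ∀ n, t n < 1 := fun n => sub_lt_self _ (by positivity)
  have htl : Tendsto t atTop (𝓝 1) := by
    have h := (tendsto_one_div_add_atTop_nhds_zero_nat (𝕜 := ℝ)).comp (tendsto_add_atTop_nat 1)
    have h2 := (tendsto_const_nhds (x := (1 : ℝ))).sub h
    rw [sub_zero] at h2
    refine h2.congr fun n => ?_
    simp only [t, Function.comp_apply, Nat.cast_add, Nat.cast_one]
    ring_nf
  have hlim : Tendsto (fun n => ENNReal.ofReal (t n)⁻¹ * (2 * c * perimeter F)) atTop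
      (𝓝 (2 * c * perimeter F)) := by
    have h := ENNReal.tendsto_ofReal (htl.inv₀ one_ne_zero)
    rw [inv_one, ENNReal.ofReal_one] at h
    have h2 := ENNReal.Tendsto.mul_const (b := 2 * c * perimeter F) h (Or.inl one_ne_zero)
    rwa [one_mul] at h2
  calc ∫⁻ x in F, ρ x
      ≤ ∫⁻ x in F, liminf (fun n => ρ (AffineMap.homothety x₀ (t n) x)) atTop := by
        refine lintegral_mono fun x => ?_
        have hx : Tendsto (fun n => AffineMap.homothety x₀ (t n) x) atTop (𝓝 x) := by
          simp_rw [homothety_eq]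
          have h := (htl.smul_const (x - x₀)).const_add x₀
          rwa [one_smul, add_sub_cancel] at h
        refine le_of_forall_lt fun a ha => ?_
        obtain ⟨b, hab, hb'⟩ := exists_between ha
        refine hab.trans_le (le_liminf_of_le (by isBoundedDefault) ?_)
        filter_upwards [hx.eventually (hρ x b hb')] with n hn using hn.le
    _ ≤ liminf (fun n => ∫⁻ x in F, ρ (AffineMap.homothety x₀ (t n) x)) atTop :=
        lintegral_liminf_le fun n =>
          hρ.measurable.comp (continuous_homothety x₀ (t n)).measurable
    _ ≤ liminf (fun n => ENNReal.ofReal (t n)⁻¹ * (2 * c * perimeter F)) atTop :=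
        liminf_le_liminf (Eventually.of_forall fun n =>
          setLIntegral_comp_homothety_le_perimeter ho hconv (hFΩ hx₀) hρ.measurable hρt hc H
            hF hFΩ hb (htp n) (ht1 n))
    _ = _ := hlim.liminf_eq

end Sobolev

lemma ofReal_integral_mul_divergence_le {u : Plane → ℝ} {C : ℝ≥0} (hu : LipschitzWith C u)
    {g : Plane → Plane} (hg : ContDiff ℝ 1 g) (hcs : HasCompactSupport g) (hg1 : ∀ x, ‖g x‖ ≤ 1) :
    ENNReal.ofReal (∫ x, u x * divergence g x) ≤ ∫⁻ x, ‖fderiv ℝ u x‖ₑ := by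
  let b := stdOrthonormalBasis ℝ Plane
  have hgi : ∀ i, ContDiff ℝ 1 fun y => inner ℝ (b i) (g y) :=
    fun i => contDiff_const.inner ℝ hg
  have hgs : ∀ i, HasCompactSupport fun y => inner ℝ (b i) (g y) := fun i =>
    hcs.comp_left (g := fun v => inner ℝ (b i) v) (inner_zero_right _)
  have hgd : ∀ i, Continuous fun x => fderiv ℝ (fun y => inner ℝ (b i) (g y)) x (b i) := fun i =>
    ((hgi i).continuous_fderiv one_ne_zero).clm_apply continuous_const
  have h1 : ∀ i, Integrable fun x => u x * fderiv ℝ (fun y => inner ℝ (b i) (g y)) x (b i) :=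
    fun i => (hu.continuous.mul (hgd i)).integrable_of_hasCompactSupport
      ((hgs i).fderiv_apply ℝ (b i)).mul_left
  have h2 : ∀ i, Integrable fun x => lineDeriv ℝ u x (b i) * inner ℝ (b i) (g x) := fun i =>
    (hu.locallyIntegrable_lineDeriv (b i)).integrable_smul_right_of_hasCompactSupport
      (hgi i).continuous (hgs i)
  have h3 : ∀ i, ∫ x, u x * fderiv ℝ (fun y => inner ℝ (b i) (g y)) x (b i) =
      -∫ x, lineDeriv ℝ u x (b i) * inner ℝ (b i) (g x) := by
    intro i
    obtain ⟨D, hD⟩ := (hgi i).lipschitzWith_of_hasCompactSupport (hgs i) one_ne_zero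
    rw [hu.integral_lineDeriv_mul_eq hD (hgs i), ← integral_neg]
    refine integral_congr_ae (Eventually.of_forall fun x => ?_)
    simp only [((hgi i).differentiable one_ne_zero x).lineDeriv_eq_fderiv, map_neg]
    ring
  have h4 : ∫ x, u x * divergence g x =
      -∫ x, ∑ i, lineDeriv ℝ u x (b i) * inner ℝ (b i) (g x) := by
    simp_rw [divergence_eq_sum_fderiv b hg, Finset.mul_sum]
    rw [integral_finsetSum _ fun i _ => h1 i, integral_finsetSum _ fun i _ => h2 i,
      ← Finset.sum_neg_distrib]
    exact Finset.sum_congr rfl fun i _ => h3 i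
  rw [h4, ← integral_neg]
  refine (Real.ofReal_le_enorm _).trans ((enorm_integral_le_lintegral_enorm _).trans ?_)
  refine lintegral_mono_ae ?_
  filter_upwards [hu.ae_differentiableAt] with x hx
  have h5 : ∑ i, lineDeriv ℝ u x (b i) * inner ℝ (b i) (g x) = fderiv ℝ u x (g x) := by
    simp_rw [hx.lineDeriv_eq_fderiv]
    conv_rhs => rw [← b.sum_repr' (g x)]
    simp [mul_comm]
  rw [h5, enorm_neg, ← ofReal_norm, ← ofReal_norm]
  refine ENNReal.ofReal_le_ofReal (((fderiv ℝ u x).le_opNorm _).trans ?_)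
  exact mul_le_of_le_one_right (norm_nonneg _) (hg1 x)

/-- The perimeter of a convex set is at most half its integrated width. -/
lemma two_mul_perimeter_le_totalWidth {E : Set Plane} (ho : IsOpen E)
    (hb : Bornology.IsBounded E) (hc : Convex ℝ E) : 2 * perimeter E ≤ totalWidth E := by
  have hcut : ∀ s : ℝ, 0 < s → ∀ g : Plane → Plane, ContDiff ℝ 1 g → HasCompactSupport g →
      (∀ x, ‖g x‖ ≤ 1) →
      2 * ENNReal.ofReal (∫ x, min 1 (s⁻¹ * inDist E x) * divergence g x) ≤ totalWidth E := by
    intro s hs g hg hcs hg1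
    have hlip : LipschitzWith ‖s⁻¹‖₊ fun x => min 1 (s⁻¹ * inDist E x) := by
      have h := ((lipschitzWith_smul (s⁻¹ : ℝ)).comp (lipschitz_inDist E)).const_min 1
      rwa [mul_one] at h
    have hfd : ∀ x, ‖fderiv ℝ (fun x => min 1 (s⁻¹ * inDist E x)) x‖ₑ ≤
        (E \ innerSet E s).indicator (fun _ => ENNReal.ofReal s⁻¹) x := by
      intro x
      by_cases hx : x ∈ E \ innerSet E s
      · rw [indicator_of_mem hx, ← ofReal_norm]
        refine ENNReal.ofReal_le_ofReal ((norm_fderiv_le_of_lipschitz ℝ hlip).trans ?_)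
        rw [coe_nnnorm, Real.norm_of_nonneg (by positivity)]
      · suffices fderiv ℝ (fun x => min 1 (s⁻¹ * inDist E x)) x = 0 by
          rw [this, ← ofReal_norm, norm_zero, ENNReal.ofReal_zero]
          exact zero_le
        by_cases hxE : x ∈ E
        · have hxs : s ≤ inDist E x := not_not.1 fun h => hx ⟨hxE, h⟩
          refine IsLocalMax.fderiv_eq_zero (Eventually.of_forall fun y => ?_)
          have h1 : 1 ≤ s⁻¹ * inDist E x := by rwa [le_inv_mul_iff₀ hs, mul_one]
          simp only [min_eq_left h1]
          exact min_le_left _ _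
        · refine IsLocalMin.fderiv_eq_zero (Eventually.of_forall fun y => ?_)
          simp only [inDist_of_notMem hxE, mul_zero]
          rw [min_eq_right zero_le_one]
          exact le_min zero_le_one (mul_nonneg (by positivity) (inDist_nonneg E y))
    have hm : MeasurableSet (E \ innerSet E s) :=
      ho.measurableSet.diff (isClosed_innerSet E s).measurableSet
    calc 2 * ENNReal.ofReal (∫ x, min 1 (s⁻¹ * inDist E x) * divergence g x)
        ≤ 2 * ∫⁻ x, (E \ innerSet E s).indicator (fun _ => ENNReal.ofReal s⁻¹) x :=
          mul_le_mul_right ((ofReal_integral_mul_divergence_le hlip hg hcs hg1).trans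
            (lintegral_mono hfd)) 2
      _ = ENNReal.ofReal s⁻¹ * (2 * volume (E \ innerSet E s)) := by
          rw [lintegral_indicator hm, setLIntegral_const]; ring
      _ ≤ ENNReal.ofReal s⁻¹ * (ENNReal.ofReal s * totalWidth E) :=
          mul_le_mul_right (two_mul_volume_diff_le_mul_totalWidth ho hb hc hs) _
      _ = totalWidth E := by
          rw [← mul_assoc, ← ENNReal.ofReal_mul (by positivity), inv_mul_cancel₀ hs.ne',
            ENNReal.ofReal_one, one_mul]
  rw [perimeter, ENNReal.mul_iSup]
  refine iSup_le fun g => ?_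
  rw [ENNReal.mul_iSup]
  refine iSup_le fun ⟨hg, hcs, hg1⟩ => ?_
  have hε : ∀ n : ℕ, (0 : ℝ) < 1 / (n + 1) := fun n => Nat.one_div_pos_of_nat
  have hlim : Tendsto (fun n : ℕ => ∫ x, min 1 ((1 / (n + 1 : ℝ))⁻¹ * inDist E x) *
      divergence g x) atTop (𝓝 (∫ x, E.indicator (divergence g) x)) := by
    refine tendsto_integral_of_dominated_convergence (fun x => ‖divergence g x‖)
      (fun n => ?_) (integrable_divergence hg hcs).norm (fun n => ?_) ?_
    · exact ((continuous_const.min (continuous_const.mul (continuous_inDist E))).mul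
        (continuous_divergence hg)).aestronglyMeasurable
    · refine Eventually.of_forall fun x => ?_
      have h0 : 0 ≤ min 1 ((1 / (n + 1 : ℝ))⁻¹ * inDist E x) :=
        le_min zero_le_one (mul_nonneg (inv_nonneg.2 (hε n).le) (inDist_nonneg E x))
      rw [norm_mul, Real.norm_of_nonneg h0]
      exact mul_le_of_le_one_left (norm_nonneg _) (min_le_left _ _)
    · refine Eventually.of_forall fun x => ?_
      by_cases hx : x ∈ E
      · rw [indicator_of_mem hx]
        refine tendsto_const_nhds.congr' ?_
        filter_upwards [(tendsto_one_div_add_atTop_nhds_zero_nat (𝕜 := ℝ)).eventually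
          (gt_mem_nhds ((inDist_pos ho hb).2 hx))] with n hn
        rw [min_eq_left, one_mul]
        rw [le_inv_mul_iff₀ (hε n), mul_one]
        exact hn.le
      · simp [indicator_of_notMem hx, inDist_of_notMem hx]
  rw [integral_indicator ho.measurableSet] at hlim
  exact le_of_tendsto' (ENNReal.Tendsto.const_mul (ENNReal.tendsto_ofReal hlim) (Or.inr (by simp)))
    fun n => hcut _ (hε n) g hg hcs hg1

/-- The real-valued version of `totalWidth`. -/
def totalWidthReal (A : Set Plane) : ℝ := (totalWidth A).toReal

section Real

variable {Q : Set Plane}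

lemma totalWidthReal_nonneg : 0 ≤ totalWidthReal Q := ENNReal.toReal_nonneg

lemma ofReal_totalWidthReal (hb : Bornology.IsBounded Q) :
    ENNReal.ofReal (totalWidthReal Q) = totalWidth Q :=
  ENNReal.ofReal_toReal (totalWidth_lt_top hb).ne

lemma ofReal_volumeReal (hb : Bornology.IsBounded Q) :
    ENNReal.ofReal (volume.real Q) = volume Q :=
  ofReal_measureReal hb.measure_lt_top.ne

lemma two_mul_eq_ofReal {a : ℝ} : 2 * ENNReal.ofReal a = ENNReal.ofReal (2 * a) := by
  rw [ENNReal.ofReal_mul zero_le_two, ENNReal.ofReal_ofNat]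

lemma totalWidthReal_mono {A B : Set Plane} (hB : Bornology.IsBounded B) (h : A ⊆ B) :
    totalWidthReal A ≤ totalWidthReal B :=
  ENNReal.toReal_mono (totalWidth_lt_top hB).ne (totalWidth_mono h)

lemma volumeReal_mono {A B : Set Plane} (hB : Bornology.IsBounded B) (h : A ⊆ B) :
    volume.real A ≤ volume.real B :=
  measureReal_mono h hB.measure_lt_top.ne

lemma inDist_mono {A B : Set Plane} (hB : Bornology.IsBounded B) (h : A ⊆ B) (x : Plane) :
    inDist A x ≤ inDist B x :=
  infDist_le_infDist_of_subset (compl_subset_compl.2 h) (compl_nonempty_of_isBounded hB)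

lemma innerSet_mono {A B : Set Plane} (hB : Bornology.IsBounded B) (h : A ⊆ B) (s : ℝ) :
    innerSet A s ⊆ innerSet B s := fun x (hx : s ≤ inDist A x) => hx.trans (inDist_mono hB h x)

lemma innerSet_anti {s t : ℝ} (h : s ≤ t) : innerSet Q t ⊆ innerSet Q s :=
  fun _ (hx : t ≤ _) => h.trans hx

lemma isBounded_innerSet (ho : IsOpen Q) (hb : Bornology.IsBounded Q) {s : ℝ} (hs : 0 < s) :
    Bornology.IsBounded (innerSet Q s) := hb.subset (innerSet_subset ho hb hs)

lemma isBounded_lt_inDist (ho : IsOpen Q) (hb : Bornology.IsBounded Q) {s : ℝ} (hs : 0 ≤ s) :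
    Bornology.IsBounded {x | s < inDist Q x} := hb.subset (lt_inDist_subset ho hb hs)

lemma two_mul_volumeReal_add_le (ho : IsOpen Q) (hb : Bornology.IsBounded Q)
    (hc : Convex ℝ Q) {s : ℝ} (hs : 0 < s) (hne : (innerSet Q s).Nonempty) :
    2 * volume.real Q + 2 * Real.pi * s ^ 2 ≤
      2 * volume.real (innerSet Q s) + s * totalWidthReal Q := by
  obtain ⟨x, hx⟩ := hne
  have h := two_mul_volume_add_le ho hb hc hs hx
  have h1 : 0 ≤ volume.real Q := measureReal_nonneg
  have h2 : 0 ≤ volume.real (innerSet Q s) := measureReal_nonneg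
  have h3 : 0 ≤ totalWidthReal Q := totalWidthReal_nonneg
  rw [← ofReal_volumeReal hb, ← ofReal_volumeReal (isBounded_innerSet ho hb hs),
    ← ofReal_totalWidthReal hb, two_mul_eq_ofReal, two_mul_eq_ofReal,
    ← ENNReal.ofReal_mul hs.le, ← ENNReal.ofReal_add (by positivity) (by positivity),
    ← ENNReal.ofReal_add (by positivity) (by positivity),
    ENNReal.ofReal_le_ofReal_iff (by positivity)] at h
  exact h

lemma two_mul_volumeReal_le (ho : IsOpen Q) (hb : Bornology.IsBounded Q)
    (hc : Convex ℝ Q) {s : ℝ} (hs : 0 < s) :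
    2 * volume.real Q ≤ 2 * volume.real (innerSet Q s) + s * totalWidthReal Q := by
  have h := two_mul_volume_diff_le_mul_totalWidth ho hb hc hs
  have h1 : 0 ≤ volume.real (Q \ innerSet Q s) := measureReal_nonneg
  have h3 : 0 ≤ totalWidthReal Q := totalWidthReal_nonneg
  rw [← ofReal_volumeReal (hb.subset sdiff_subset), ← ofReal_totalWidthReal hb, two_mul_eq_ofReal,
    ← ENNReal.ofReal_mul hs.le, ENNReal.ofReal_le_ofReal_iff (by positivity)] at h
  have h4 := measureReal_sdiff_add_inter (μ := volume) (s := Q)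
    (isClosed_innerSet Q s).measurableSet hb.measure_lt_top.ne
  have h5 := volumeReal_mono (isBounded_innerSet ho hb hs)
    (inter_subset_right : Q ∩ innerSet Q s ⊆ _)
  linarith

lemma two_mul_volumeReal_le_of_innerSet_eq_empty (ho : IsOpen Q) (hb : Bornology.IsBounded Q)
    (hc : Convex ℝ Q) {s D : ℝ} (hs : 0 < s) (hD : 0 < D)
    (hdist : ∀ x ∈ Q, ∀ y ∈ Q, dist x y ≤ D) (he : innerSet Q s = ∅) :
    2 * volume.real Q ≤ (1 - min (1 / 2) (s / D)) * s * totalWidthReal Q := by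
  have h := two_mul_volume_le_of_innerSet_eq_empty ho hb hc hs hD hdist he
  have h0 : 0 ≤ 1 - min (1 / 2) (s / D) := by
    have := min_le_left (1 / 2) (s / D)
    linarith
  have h1 : 0 ≤ volume.real Q := measureReal_nonneg
  have h3 : 0 ≤ totalWidthReal Q := totalWidthReal_nonneg
  rwa [← ofReal_volumeReal hb, ← ofReal_totalWidthReal hb, two_mul_eq_ofReal,
    ← ENNReal.ofReal_mul (by positivity), ENNReal.ofReal_le_ofReal_iff (by positivity)] at h

lemma steinerReal_le (ho : IsOpen Q) (hb : Bornology.IsBounded Q) (hc : Convex ℝ Q)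
    (hne : Q.Nonempty) {r : ℝ} (hr : 0 < r) :
    2 * volume.real Q + r * totalWidthReal Q + 2 * Real.pi * r ^ 2 ≤
      2 * volume.real (Q + ball (0 : Plane) r) := by
  have h := steiner_le ho hb hc hne hr
  have h1 : 0 ≤ volume.real Q := measureReal_nonneg
  have h2 : 0 ≤ volume.real (Q + ball (0 : Plane) r) := measureReal_nonneg
  have h3 : 0 ≤ totalWidthReal Q := totalWidthReal_nonneg
  rwa [← ofReal_volumeReal hb, ← ofReal_volumeReal (hb.add isBounded_ball),
    ← ofReal_totalWidthReal hb, two_mul_eq_ofReal, two_mul_eq_ofReal,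
    ← ENNReal.ofReal_mul hr.le, ← ENNReal.ofReal_add (by positivity) (by positivity),
    ← ENNReal.ofReal_add (by positivity) (by positivity),
    ENNReal.ofReal_le_ofReal_iff (by positivity)] at h

lemma volumeReal_lt_inDist (ho : IsOpen Q) (hb : Bornology.IsBounded Q) (hc : Convex ℝ Q) {s : ℝ}
    (hs : 0 < s) : volume.real {x | s < inDist Q x} = volume.real (innerSet Q s) := by
  rw [measureReal_def, volume_lt_inDist ho hb hc hs, measureReal_def]

lemma volumeReal_innerSet_le (ho : IsOpen Q) (hb : Bornology.IsBounded Q) (hc : Convex ℝ Q)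
    {s ε : ℝ} (hs : 0 < s) (hε : 0 < ε) :
    2 * volume.real (innerSet Q s) ≤
      2 * volume.real (innerSet Q (s + ε)) + ε * totalWidthReal {x | s < inDist Q x} := by
  have h := two_mul_volumeReal_le (isOpen_lt_inDist Q s) (isBounded_lt_inDist ho hb hs.le)
    (convex_lt_inDist ho hb hc s) hε
  rw [volumeReal_lt_inDist ho hb hc hs] at h
  have h2 := volumeReal_mono (isBounded_innerSet ho hb (add_pos hs hε))
    (innerSet_lt_inDist_subset ho hb hs hε)
  linarith

lemma continuousOn_volumeReal_innerSet (ho : IsOpen Q) (hb : Bornology.IsBounded Q)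
    (hc : Convex ℝ Q) : ContinuousOn (fun s => volume.real (innerSet Q s)) (Ioi 0) := by
  have key : ∀ s ∈ Ioi (0 : ℝ), ∀ t ∈ Ioi (0 : ℝ), s < t →
      |volume.real (innerSet Q s) - volume.real (innerSet Q t)| ≤
        totalWidthReal Q / 2 * |s - t| := by
    intro s hs t ht hst
    have h1 := volumeReal_innerSet_le ho hb hc hs (sub_pos.2 hst)
    rw [add_sub_cancel] at h1
    have h2 := totalWidthReal_mono hb (lt_inDist_subset ho hb (le_of_lt hs))
    have h3 := volumeReal_mono (isBounded_innerSet ho hb hs) (innerSet_anti (Q := Q) hst.le)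
    rw [abs_of_nonneg (sub_nonneg.2 h3), abs_of_nonpos (by linarith)]
    nlinarith [mul_le_mul_of_nonneg_left h2 (sub_pos.2 hst).le]
  refine (LipschitzOnWith.of_dist_le_mul (K := (totalWidthReal Q / 2).toNNReal)
    fun s hs t ht => ?_).continuousOn
  rw [Real.dist_eq, Real.dist_eq,
    Real.coe_toNNReal _ (div_nonneg totalWidthReal_nonneg zero_le_two)]
  rcases lt_trichotomy s t with h | rfl | h
  · exact key s hs t ht h
  · simp
  · rw [abs_sub_comm, abs_sub_comm s]
    exact key t ht s hs h

lemma volumeReal_ball (x : Plane) {R : ℝ} (hR : 0 ≤ R) :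
    volume.real (ball x R) = Real.pi * R ^ 2 := by
  rw [measureReal_def, EuclideanSpace.volume_ball_fin_two, ENNReal.toReal_mul, ENNReal.toReal_pow,
    ENNReal.toReal_ofReal hR, ENNReal.toReal_ofReal Real.pi_pos.le, mul_comm]

lemma exists_volumeReal_innerSet_eq (ho : IsOpen Q) (hb : Bornology.IsBounded Q)
    (hc : Convex ℝ Q) (hne : Q.Nonempty) :
    ∃ r > 0, volume.real (innerSet Q r) = Real.pi * r ^ 2 := by
  obtain ⟨x, hx⟩ := hne
  have hd := (inDist_pos ho hb).2 hx
  set R := inDist Q x / 2 with hR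
  have hRp : 0 < R := half_pos hd
  have hball : ball x R ⊆ innerSet Q R := by
    intro y hy
    have := (lipschitz_inDist Q).dist_le_mul x y
    rw [Real.dist_eq, NNReal.coe_one, one_mul] at this
    have h2 := (abs_le.1 this).2
    rw [mem_ball, dist_comm] at hy
    change R ≤ inDist Q y
    linarith
  have h1 : Real.pi * R ^ 2 ≤ volume.real (innerSet Q R) := by
    rw [← volumeReal_ball x hRp.le]
    exact volumeReal_mono (isBounded_innerSet ho hb hRp) hball
  set B := R + volume.real Q + 1
  have hV : 0 ≤ volume.real Q := measureReal_nonneg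
  have hB : R ≤ B := by simp only [B]; linarith
  have hBp : 0 < B := hRp.trans_le hB
  have h2 : volume.real (innerSet Q B) ≤ Real.pi * B ^ 2 := by
    have h3 := volumeReal_mono hb (innerSet_subset ho hb hBp)
    have h4 : volume.real Q ≤ B := by simp only [B]; linarith
    have h5 : 1 ≤ B := by simp only [B]; linarith
    nlinarith [Real.pi_gt_three, mul_le_mul_of_nonneg_left h5 hBp.le, sq_nonneg B]
  have hcont : ContinuousOn (fun s => Real.pi * s ^ 2 - volume.real (innerSet Q s)) (Icc R B) :=
    ContinuousOn.sub (by fun_prop) ((continuousOn_volumeReal_innerSet ho hb hc).mono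
      fun s hs => hRp.trans_le hs.1)
  obtain ⟨r, hr, hr0⟩ := intermediate_value_Icc hB hcont
    (show (0 : ℝ) ∈ Icc _ _ from ⟨by linarith, by linarith⟩)
  exact ⟨r, hRp.trans_le hr.1, by linarith [hr0]⟩

end Real

section LowerBound

variable {Ω : Set Plane}

lemma lintegral_weight {a k : ℝ} (ha : 0 ≤ a) (hk : 0 ≤ k) {B Q : Set Plane}
    (hB : MeasurableSet B) (hb : Bornology.IsBounded Q) :
    ∫⁻ x in Q, (ENNReal.ofReal a + Bᶜ.indicator (fun _ => ENNReal.ofReal k) x) =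
      ENNReal.ofReal ((a + k) * volume.real Q - k * volume.real (Q ∩ B)) := by
  have h1 := measureReal_inter_add_sdiff (μ := volume) (s := Q) hB hb.measure_lt_top.ne
  have h2 : 0 ≤ volume.real Q := measureReal_nonneg
  have h3 : 0 ≤ volume.real (Q \ B) := measureReal_nonneg
  rw [lintegral_add_left measurable_const, setLIntegral_const, lintegral_indicator hB.compl,
    lintegral_const, Measure.restrict_restrict hB.compl, Measure.restrict_apply_univ,
    inter_comm, ← sdiff_eq, ← ofReal_volumeReal hb, ← ofReal_volumeReal (hb.subset sdiff_subset),
    ← ENNReal.ofReal_mul ha, ← ENNReal.ofReal_mul hk,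
    ← ENNReal.ofReal_add (by positivity) (by positivity)]
  congr 1
  rw [← h1]
  ring

lemma mul_volumeReal_le_perimeter (ho : IsOpen Ω) (hb : Bornology.IsBounded Ω)
    (hc : Convex ℝ Ω) {s τ β : ℝ} {B : Set Plane} (hs : 0 < s) (hτ : 0 ≤ τ) (hβ : 0 ≤ β)
    (hB : IsClosed B) (hB0 : 0 < volume.real B) (hτB : τ ≤ volume.real B)
    (h0 : ∀ Q ⊆ Ω, IsOpen Q → Convex ℝ Q → innerSet Q s = ∅ →
      (1 + β) * (2 * volume.real Q) ≤ s * totalWidthReal Q)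
    (h1 : volume.real (innerSet Ω s) + β * volume.real Ω ≤ Real.pi * s ^ 2 + τ)
    (h2 : ∀ Q ⊆ Ω, IsOpen Q → Convex ℝ Q → ¬ B ⊆ Q →
      volume.real (innerSet Q s) + β * volume.real Ω ≤ Real.pi * s ^ 2)
    {F : Set Plane} (hF : MeasurableSet F) (hFΩ : F ⊆ Ω) (hP : perimeter F ≠ ∞) :
    (1 + β) * volume.real F ≤
      s * (perimeter F).toReal + τ / volume.real B * volume.real (F ∩ B) := by
  set k := τ / volume.real B with hk
  have hk0 : 0 ≤ k := by positivity
  have hk1 : k ≤ 1 := (div_le_one hB0).2 hτB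
  have hkB : k * volume.real B = τ := div_mul_cancel₀ _ hB0.ne'
  have ha : 0 ≤ 1 + β - k := by linarith
  have hkint : ∀ Q : Set Plane, 0 ≤ k * volume.real (Q ∩ B) := fun Q =>
    mul_nonneg hk0 measureReal_nonneg
  have H : ∀ Q ⊆ Ω, IsOpen Q → Convex ℝ Q →
      ∫⁻ x in Q, (ENNReal.ofReal (1 + β - k) + Bᶜ.indicator (fun _ => ENNReal.ofReal k) x) ≤
        ENNReal.ofReal (s / 2) * totalWidth Q := by
    intro Q hQ hQo hQc
    have hQb := hb.subset hQ
    rw [lintegral_weight ha hk0 hB.measurableSet hQb, ← ofReal_totalWidthReal hQb,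
      ← ENNReal.ofReal_mul (by positivity)]
    refine ENNReal.ofReal_le_ofReal ?_
    rw [sub_add_cancel]
    have hβQ := mul_le_mul_of_nonneg_left (volumeReal_mono hb hQ) hβ
    rcases (innerSet Q s).eq_empty_or_nonempty with he | hne
    · linarith [h0 Q hQ hQo hQc he, hkint Q]
    have h3 := two_mul_volumeReal_add_le hQo hQb hQc hs hne
    by_cases hBQ : B ⊆ Q
    · rw [inter_eq_right.2 hBQ, hkB]
      have h4 := volumeReal_mono (isBounded_innerSet ho hb hs) (innerSet_mono hb hQ s)
      linarith
    · linarith [h2 Q hQ hQo hQc hBQ, hkint Q]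
  have hlsc : LowerSemicontinuous fun x =>
      ENNReal.ofReal (1 + β - k) + Bᶜ.indicator (fun _ => ENNReal.ofReal k) x :=
    lowerSemicontinuous_const.add (hB.isOpen_compl.lowerSemicontinuous_indicator zero_le)
  have hFb := hb.subset hFΩ
  have h := setLIntegral_le_perimeter ho hc hlsc (fun x => ENNReal.add_ne_top.2
    ⟨ENNReal.ofReal_ne_top, by by_cases hx : x ∈ Bᶜ <;> simp [hx]⟩) ENNReal.ofReal_ne_top H
    hF hFΩ hFb
  rw [lintegral_weight ha hk0 hB.measurableSet hFb, two_mul_eq_ofReal,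
    mul_div_cancel₀ s two_ne_zero,
    ← ENNReal.ofReal_toReal hP, ← ENNReal.ofReal_mul hs.le, sub_add_cancel,
    ENNReal.ofReal_le_ofReal_iff (mul_nonneg hs.le ENNReal.toReal_nonneg)] at h
  linarith

lemma exists_gap_of_innerSet_eq_empty (hb : Bornology.IsBounded Ω) {s : ℝ} (hs : 0 < s) :
    ∃ β₀ > 0, ∀ β ≤ β₀, ∀ Q ⊆ Ω, IsOpen Q → Convex ℝ Q → innerSet Q s = ∅ →
      (1 + β) * (2 * volume.real Q) ≤ s * totalWidthReal Q := by
  obtain ⟨C, hC⟩ := Metric.isBounded_iff.1 hb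
  set D := max C 1 with hD
  have hDp : 0 < D := one_pos.trans_le (le_max_right _ _)
  set m := min (1 / 2) (s / D) with hm
  have hmp : 0 < m := lt_min (by norm_num) (by positivity)
  refine ⟨m, hmp, fun β hβ Q hQ hQo hQc he => ?_⟩
  have h := two_mul_volumeReal_le_of_innerSet_eq_empty hQo (hb.subset hQ) hQc hs hDp
    (fun x hx y hy => (hC (hQ hx) (hQ hy)).trans (le_max_left _ _)) he
  have hV : 0 ≤ volume.real Q := measureReal_nonneg
  have hW : 0 ≤ s * totalWidthReal Q := mul_nonneg hs.le totalWidthReal_nonneg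
  calc (1 + β) * (2 * volume.real Q) ≤ (1 + m) * (2 * volume.real Q) := by gcongr
    _ ≤ (1 + m) * ((1 - m) * s * totalWidthReal Q) := by gcongr
    _ = s * totalWidthReal Q - m ^ 2 * (s * totalWidthReal Q) := by ring
    _ ≤ s * totalWidthReal Q := sub_le_self _ (by positivity)

lemma volumeReal_innerSet_add_le (ho : IsOpen Ω) (hb : Bornology.IsBounded Ω) {s η : ℝ}
    (hs : 0 < s) (hη : 0 ≤ η) {p c : Plane} {B Q : Set Plane} (hcη : ball c η ⊆ innerSet Ω s)
    (hBp : B ⊆ closedBall p η) (hpc : dist p c + 2 * η ≤ s) (hQ : Q ⊆ Ω) (hBQ : ¬ B ⊆ Q) :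
    volume.real (innerSet Q s) + Real.pi * η ^ 2 ≤ volume.real (innerSet Ω s) := by
  obtain ⟨x, hxB, hxQ⟩ := not_subset.1 hBQ
  have hdisj : Disjoint (innerSet Q s) (ball c η) := by
    rw [Set.disjoint_left]
    intro y (hy : s ≤ inDist Q y) hyc
    have h1 : inDist Q y ≤ dist y x := infDist_le_dist_of_mem hxQ
    have h2 := mem_ball'.1 hyc
    have h3 := mem_closedBall'.1 (hBp hxB)
    have h4 := dist_triangle4 y c p x
    rw [dist_comm y c, dist_comm c p] at h4
    linarith
  have hbd := isBounded_innerSet ho hb hs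
  have hsub := innerSet_mono hb hQ s
  rw [← volumeReal_ball c hη, ← measureReal_union hdisj measurableSet_ball
    (hbd.subset hsub).measure_lt_top.ne measure_ball_lt_top.ne]
  exact volumeReal_mono hbd (union_subset hsub hcη)

lemma volumeReal_closedBall (x : Plane) {R : ℝ} (hR : 0 ≤ R) :
    volume.real (closedBall x R) = Real.pi * R ^ 2 := by
  rw [Measure.addHaar_real_closedBall_eq_addHaar_real_ball, volumeReal_ball _ hR]

/-- The isoperimetric inequality whose constant is the radius `r` of the inner Cheeger formula. -/
lemma volumeReal_le_mul_perimeter (ho : IsOpen Ω) (hb : Bornology.IsBounded Ω)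
    (hc : Convex ℝ Ω) {r : ℝ} (hr : 0 < r) (hA : volume.real (innerSet Ω r) = Real.pi * r ^ 2)
    {F : Set Plane} (hF : MeasurableSet F) (hFΩ : F ⊆ Ω) (hP : perimeter F ≠ ∞) :
    volume.real F ≤ r * (perimeter F).toReal := by
  obtain ⟨β₀, hβ₀, h0⟩ := exists_gap_of_innerSet_eq_empty hb hr
  have hB : 0 < volume.real (closedBall (0 : Plane) 1) := by
    rw [volumeReal_closedBall _ zero_le_one]
    positivity
  have h := mul_volumeReal_le_perimeter ho hb hc hr le_rfl le_rfl isClosed_closedBall hB hB.le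
    (h0 0 hβ₀.le) (by rw [hA]; simp) (fun Q hQ _ _ _ => by
      have := volumeReal_mono (isBounded_innerSet ho hb hr) (innerSet_mono hb hQ r)
      linarith) hF hFΩ hP
  simpa using h

/-- A set with equality in `volumeReal_le_mul_perimeter` has positive density at each point of
the candidate Cheeger set. -/
lemma exists_density_bound (ho : IsOpen Ω) (hb : Bornology.IsBounded Ω)
    (hc : Convex ℝ Ω) (hne : Ω.Nonempty) {r : ℝ} (hr : 0 < r)
    (hA : volume.real (innerSet Ω r) = Real.pi * r ^ 2)
    {F : Set Plane} (hF : MeasurableSet F) (hFΩ : F ⊆ Ω) (hP : perimeter F ≠ ∞)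
    (hFP : volume.real F = r * (perimeter F).toReal) {p : Plane}
    (hp : p ∈ {x | r < inDist Ω x} + ball (0 : Plane) r) :
    ∃ η > 0, ∀ δ ∈ Ioc 0 η, volume.real F * volume.real (closedBall p δ) ≤
      volume.real Ω * volume.real (F ∩ closedBall p δ) := by
  obtain ⟨c, hcr, v, hv, rfl⟩ := hp
  rw [mem_ball_zero_iff] at hv
  obtain ⟨η₁, hη₁, hball⟩ := Metric.isOpen_iff.1 (isOpen_lt_inDist Ω r) c hcr
  set η := min η₁ ((r - ‖v‖) / 2) with hη
  have hηp : 0 < η := lt_min hη₁ (by linarith)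
  have hη2 : η ≤ (r - ‖v‖) / 2 := min_le_right _ _
  have hball' : ball c η ⊆ innerSet Ω r := fun x hx => by
    have h : r < inDist Ω x := hball (ball_subset_ball (min_le_left _ _) hx)
    exact le_of_lt h
  have hdist : dist (c + v) c + 2 * η ≤ r := by
    rw [dist_eq_norm, add_sub_cancel_left]
    linarith
  refine ⟨η, hηp, fun δ hδ => ?_⟩
  have hVΩ : 0 < volume.real Ω :=
    ENNReal.toReal_pos (ho.measure_pos volume hne).ne' hb.measure_lt_top.ne
  have hVB : 0 < volume.real (closedBall (c + v) δ) := by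
    have := hδ.1
    rw [volumeReal_closedBall _ hδ.1.le]
    positivity
  obtain ⟨β₀, hβ₀, h0⟩ := exists_gap_of_innerSet_eq_empty hb hr
  set τ := min (min (volume.real (closedBall (c + v) δ)) (Real.pi * η ^ 2)) (β₀ * volume.real Ω)
    with hτ
  have hτp : 0 < τ := lt_min (lt_min hVB (by positivity)) (by positivity)
  have hτ1 : τ ≤ volume.real (closedBall (c + v) δ) := (min_le_left _ _).trans (min_le_left _ _)
  have hτ2 : τ ≤ Real.pi * η ^ 2 := (min_le_left _ _).trans (min_le_right _ _)
  have hτ3 : τ ≤ β₀ * volume.real Ω := min_le_right _ _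
  have hβΩ : τ / volume.real Ω * volume.real Ω = τ := div_mul_cancel₀ _ hVΩ.ne'
  have h := mul_volumeReal_le_perimeter ho hb hc (β := τ / volume.real Ω) hr hτp.le (by positivity)
    isClosed_closedBall hVB hτ1 (h0 _ ((div_le_iff₀ hVΩ).2 hτ3)) (by rw [hA, hβΩ])
    (fun Q hQ _ _ hBQ => by
      have := volumeReal_innerSet_add_le ho hb hr hηp.le hball'
        (closedBall_subset_closedBall hδ.2) hdist hQ hBQ
      rw [hβΩ]
      linarith) hF hFΩ hP
  rw [← hFP, add_mul, one_mul, add_le_add_iff_left, div_mul_eq_mul_div, div_mul_eq_mul_div,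
    div_le_div_iff₀ hVΩ hVB, mul_assoc, mul_assoc, mul_le_mul_iff_right₀ hτp] at h
  linarith

end LowerBound

section UpperBound

variable {Ω : Set Plane}

/-- A set with equality in `volumeReal_le_mul_perimeter` has perimeter controlled by inner
parallel sets with a smaller radius. -/
lemma perimeter_le_of_lt (ho : IsOpen Ω) (hb : Bornology.IsBounded Ω)
    (hc : Convex ℝ Ω) {r ε η : ℝ} {c : Plane} (hε : 0 < ε) (hη : 0 < η) (hηr : 2 * η ≤ r - ε)
    (hcη : ball c η ⊆ innerSet Ω r) (hA : volume.real (innerSet Ω r) = Real.pi * r ^ 2)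
    (hAε : volume.real (innerSet Ω (r - ε)) - Real.pi * (r - ε) ^ 2 ≤ Real.pi * η ^ 2)
    {F : Set Plane} (hF : MeasurableSet F) (hFΩ : F ⊆ Ω) (hP : perimeter F ≠ ∞)
    (hFP : volume.real F = r * (perimeter F).toReal) :
    2 * (perimeter F).toReal ≤
      totalWidthReal {x | r - ε < inDist Ω x} + 4 * Real.pi * r := by
  set s := r - ε with hs
  have hsp : 0 < s := by linarith
  set τ := volume.real (innerSet Ω s) - Real.pi * s ^ 2 with hτ
  have hsub := innerSet_anti (Q := Ω) (show s ≤ r by linarith)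
  have hτ0 : 0 ≤ τ := by
    have h1 := volumeReal_mono (isBounded_innerSet ho hb hsp) hsub
    have h2 : Real.pi * s ^ 2 ≤ Real.pi * r ^ 2 := by
      gcongr
      linarith
    linarith
  have hB := volumeReal_closedBall c hη.le
  have hBp : 0 < volume.real (closedBall c η) := by
    rw [hB]
    positivity
  obtain ⟨β₀, hβ₀, h0⟩ := exists_gap_of_innerSet_eq_empty hb hsp
  have h := mul_volumeReal_le_perimeter ho hb hc (β := 0) hsp hτ0 le_rfl isClosed_closedBall hBp
    (by rwa [hB]) (h0 0 hβ₀.le) (by linarith) (fun Q hQ _ _ hBQ => by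
      have := volumeReal_innerSet_add_le ho hb hsp hη.le (hcη.trans hsub) le_rfl
        (by rwa [dist_self, zero_add]) hQ hBQ
      linarith) hF hFΩ hP
  have h1 : τ / volume.real (closedBall c η) * volume.real (F ∩ closedBall c η) ≤ τ := by
    rw [div_mul_eq_mul_div, div_le_iff₀ hBp]
    exact mul_le_mul_of_nonneg_left (volumeReal_mono isBounded_closedBall inter_subset_right) hτ0
  have h2 := volumeReal_innerSet_le ho hb hc hsp hε
  rw [hs, sub_add_cancel, ← hs, hA] at h2
  have h3 : ε * (2 * (perimeter F).toReal) ≤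
      ε * (totalWidthReal {x | s < inDist Ω x} + 4 * Real.pi * r) := by
    have : 0 ≤ Real.pi * ε ^ 2 := by positivity
    nlinarith
  exact le_of_mul_le_mul_left h3 hε

lemma homothety_image_lt_inDist_subset (ho : IsOpen Ω) (hb : Bornology.IsBounded Ω)
    (hc : Convex ℝ Ω) {s t R : ℝ} {x : Plane} (hs : 0 ≤ s) (ht0 : 0 < t) (ht1 : t ≤ 1)
    (hx : x ∈ Ω) (hR : R ≤ (1 - t) * inDist Ω x + t * s) :
    AffineMap.homothety x t '' {y | s < inDist Ω y} ⊆ {y | R < inDist Ω y} := by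
  rintro _ ⟨y, hy, rfl⟩
  have hy' : s < inDist Ω y := hy
  have h := (concaveOn_inDist ho hb hc).2 hx (lt_inDist_subset ho hb hs hy)
    (sub_nonneg.2 ht1) ht0.le (by ring)
  have he : AffineMap.homothety x t y = (1 - t) • x + t • y := by
    rw [homothety_eq]
    module
  change R < inDist Ω (AffineMap.homothety x t y)
  rw [he]
  simp only [smul_eq_mul] at h
  have := mul_lt_mul_of_pos_left hy' ht0
  linarith

lemma nonempty_lt_inDist (ho : IsOpen Ω) (hb : Bornology.IsBounded Ω) (hc : Convex ℝ Ω) {r : ℝ}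
    (hr : 0 < r) (hA : volume.real (innerSet Ω r) = Real.pi * r ^ 2) :
    {x | r < inDist Ω x}.Nonempty := by
  rw [nonempty_iff_ne_empty]
  intro he
  have h := volumeReal_lt_inDist ho hb hc hr
  rw [he, measureReal_empty, hA] at h
  have : 0 < Real.pi * r ^ 2 := by positivity
  linarith

/-- A set with equality in `volumeReal_le_mul_perimeter` has at most the perimeter of
the candidate Cheeger set. -/
lemma two_mul_perimeter_le_of_volumeReal_eq (ho : IsOpen Ω) (hb : Bornology.IsBounded Ω)
    (hc : Convex ℝ Ω) {r : ℝ} (hr : 0 < r)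
    (hA : volume.real (innerSet Ω r) = Real.pi * r ^ 2)
    {F : Set Plane} (hF : MeasurableSet F) (hFΩ : F ⊆ Ω) (hP : perimeter F ≠ ∞)
    (hFP : volume.real F = r * (perimeter F).toReal) :
    2 * (perimeter F).toReal ≤ totalWidthReal {x | r < inDist Ω x} + 4 * Real.pi * r := by
  obtain ⟨c, hcr⟩ := nonempty_lt_inDist ho hb hc hr hA
  have hcΩ := lt_inDist_subset ho hb hr.le hcr
  obtain ⟨η₁, hη₁, hball⟩ := Metric.isOpen_iff.1 (isOpen_lt_inDist Ω r) c hcr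
  set η := min η₁ (r / 3) with hη
  have hηp : 0 < η := lt_min hη₁ (by positivity)
  have hη3 : η ≤ r / 3 := min_le_right _ _
  have hcη : ball c η ⊆ innerSet Ω r := fun x hx => by
    have h : r < inDist Ω x := hball (ball_subset_ball (min_le_left _ _) hx)
    exact le_of_lt h
  have hlim : Tendsto (fun ε => r - ε) (𝓝[>] 0) (𝓝 r) := by
    have : Tendsto (fun ε : ℝ => r - ε) (𝓝 0) (𝓝 (r - 0)) :=
      tendsto_const_nhds.sub tendsto_id
    rw [sub_zero] at this
    exact this.mono_left nhdsWithin_le_nhds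
  have hτ : Tendsto (fun ε => volume.real (innerSet Ω (r - ε)) - Real.pi * (r - ε) ^ 2)
      (𝓝[>] 0) (𝓝 (volume.real (innerSet Ω r) - Real.pi * r ^ 2)) :=
    (((continuousOn_volumeReal_innerSet ho hb hc).continuousAt (Ioi_mem_nhds hr)).tendsto.comp
      hlim).sub ((hlim.pow 2).const_mul _)
  rw [hA, sub_self] at hτ
  set ρ := inDist Ω c - r with hρ
  have hρp : 0 < ρ := sub_pos.2 hcr
  have ht : Tendsto (fun ε => ρ / (ρ + ε)) (𝓝[>] 0) (𝓝 1) := by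
    have : Tendsto (fun ε : ℝ => ρ / (ρ + ε)) (𝓝 0) (𝓝 (ρ / (ρ + 0))) :=
      tendsto_const_nhds.div (tendsto_const_nhds.add tendsto_id) (by simpa using hρp.ne')
    rw [add_zero, div_self hρp.ne'] at this
    exact this.mono_left nhdsWithin_le_nhds
  have hl := ht.mul_const (2 * (perimeter F).toReal)
  have hu := (ht.mul_const (4 * Real.pi * r)).const_add (totalWidthReal {x | r < inDist Ω x})
  rw [one_mul] at hl hu
  refine le_of_tendsto_of_tendsto hl hu ?_
  filter_upwards [hτ.eventually_lt_const (show 0 < Real.pi * η ^ 2 by positivity),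
    Ioo_mem_nhdsGT (show 0 < r / 3 by positivity)] with ε h1 h2
  have hε := h2.1
  have hεr := h2.2
  have h3 := perimeter_le_of_lt ho hb hc hε hηp (by linarith) hcη hA h1.le hF hFΩ hP hFP
  have htp : 0 < ρ / (ρ + ε) := by positivity
  have h4 : totalWidth (AffineMap.homothety c (ρ / (ρ + ε)) '' {x | r - ε < inDist Ω x}) ≤
      totalWidth {x | r < inDist Ω x} :=
    totalWidth_mono (homothety_image_lt_inDist_subset ho hb hc (by linarith) htp
      ((div_le_one (by positivity)).2 (by linarith)) hcΩ (by
        rw [show inDist Ω c = ρ + r by ring]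
        field_simp
        linarith))
  rw [totalWidth_homothety c htp.le] at h4
  have h5 := ENNReal.toReal_mono (totalWidth_lt_top (isBounded_lt_inDist ho hb hr.le)).ne h4
  rw [ENNReal.toReal_mul, ENNReal.toReal_ofReal htp.le] at h5
  change _ ≤ totalWidthReal _ at h5
  have h6 := mul_le_mul_of_nonneg_left h3 htp.le
  rw [mul_add] at h6
  exact h6.trans (add_le_add_left h5 _)

end UpperBound

section Candidate

variable {Ω : Set Plane}

lemma setOf_lt_infDist_frontier (ho : IsOpen Ω) (hb : Bornology.IsBounded Ω) {r : ℝ}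
    (hr : 0 ≤ r) : {x ∈ Ω | r < infDist x (frontier Ω)} = {x | r < inDist Ω x} := by
  have hne : Ω ≠ univ := by
    rw [← nonempty_compl]
    exact compl_nonempty_of_isBounded hb
  have hfr : frontier Ω ⊆ Ωᶜ := by
    rw [frontier_eq_closure_inter_closure, ho.isClosed_compl.closure_eq]
    exact inter_subset_right
  have key : ∀ x ∈ Ω, infDist x (frontier Ω) = inDist Ω x := by
    intro x hx
    obtain ⟨y, hy, hxy⟩ := exists_mem_frontier_infDist_compl_eq_dist hx hne
    exact le_antisymm ((infDist_le_dist_of_mem hy).trans_eq hxy.symm)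
      (infDist_le_infDist_of_subset hfr ⟨y, hy⟩)
  ext x
  constructor
  · rintro ⟨hx, hxr⟩
    rw [key x hx] at hxr
    exact hxr
  · intro hx
    have hxΩ := lt_inDist_subset ho hb hr hx
    refine ⟨hxΩ, ?_⟩
    rw [key x hxΩ]
    exact hx

lemma add_ball_subset (hb : Bornology.IsBounded Ω) {r : ℝ} :
    {x | r < inDist Ω x} + ball (0 : Plane) r ⊆ Ω := by
  rintro _ ⟨c, hc, v, hv, rfl⟩
  have hc' : r < inDist Ω c := hc
  exact (ball_subset_iff hb).2 hc'.le (by simpa using hv)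

lemma add_ball_eq_iUnion_ball (ho : IsOpen Ω) (hb : Bornology.IsBounded Ω) (hc : Convex ℝ Ω)
    {r : ℝ} (hr : 0 < r) (hne : {x | r < inDist Ω x}.Nonempty) :
    {x | r < inDist Ω x} + ball (0 : Plane) r = ⋃ (c) (_ : ball c r ⊆ Ω), ball c r := by
  ext x
  simp only [mem_iUnion, exists_prop]
  constructor
  · rintro ⟨c, hcr, v, hv, rfl⟩
    have hc' : r < inDist Ω c := hcr
    exact ⟨c, (ball_subset_iff hb).2 hc'.le, by simpa using hv⟩
  · rintro ⟨c, hcb, hx⟩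
    obtain ⟨y, hy⟩ := hne
    have hy' : r < inDist Ω y := hy
    have hcr := (ball_subset_iff hb).1 hcb
    have hcΩ := hcb (mem_ball_self hr)
    have hyΩ := lt_inDist_subset ho hb hr.le hy
    have hcont : Tendsto (fun t : ℝ => dist x ((1 - t) • c + t • y)) (𝓝[>] 0)
        (𝓝 (dist x c)) := by
      have : Continuous fun t : ℝ => dist x ((1 - t) • c + t • y) := by fun_prop
      have h := this.tendsto 0
      simp only [sub_zero, one_smul, zero_smul, add_zero] at h
      exact h.mono_left nhdsWithin_le_nhds
    obtain ⟨t, htx, ht⟩ := ((hcont.eventually_lt_const hx).and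
      (Ioo_mem_nhdsGT (zero_lt_one' ℝ))).exists
    have h := (concaveOn_inDist ho hb hc).2 hcΩ hyΩ (sub_nonneg.2 ht.2.le) ht.1.le (by ring)
    simp only [smul_eq_mul] at h
    refine ⟨(1 - t) • c + t • y, ?_, x - ((1 - t) • c + t • y), ?_, add_sub_cancel _ _⟩
    · change r < inDist Ω _
      have h1 := mul_le_mul_of_nonneg_left hcr (sub_nonneg.2 ht.2.le)
      have h2 := mul_lt_mul_of_pos_left hy' ht.1
      linarith
    · rwa [mem_ball_zero_iff, ← dist_eq_norm]

lemma perimeter_div_eq_inv_iff {r : ℝ} (hr : 0 < r) {F : Set Plane}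
    (hb : Bornology.IsBounded F) (hF : 0 < volume F) :
    perimeter F / volume F = (ENNReal.ofReal r)⁻¹ ↔
      perimeter F ≠ ∞ ∧ volume.real F = r * (perimeter F).toReal := by
  have hV := hb.measure_lt_top (μ := volume)
  have hr0 : ENNReal.ofReal r ≠ 0 := (ENNReal.ofReal_pos.2 hr).ne'
  constructor
  · intro h
    have hP : perimeter F ≠ ∞ := by
      intro hP
      rw [hP, ENNReal.top_div_of_lt_top hV] at h
      exact ENNReal.inv_ne_top.2 hr0 h.symm
    refine ⟨hP, ?_⟩
    have h1 := congr_arg ENNReal.toReal h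
    rw [ENNReal.toReal_div, ENNReal.toReal_inv, ENNReal.toReal_ofReal hr.le,
      ← measureReal_def] at h1
    have hV0 : 0 < volume.real F := ENNReal.toReal_pos hF.ne' hV.ne
    field_simp at h1
    linarith
  · rintro ⟨hP, h⟩
    rw [← ofReal_volumeReal hb, h, ENNReal.ofReal_mul hr.le, ENNReal.ofReal_toReal hP]
    have hP0 : perimeter F ≠ 0 := by
      intro hP0
      rw [hP0, ENNReal.toReal_zero, mul_zero] at h
      exact (ENNReal.toReal_pos hF.ne' hV.ne).ne' h
    rw [ENNReal.div_eq_inv_mul, ENNReal.mul_inv (Or.inl hr0) (Or.inl ENNReal.ofReal_ne_top),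
      mul_assoc, ENNReal.inv_mul_cancel hP0 hP, mul_one]

lemma inv_le_perimeter_div (ho : IsOpen Ω) (hb : Bornology.IsBounded Ω)
    (hc : Convex ℝ Ω) {r : ℝ} (hr : 0 < r) (hA : volume.real (innerSet Ω r) = Real.pi * r ^ 2)
    {F : Set Plane} (hF : MeasurableSet F) (hFΩ : F ⊆ Ω)
    (hF0 : 0 < volume F) : (ENNReal.ofReal r)⁻¹ ≤ perimeter F / volume F := by
  have hFb := hb.subset hFΩ
  by_cases hP : perimeter F = ∞
  · rw [hP, ENNReal.top_div_of_lt_top hFb.measure_lt_top]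
    exact le_top
  have h := volumeReal_le_mul_perimeter ho hb hc hr hA hF hFΩ hP
  have h' := ENNReal.ofReal_le_ofReal h
  rw [ofReal_volumeReal hFb, ENNReal.ofReal_mul hr.le, ENNReal.ofReal_toReal hP] at h'
  rw [ENNReal.inv_le_iff_inv_le, ENNReal.inv_div (Or.inr hP) (Or.inl hF0.ne')]
  exact ENNReal.div_le_of_le_mul h'

lemma mul_totalWidthReal_le (ho : IsOpen Ω) (hb : Bornology.IsBounded Ω)
    (hc : Convex ℝ Ω) {r : ℝ} (hr : 0 < r) (hA : volume.real (innerSet Ω r) = Real.pi * r ^ 2) :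
    r * (totalWidthReal {x | r < inDist Ω x} + 4 * Real.pi * r) ≤
      2 * volume.real ({x | r < inDist Ω x} + ball (0 : Plane) r) := by
  have h := steinerReal_le (isOpen_lt_inDist Ω r) (isBounded_lt_inDist ho hb hr.le)
    (convex_lt_inDist ho hb hc r) (nonempty_lt_inDist ho hb hc hr hA) hr
  rw [volumeReal_lt_inDist ho hb hc hr, hA] at h
  linarith

lemma volume_add_ball_pos (ho : IsOpen Ω) (hb : Bornology.IsBounded Ω)
    (hc : Convex ℝ Ω) {r : ℝ} (hr : 0 < r) (hA : volume.real (innerSet Ω r) = Real.pi * r ^ 2) :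
    0 < volume ({x | r < inDist Ω x} + ball (0 : Plane) r) :=
  isOpen_ball.add_left.measure_pos volume
    ((nonempty_lt_inDist ho hb hc hr hA).add ⟨0, mem_ball_self hr⟩)

lemma perimeter_add_ball_div (ho : IsOpen Ω) (hb : Bornology.IsBounded Ω)
    (hc : Convex ℝ Ω) {r : ℝ} (hr : 0 < r) (hA : volume.real (innerSet Ω r) = Real.pi * r ^ 2) :
    perimeter ({x | r < inDist Ω x} + ball (0 : Plane) r) /
      volume ({x | r < inDist Ω x} + ball (0 : Plane) r) = (ENNReal.ofReal r)⁻¹ := by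
  have hUb := isBounded_lt_inDist ho hb hr.le
  have hUc := convex_lt_inDist ho hb hc r
  have hUo := isOpen_lt_inDist Ω r
  set E := {x | r < inDist Ω x} + ball (0 : Plane) r with hE
  have hEo : IsOpen E := isOpen_ball.add_left
  have hEΩ : E ⊆ Ω := add_ball_subset hb
  have hEb := hb.subset hEΩ
  have h1 := (two_mul_perimeter_le_totalWidth hEo hEb (hUc.add (convex_ball _ _))).trans
    (totalWidth_add_ball_le hUo hUc.isPreconnected hUb hr.le)
  have hfin : totalWidth {x | r < inDist Ω x} + ENNReal.ofReal (4 * Real.pi * r) ≠ ∞ :=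
    ENNReal.add_ne_top.2 ⟨(totalWidth_lt_top hUb).ne, ENNReal.ofReal_ne_top⟩
  have hP : perimeter E ≠ ∞ := by
    intro hP
    rw [hP, ENNReal.mul_top two_ne_zero, top_le_iff] at h1
    exact hfin h1
  have h2 := ENNReal.toReal_mono hfin h1
  rw [ENNReal.toReal_mul, ENNReal.toReal_ofNat,
    ENNReal.toReal_add (totalWidth_lt_top hUb).ne ENNReal.ofReal_ne_top,
    ENNReal.toReal_ofReal (by positivity)] at h2
  change _ ≤ totalWidthReal _ + _ at h2
  refine (perimeter_div_eq_inv_iff hr hEb (volume_add_ball_pos ho hb hc hr hA)).2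
    ⟨hP, le_antisymm (volumeReal_le_mul_perimeter ho hb hc hr hA hEo.measurableSet hEΩ hP) ?_⟩
  have h3 := mul_totalWidthReal_le ho hb hc hr hA
  have h4 := mul_le_mul_of_nonneg_left h2 hr.le
  linarith

lemma cheegerConstant_eq_inv (ho : IsOpen Ω) (hb : Bornology.IsBounded Ω)
    (hc : Convex ℝ Ω) {r : ℝ} (hr : 0 < r) (hA : volume.real (innerSet Ω r) = Real.pi * r ^ 2) :
    cheegerConstant Ω = (ENNReal.ofReal r)⁻¹ := by
  refine le_antisymm ?_ (le_iInf₂ fun F hF =>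
    inv_le_perimeter_div ho hb hc hr hA hF.1 hF.2.1 hF.2.2)
  rw [← perimeter_add_ball_div ho hb hc hr hA]
  exact iInf₂_le _ ⟨isOpen_ball.add_left.measurableSet, add_ball_subset hb,
    volume_add_ball_pos ho hb hc hr hA⟩

lemma ae_mem_of_perimeter_eq (ho : IsOpen Ω) (hb : Bornology.IsBounded Ω)
    (hc : Convex ℝ Ω) {r : ℝ} (hr : 0 < r) (hA : volume.real (innerSet Ω r) = Real.pi * r ^ 2)
    {F : Set Plane} (hF : MeasurableSet F) (hFΩ : F ⊆ Ω) (hF0 : 0 < volume F)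
    (hP : perimeter F ≠ ∞) (hFP : volume.real F = r * (perimeter F).toReal) :
    volume (({x | r < inDist Ω x} + ball (0 : Plane) r) \ F) = 0 := by
  have hFb := hb.subset hFΩ
  have hVF : 0 < volume.real F := ENNReal.toReal_pos hF0.ne' hFb.measure_lt_top.ne
  have hVΩ : 0 < volume.real Ω := hVF.trans_le (volumeReal_mono hb hFΩ)
  have hne : Ω.Nonempty := (nonempty_of_measure_ne_zero hF0.ne').mono hFΩ
  refine measure_mono_null ?_
    (ae_iff.1 (Besicovitch.ae_tendsto_measure_inter_div_of_measurableSet volume hF))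
  rintro p ⟨hpE, hpF⟩ hlim
  rw [indicator_of_notMem hpF] at hlim
  obtain ⟨η, hη, hdens⟩ := exists_density_bound ho hb hc hne hr hA hF hFΩ hP hFP hpE
  have hκ : (0 : ℝ≥0∞) < ENNReal.ofReal (volume.real F / volume.real Ω) :=
    ENNReal.ofReal_pos.2 (by positivity)
  obtain ⟨δ, hlt, hδ⟩ := ((hlim.eventually_lt_const hκ).and (Ioc_mem_nhdsGT hη)).exists
  have h := hdens δ hδ
  have hB : 0 < volume.real (closedBall p δ) := by
    have := hδ.1
    rw [volumeReal_closedBall p hδ.1.le]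
    positivity
  rw [← ofReal_volumeReal isBounded_closedBall,
    ← ofReal_volumeReal (hFb.subset inter_subset_left), ← ENNReal.ofReal_div_of_pos hB,
    ENNReal.ofReal_lt_ofReal_iff (by positivity), div_lt_div_iff₀ hB hVΩ] at hlt
  linarith

lemma volume_symmDiff_eq_zero (ho : IsOpen Ω) (hb : Bornology.IsBounded Ω)
    (hc : Convex ℝ Ω) {r : ℝ} (hr : 0 < r) (hA : volume.real (innerSet Ω r) = Real.pi * r ^ 2)
    {F : Set Plane} (hF : MeasurableSet F) (hFΩ : F ⊆ Ω) (hF0 : 0 < volume F)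
    (h : perimeter F / volume F = (ENNReal.ofReal r)⁻¹) :
    volume (symmDiff F ({x | r < inDist Ω x} + ball (0 : Plane) r)) = 0 := by
  have hFb := hb.subset hFΩ
  obtain ⟨hP, hFP⟩ := (perimeter_div_eq_inv_iff hr hFb hF0).1 h
  have h1 := ae_mem_of_perimeter_eq ho hb hc hr hA hF hFΩ hF0 hP hFP
  have h2 := mul_le_mul_of_nonneg_left
    (two_mul_perimeter_le_of_volumeReal_eq ho hb hc hr hA hF hFΩ hP hFP) hr.le
  have h3 := mul_totalWidthReal_le ho hb hc hr hA
  have hEm : MeasurableSet ({x | r < inDist Ω x} + ball (0 : Plane) r) :=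
    isOpen_ball.add_left.measurableSet
  have hEb := hb.subset (add_ball_subset hb : {x | r < inDist Ω x} + ball (0 : Plane) r ⊆ Ω)
  set E := {x | r < inDist Ω x} + ball (0 : Plane) r with hE
  have h4 := measureReal_inter_add_sdiff (μ := volume) (s := E) hF hEb.measure_lt_top.ne
  have h5 := measureReal_inter_add_sdiff (μ := volume) (s := F) hEm hFb.measure_lt_top.ne
  rw [measureReal_def (s := E \ F), h1, ENNReal.toReal_zero, inter_comm] at h4
  have h6 : volume.real (F \ E) = 0 :=
    le_antisymm (by linarith) measureReal_nonneg
  rw [measure_symmDiff_eq hF.nullMeasurableSet hEm.nullMeasurableSet, h1, add_zero,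
    ← ofReal_volumeReal (hFb.subset sdiff_subset), h6, ENNReal.ofReal_zero]

end Candidate

end PlanarCheeger

/-- **Structure of the Cheeger set of a planar convex body.** Let `Ω ⊆ ℝ²` be a bounded open
convex set and `r = h(Ω)⁻¹`.  Then the Cheeger set `E` of `Ω` is unique (up to null sets), it
is the union of all balls of radius `r` contained in `Ω`, equivalently
`E = E_r + B_r(0)` (Minkowski sum) where `E_r = {x ∈ Ω : dist(x, ∂Ω) > r}`, and the inner
Cheeger formula `|E_r| = π r²` holds. -/
theorem convex_cheegerSet_union_of_balls (Ω : Set (EuclideanSpace ℝ (Fin 2)))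
    (hΩne : Ω.Nonempty) (hΩop : IsOpen Ω) (hΩbd : Bornology.IsBounded Ω)
    (hΩcv : Convex ℝ Ω)
    (r : ℝ) (hr : ENNReal.ofReal r = (cheegerConstant Ω)⁻¹) :
    ∃ E : Set (EuclideanSpace ℝ (Fin 2)), IsCheegerSet Ω E ∧
      (∀ F, IsCheegerSet Ω F → volume (symmDiff F E) = 0) ∧
      (E = ⋃ (c : EuclideanSpace ℝ (Fin 2)) (_ : ball c r ⊆ Ω), ball c r) ∧
      (E = {x ∈ Ω | r < infDist x (frontier Ω)} + ball (0 : EuclideanSpace ℝ (Fin 2)) r) ∧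
      volume {x ∈ Ω | r < infDist x (frontier Ω)} = ENNReal.ofReal (Real.pi * r ^ 2) := by
  obtain ⟨r₀, hr₀, hA⟩ := PlanarCheeger.exists_volumeReal_innerSet_eq hΩop hΩbd hΩcv hΩne
  have hch := PlanarCheeger.cheegerConstant_eq_inv hΩop hΩbd hΩcv hr₀ hA
  obtain rfl : r = r₀ := by
    rw [hch, inv_inv] at hr
    have hrpos : 0 < r := by
      rw [← ENNReal.ofReal_pos, hr]
      exact ENNReal.ofReal_pos.2 hr₀
    exact (ENNReal.ofReal_eq_ofReal_iff hrpos.le hr₀.le).1 hr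
  rw [PlanarCheeger.setOf_lt_infDist_frontier hΩop hΩbd hr₀.le]
  refine ⟨_, ⟨isOpen_ball.add_left.measurableSet, PlanarCheeger.add_ball_subset hΩbd,
    PlanarCheeger.volume_add_ball_pos hΩop hΩbd hΩcv hr₀ hA, ?_⟩, ?_,
    PlanarCheeger.add_ball_eq_iUnion_ball hΩop hΩbd hΩcv hr₀
      (PlanarCheeger.nonempty_lt_inDist hΩop hΩbd hΩcv hr₀ hA), rfl, ?_⟩
  · rw [hch, PlanarCheeger.perimeter_add_ball_div hΩop hΩbd hΩcv hr₀ hA]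
  · rintro F ⟨hF, hFΩ, hF0, h⟩
    exact PlanarCheeger.volume_symmDiff_eq_zero hΩop hΩbd hΩcv hr₀ hA hF hFΩ hF0 (h.trans hch)
  · rw [PlanarCheeger.volume_lt_inDist hΩop hΩbd hΩcv hr₀, ← hA, PlanarCheeger.ofReal_volumeReal
      (PlanarCheeger.isBounded_innerSet hΩop hΩbd hr₀)]
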